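/- The only rational points on the genus 2 curve Y^2 = 4X^5 - 3 are the point at infinity and (1, ±1). -/

import Mathlib

open Polynomial Module NumberField

/-- `s` generates the number field `ℚ(⁵√18)`. -/
structure IsFifthRoot {K : Type*} [Field K] [NumberField K] (s : K) : Prop where
  pow_five : s ^ 5 = 18
  finrank_eq : finrank ℚ K = 5

theorem irreducible_X_pow_five_sub : Irreducible (X ^ 5 - C 18 : ℚ[X]) := by
  apply X_pow_sub_C_irreducible_of_prime (by norm_num)
  intro b hb
  have h1 : padicValRat 2 (b ^ 5) = padicValRat 2 18 := by rw [hb]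
  have hb0 : b ≠ 0 := by rintro rfl; norm_num at hb
  have : Fact (Nat.Prime 2) := ⟨by norm_num⟩
  rw [padicValRat.pow] at h1
  have h2 : padicValRat 2 18 = 1 := by
    have : (18 : ℚ) = 2 * 9 := by norm_num
    rw [this, padicValRat.mul (by norm_num) (by norm_num)]
    have h9 : padicValRat 2 9 = 0 := by
      have := padicValRat.of_nat (p := 2) (n := 9)
      norm_num at this ⊢
      rw [this]
      exact_mod_cast padicValNat.eq_zero_of_not_dvd (by norm_num)
    have h2 : padicValRat 2 2 = 1 := by
      exact_mod_cast padicValRat.self (p := 2) (by norm_num)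
    rw [h2, h9]; norm_num
  omega

theorem exists_isFifthRoot :
    ∃ (K : Type) (_ : Field K) (_ : NumberField K) (s : K), IsFifthRoot s := by
  have : Fact (Irreducible (X ^ 5 - C 18 : ℚ[X])) := ⟨irreducible_X_pow_five_sub⟩
  have hm : (X ^ 5 - C 18 : ℚ[X]).Monic := monic_X_pow_sub_C _ (by norm_num)
  have hf : finrank ℚ (AdjoinRoot (X ^ 5 - C 18 : ℚ[X])) = 5 := by
    rw [(AdjoinRoot.powerBasis hm.ne_zero).finrank, AdjoinRoot.powerBasis_dim,
      natDegree_X_pow_sub_C]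
  have : FiniteDimensional ℚ (AdjoinRoot (X ^ 5 - C 18 : ℚ[X])) :=
    (AdjoinRoot.powerBasis hm.ne_zero).finite
  refine ⟨AdjoinRoot (X ^ 5 - C 18 : ℚ[X]), inferInstance, ⟨⟩, AdjoinRoot.root _, ?_, hf⟩
  have := AdjoinRoot.eval₂_root (X ^ 5 - C 18 : ℚ[X])
  simp only [eval₂_sub, eval₂_pow, eval₂_X, eval₂_C] at this
  rw [sub_eq_zero] at this
  rw [this]; exact map_ofNat _ 18

section
variable {K : Type*} [Field K] [NumberField K] {s : K}

/-- The element of `K` with rational coordinates `z₀, …, z₄` on the powers of `s`. -/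
def vec (s : K) (z₀ z₁ z₂ z₃ z₄ : ℚ) : K :=
  z₀ + z₁ * s + z₂ * s ^ 2 + z₃ * s ^ 3 + z₄ * s ^ 4

namespace IsFifthRoot

theorem minpoly_eq (h : IsFifthRoot s) : minpoly ℚ s = X ^ 5 - C 18 := by
  symm
  apply minpoly.eq_of_irreducible_of_monic irreducible_X_pow_five_sub
  · simp [h.pow_five]
  · exact monic_X_pow_sub_C _ (by norm_num)

theorem natDegree_minpoly (h : IsFifthRoot s) : (minpoly ℚ s).natDegree = 5 := by
  rw [h.minpoly_eq, natDegree_X_pow_sub_C]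

theorem linearIndependent (h : IsFifthRoot s) :
    LinearIndependent ℚ (fun i : Fin 5 => s ^ (i : ℕ)) := by
  have := linearIndependent_pow (K := ℚ) s
  rw [h.natDegree_minpoly] at this
  exact this

/-- The basis `1, s, s², s³, s⁴` of `K`. -/
noncomputable def basis (h : IsFifthRoot s) : Basis (Fin 5) ℚ K :=
  basisOfLinearIndependentOfCardEqFinrank h.linearIndependent (by simp [h.finrank_eq])

@[simp] theorem basis_apply (h : IsFifthRoot s) (i : Fin 5) : h.basis i = s ^ (i : ℕ) := by
  simp [basis]

theorem exists_vec (h : IsFifthRoot s) (z : K) :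
    ∃ z₀ z₁ z₂ z₃ z₄ : ℚ, z = vec s z₀ z₁ z₂ z₃ z₄ := by
  refine ⟨h.basis.repr z 0, h.basis.repr z 1, h.basis.repr z 2, h.basis.repr z 3,
    h.basis.repr z 4, ?_⟩
  conv_lhs => rw [← h.basis.sum_repr z]
  simp [Fin.sum_univ_five, vec, Algebra.smul_def]

theorem repr_vec (h : IsFifthRoot s) (z₀ z₁ z₂ z₃ z₄ : ℚ) :
    ⇑(h.basis.repr (vec s z₀ z₁ z₂ z₃ z₄)) = ![z₀, z₁, z₂, z₃, z₄] := by
  have : vec s z₀ z₁ z₂ z₃ z₄ = ∑ i, (![z₀, z₁, z₂, z₃, z₄] i) • h.basis i := by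
    simp [Fin.sum_univ_five, vec, Algebra.smul_def]
  rw [this, h.basis.repr_sum_self]

theorem vec_inj (h : IsFifthRoot s) {a₀ a₁ a₂ a₃ a₄ b₀ b₁ b₂ b₃ b₄ : ℚ}
    (e : vec s a₀ a₁ a₂ a₃ a₄ = vec s b₀ b₁ b₂ b₃ b₄) :
    a₀ = b₀ ∧ a₁ = b₁ ∧ a₂ = b₂ ∧ a₃ = b₃ ∧ a₄ = b₄ := by
  have := h.repr_vec a₀ a₁ a₂ a₃ a₄
  rw [e, h.repr_vec] at this
  have h' := fun i => congrFun this i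
  exact ⟨(h' 0).symm, (h' 1).symm, (h' 2).symm, (h' 3).symm, (h' 4).symm⟩

theorem vec_mul (h : IsFifthRoot s) (a₀ a₁ a₂ a₃ a₄ b₀ b₁ b₂ b₃ b₄ : ℚ) :
    vec s a₀ a₁ a₂ a₃ a₄ * vec s b₀ b₁ b₂ b₃ b₄ =
      vec s (a₀ * b₀ + 18 * (a₁ * b₄ + a₂ * b₃ + a₃ * b₂ + a₄ * b₁))
        (a₀ * b₁ + a₁ * b₀ + 18 * (a₂ * b₄ + a₃ * b₃ + a₄ * b₂))
        (a₀ * b₂ + a₁ * b₁ + a₂ * b₀ + 18 * (a₃ * b₄ + a₄ * b₃))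
        (a₀ * b₃ + a₁ * b₂ + a₂ * b₁ + a₃ * b₀ + 18 * (a₄ * b₄))
        (a₀ * b₄ + a₁ * b₃ + a₂ * b₂ + a₃ * b₁ + a₄ * b₀) := by
  have := h.pow_five
  simp only [vec]
  push_cast
  linear_combination (a₁ * b₄ + a₂ * b₃ + a₃ * b₂ + a₄ * b₁ +
    s * (a₂ * b₄ + a₃ * b₃ + a₄ * b₂) + s ^ 2 * (a₃ * b₄ + a₄ * b₃) + s ^ 3 * (a₄ * b₄) : K) * this

theorem norm_vec_eq_det (h : IsFifthRoot s) (z₀ z₁ z₂ z₃ z₄ : ℚ) :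
    Algebra.norm ℚ (vec s z₀ z₁ z₂ z₃ z₄) =
      Matrix.det !![z₀, 18 * z₄, 18 * z₃, 18 * z₂, 18 * z₁;
        z₁, z₀, 18 * z₄, 18 * z₃, 18 * z₂;
        z₂, z₁, z₀, 18 * z₄, 18 * z₃;
        z₃, z₂, z₁, z₀, 18 * z₄;
        z₄, z₃, z₂, z₁, z₀] := by
  rw [Algebra.norm_eq_matrix_det h.basis]
  congr 1
  have e : ∀ j : Fin 5, h.basis j = vec s (if j = 0 then 1 else 0) (if j = 1 then 1 else 0)
      (if j = 2 then 1 else 0) (if j = 3 then 1 else 0) (if j = 4 then 1 else 0) := by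
    intro j
    fin_cases j <;> simp [vec]
  ext i j
  rw [Algebra.leftMulMatrix_eq_repr_mul, e, h.vec_mul, h.repr_vec]
  fin_cases i <;> fin_cases j <;> simp

theorem norm_vec (h : IsFifthRoot s) (z₀ z₁ z₂ z₃ z₄ : ℚ) :
    Algebra.norm ℚ (vec s z₀ z₁ z₂ z₃ z₄) =
      -1620 * z₀ * z₁ * z₂ * z₃ * z₄ - 1620 * z₀ * z₁ * z₃ ^ 3 + 1620 * z₀ * z₁ ^ 2 * z₄ ^
      2 - 90 * z₀ * z₁ ^ 3 * z₂ + 1620 * z₀ * z₂ ^ 2 * z₃ ^ 2 - 1620 * z₀ * z₂ ^ 3 * z₄ -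
      29160 * z₀ * z₃ * z₄ ^ 3 + 90 * z₀ ^ 2 * z₁ * z₂ ^ 2 + 90 * z₀ ^ 2 * z₁ ^ 2 * z₃ +
      1620 * z₀ ^ 2 * z₂ * z₄ ^ 2 + 1620 * z₀ ^ 2 * z₃ ^ 2 * z₄ - 90 * z₀ ^ 3 * z₁ * z₄ -
      90 * z₀ ^ 3 * z₂ * z₃ + z₀ ^ 5 - 29160 * z₁ * z₂ * z₄ ^ 3 - 1620 * z₁ * z₂ ^ 3 * z₃
      + 29160 * z₁ * z₃ ^ 2 * z₄ ^ 2 + 1620 * z₁ ^ 2 * z₂ * z₃ ^ 2 + 1620 * z₁ ^ 2 * z₂ ^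
      2 * z₄ - 1620 * z₁ ^ 3 * z₃ * z₄ + 18 * z₁ ^ 5 - 29160 * z₂ * z₃ ^ 3 * z₄ + 29160 *
      z₂ ^ 2 * z₃ * z₄ ^ 2 + 324 * z₂ ^ 5 + 5832 * z₃ ^ 5 + 104976 * z₄ ^ 5 := by
  rw [h.norm_vec_eq_det]
  simp [Matrix.det_succ_row_zero, Fin.sum_univ_succ, Fin.succAbove]
  ring

end IsFifthRoot
end

/-- An integral element of `K`, as an element of its ring of integers. -/
def IsIntegral.toRingOfIntegers {K : Type*} [Field K] {x : K} (hx : IsIntegral ℤ x) : 𝓞 K := ⟨x, hx⟩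

@[simp] theorem IsIntegral.coe_toRingOfIntegers {K : Type*} [Field K] {x : K}
    (hx : IsIntegral ℤ x) :
    (hx.toRingOfIntegers : K) = x := rfl

section
variable {K : Type*} [Field K] [NumberField K] {s : K}

namespace IsFifthRoot

theorem isIntegral (h : IsFifthRoot s) : IsIntegral ℤ s :=
  ⟨X ^ 5 - C 18, monic_X_pow_sub_C _ (by norm_num), by simp [h.pow_five]⟩

theorem isIntegral_cube_div (h : IsFifthRoot s) : IsIntegral ℤ (vec s 0 0 0 (1 / 3) 0) := by
  refine ⟨X ^ 5 - C 24, monic_X_pow_sub_C _ (by norm_num), ?_⟩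
  simp only [eval₂_sub, eval₂_pow, eval₂_X, eval₂_C]
  have : (vec s 0 0 0 (1 / 3) 0) ^ 5 = vec s 24 0 0 0 0 := by
    simp only [pow_succ, pow_zero, one_mul, h.vec_mul]; norm_num
  rw [this]; simp [vec]

theorem isIntegral_fourth_div (h : IsFifthRoot s) : IsIntegral ℤ (vec s 0 0 0 0 (1 / 3)) := by
  refine ⟨X ^ 5 - C 432, monic_X_pow_sub_C _ (by norm_num), ?_⟩
  simp only [eval₂_sub, eval₂_pow, eval₂_X, eval₂_C]
  have : (vec s 0 0 0 0 (1 / 3)) ^ 5 = vec s 432 0 0 0 0 := by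
    simp only [pow_succ, pow_zero, one_mul, h.vec_mul]; norm_num
  rw [this]; simp [vec]

theorem isIntegral_eta (h : IsFifthRoot s) :
    IsIntegral ℤ (vec s (1 / 5) (2 / 5) (4 / 5) (-1 / 15) (-2 / 15)) := by
  refine ⟨X ^ 5 - (X ^ 4 - 10 * X ^ 3 + 50 * X ^ 2 - 125 * X + 125), ?_, ?_⟩
  · monicity!
  simp only [eval₂_sub, eval₂_add, eval₂_mul, eval₂_pow, eval₂_X, eval₂_ofNat]
  simp only [pow_succ, pow_zero, one_mul, h.vec_mul]
  simp only [vec]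
  push_cast
  ring_nf

/-- The algebraic integer with coordinates `c` on the family `1, s, s², s³/3, ω`, where
`ω = (6 + 12 s + 24 s² - 2 s³ + s⁴) / 15`. -/
noncomputable def int (h : IsFifthRoot s) (c₀ c₁ c₂ c₃ c₄ : ℤ) : 𝓞 K :=
  c₀ + c₁ * h.isIntegral.toRingOfIntegers + c₂ * h.isIntegral.toRingOfIntegers ^ 2 +
    c₃ * h.isIntegral_cube_div.toRingOfIntegers +
    c₄ * (h.isIntegral_fourth_div.toRingOfIntegers + 2 * h.isIntegral_eta.toRingOfIntegers)

theorem coe_int (h : IsFifthRoot s) (c₀ c₁ c₂ c₃ c₄ : ℤ) : (h.int c₀ c₁ c₂ c₃ c₄ : K) =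
    vec s (c₀ + 2 / 5 * c₄) (c₁ + 4 / 5 * c₄) (c₂ + 8 / 5 * c₄) (c₃ / 3 - 2 / 15 * c₄)
      (c₄ / 15) := by
  simp only [int, map_add, map_mul, map_pow, map_intCast, map_ofNat,
    IsIntegral.coe_toRingOfIntegers, vec]
  push_cast
  ring

theorem trace_vec (h : IsFifthRoot s) (z₀ z₁ z₂ z₃ z₄ : ℚ) :
    Algebra.trace ℚ K (vec s z₀ z₁ z₂ z₃ z₄) = 5 * z₀ := by
  have e : ∀ j : Fin 5, h.basis j = vec s (if j = 0 then 1 else 0) (if j = 1 then 1 else 0)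
      (if j = 2 then 1 else 0) (if j = 3 then 1 else 0) (if j = 4 then 1 else 0) := by
    intro j
    fin_cases j <;> simp [vec]
  rw [Algebra.trace_eq_matrix_trace h.basis, Matrix.trace]
  simp only [Fin.sum_univ_five, Matrix.diag, Algebra.leftMulMatrix_eq_repr_mul, e, h.vec_mul,
    h.repr_vec]
  simp
  ring

theorem abs_discr_le (h : IsFifthRoot s) : |discr K| ≤ 162000 := by
  classical
  let b : Basis (Fin 5) ℤ (𝓞 K) := (RingOfIntegers.basis K).reindex
    (Fintype.equivFinOfCardEq (by
      rw [← finrank_eq_card_chooseBasisIndex, RingOfIntegers.rank, h.finrank_eq]))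
  let w : Fin 5 → 𝓞 K := ![h.int 1 0 0 0 0, h.int 0 1 0 0 0, h.int 0 0 1 0 0, h.int 0 0 0 1 0,
    h.int 0 0 0 0 1]
  have hw : (Algebra.discr ℤ w : ℚ) = 162000 := by
    rw [Algebra.discr_def]
    have : ((Algebra.traceMatrix ℤ w).det : ℚ) =
        (Algebra.traceMatrix ℚ (fun i => (w i : K))).det := by
      rw [show ∀ n : ℤ, (n : ℚ) = Int.castRingHom ℚ n from fun _ => rfl, RingHom.map_det]
      congr 1
      ext i j
      simp only [RingHom.mapMatrix_apply, Matrix.map_apply, Algebra.traceMatrix_apply,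
        Algebra.traceForm_apply, Int.coe_castRingHom, Algebra.coe_trace_int, map_mul]
    rw [this]
    have : Algebra.traceMatrix ℚ (fun i => (w i : K)) =
        !![5, 0, 0, 0, 2; 0, 0, 0, 0, 6; 0, 0, 0, 30, -12; 0, 0, 30, 0, 48;
          2, 6, -12, 48, -28] := by
      ext i j
      fin_cases i <;> fin_cases j <;>
      simp [w, Algebra.traceMatrix_apply, Algebra.traceForm_apply, h.coe_int, h.vec_mul,
        h.trace_vec] <;> norm_num
    rw [this]
    simp [Matrix.det_succ_row_zero, Fin.sum_univ_succ, Fin.succAbove]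
    norm_num
  have h1 : Algebra.discr ℤ w = (b.toMatrix w).det ^ 2 * discr K := by
    rw [← NumberField.discr_eq_discr K b, ← Algebra.discr_of_matrix_vecMul,
      Basis.toMatrix_map_vecMul]
  have hw' : Algebra.discr ℤ w = 162000 := by exact_mod_cast hw
  rw [hw'] at h1
  have h2 : (b.toMatrix w).det ^ 2 ≠ 0 := fun e => by rw [e] at h1; norm_num at h1
  calc |discr K| ≤ |(b.toMatrix w).det ^ 2| * |discr K| :=
        le_mul_of_one_le_left (abs_nonneg _) (Int.one_le_abs h2)
    _ = 162000 := by rw [← abs_mul, ← h1]; rfl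

end IsFifthRoot
end

section
variable {K : Type*} [Field K] [NumberField K] {s : K}

namespace IsFifthRoot

open nonZeroDivisors Real in
theorem minkowski_lt (h : IsFifthRoot s) :
    (4 / π) ^ InfinitePlace.nrComplexPlaces K *
      ((finrank ℚ K).factorial / (finrank ℚ K) ^ (finrank ℚ K) * √|discr K|) < 26 := by
  have hr := InfinitePlace.card_add_two_mul_card_eq_rank K
  rw [h.finrank_eq] at hr
  have h2 : InfinitePlace.nrComplexPlaces K ≤ 2 := by omega
  have hpi := Real.pi_gt_d2
  have hpi4 := Real.pi_lt_four
  have h1 : (4 / π) ^ InfinitePlace.nrComplexPlaces K ≤ (4 / 3.14) ^ 2 := by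
    calc (4 / π) ^ InfinitePlace.nrComplexPlaces K ≤ (4 / π) ^ 2 :=
          pow_le_pow_right₀ (by rw [le_div_iff₀ Real.pi_pos]; linarith) h2
      _ ≤ _ := by gcongr
  have h3 : √|(discr K : ℝ)| ≤ 403 := by
    rw [Real.sqrt_le_left (by norm_num)]
    have : (|discr K| : ℝ) ≤ 162000 := by exact_mod_cast h.abs_discr_le
    linarith
  rw [h.finrank_eq]
  calc _ ≤ (4 / 3.14 : ℝ) ^ 2 * ((Nat.factorial 5 : ℕ) / (5 : ℕ) ^ 5 * 403) := by gcongr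
    _ < 26 := by norm_num [Nat.factorial]

theorem norm_int_eq (z : 𝓞 K) (n : ℤ)
    (hz : Algebra.norm ℚ (z : K) = n) : Algebra.norm ℤ z = n := by
  have := Algebra.coe_norm_int z
  rw [hz] at this
  exact_mod_cast this

theorem isPrincipal_of_mem {P : Ideal (𝓞 K)} (hP : P.IsPrime) {g : 𝓞 K} {n : ℤ}
    (hn : n.natAbs.Prime) (hN : Algebra.norm ℚ (g : K) = n) (hg : g ∈ P) :
    P.IsPrincipal := by
  have h1 : Ideal.absNorm (Ideal.span {g}) = n.natAbs := by
    rw [Ideal.absNorm_span_singleton, norm_int_eq g n hN]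
  have h2 : (Ideal.span {g}).IsPrime :=
    Ideal.isPrime_of_irreducible_absNorm (by rw [h1]; exact hn)
  have h3 : Ideal.span {g} ≠ ⊥ := by
    intro e
    rw [e, Ideal.absNorm_bot] at h1
    exact hn.ne_zero h1.symm
  have h4 := (h2.isMaximal h3).eq_of_le hP.ne_top ((Ideal.span_singleton_le_iff_mem _).2 hg)
  exact ⟨⟨g, h4.symm⟩⟩

theorem exists_sub_mem {P : Ideal (𝓞 K)} (hP : P.IsPrime) {p : ℕ} (hp : p.Prime)
    (hN : Ideal.absNorm P = p) (z : 𝓞 K) : ∃ r ∈ Finset.range p, z - (r : 𝓞 K) ∈ P := by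
  have hP0 : P ≠ ⊥ := by rintro rfl; rw [Ideal.absNorm_bot] at hN; exact hp.ne_zero hN.symm
  have hf : Finite (𝓞 K ⧸ P) := Ideal.finiteQuotientOfFreeOfNeBot P hP0
  have := Fintype.ofFinite (𝓞 K ⧸ P)
  have : IsDomain (𝓞 K ⧸ P) := Ideal.Quotient.isDomain P
  have hc : Fintype.card (𝓞 K ⧸ P) = p := by
    rw [← hN, Ideal.absNorm_apply, Submodule.cardQuot_apply, Nat.card_eq_fintype_card]
  have : NeZero p := ⟨hp.ne_zero⟩
  obtain ⟨r, hr⟩ := (ZMod.ringEquivOfPrime (𝓞 K ⧸ P) hp hc).surjective (Ideal.Quotient.mk P z)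
  refine ⟨r.val, Finset.mem_range.2 r.val_lt, ?_⟩
  rw [← Ideal.Quotient.eq, ← hr, map_natCast, ← map_natCast (ZMod.ringEquivOfPrime (𝓞 K ⧸ P) hp hc),
    ZMod.natCast_zmod_val]

theorem norm_int_two (h : IsFifthRoot s) :
    Algebra.norm ℚ (h.int 0 1 2 0 (-1) : K) = (2 : ℤ) := by
  rw [h.coe_int, h.norm_vec]
  norm_num

theorem norm_int_three (h : IsFifthRoot s) :
    Algebra.norm ℚ (h.int 1 (-1) (-3) 1 2 : K) = (3 : ℤ) := by
  rw [h.coe_int, h.norm_vec]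
  norm_num

theorem norm_int_five (h : IsFifthRoot s) :
    Algebra.norm ℚ (h.int 1 0 (-1) 1 1 : K) = (5 : ℤ) := by
  rw [h.coe_int, h.norm_vec]
  norm_num

theorem norm_int_five' (h : IsFifthRoot s) :
    Algebra.norm ℚ (h.int 1 2 3 0 (-2) : K) = (5 : ℤ) := by
  rw [h.coe_int, h.norm_vec]
  norm_num

theorem int_two_pow (h : IsFifthRoot s) :
    h.int 0 1 2 0 (-1) ^ 5 = 2 * h.int 19 10 2 (-11) (-3) := by
  apply RingOfIntegers.coe_injective
  have e₂ : (vec s (-2/5) (1/5) (2/5) (2/15) (-1/15)) ^ 2 =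
      vec s (8/5) (-4/5) (-3/5) (2/15) (4/15) := by
    rw [sq, h.vec_mul]; norm_num
  have e₄ : (vec s (-2/5) (1/5) (2/5) (2/15) (-1/15)) ^ 4 = vec s (-8) (-8) (0) (8/3) (1) := by
    rw [show 4 = 2 * 2 from rfl, pow_mul, e₂, sq, h.vec_mul]; norm_num
  simp only [map_pow, pow_succ _ 4, map_mul, h.coe_int, map_ofNat]
  norm_num at e₄ ⊢
  rw [e₄, h.vec_mul]
  simp only [vec]; push_cast; ring

theorem int_three_pow (h : IsFifthRoot s) :
    h.int 1 (-1) (-3) 1 2 ^ 5 = 3 * h.int 107 (-165) (-541) 293 389 := by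
  apply RingOfIntegers.coe_injective
  have e₂ : (vec s (9/5) (3/5) (1/5) (1/15) (2/15)) ^ 2 =
      vec s (33/5) (16/5) (7/5) (4/5) (3/5) := by
    rw [sq, h.vec_mul]; norm_num
  have e₄ : (vec s (9/5) (3/5) (1/5) (1/15) (2/15)) ^ 4 = vec s (153) (84) (46) (26) (15) := by
    rw [show 4 = 2 * 2 from rfl, pow_mul, e₂, sq, h.vec_mul]; norm_num
  simp only [map_pow, pow_succ _ 4, map_mul, h.coe_int, map_ofNat]
  norm_num at e₄ ⊢
  rw [e₄, h.vec_mul]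
  simp only [vec]; push_cast; ring

theorem int_five_mul (h : IsFifthRoot s) :
    h.int 1 0 (-1) 1 1 * h.int 1 2 3 0 (-2) ^ 4 = 5 * h.int (-3) (-8) (-9) (-1) 7 := by
  apply RingOfIntegers.coe_injective
  have e₂ : (vec s (1/5) (2/5) (-1/5) (4/15) (-2/15)) ^ 2 =
      vec s (-19/5) (12/5) (-6/5) (4/15) (1/5) := by
    rw [sq, h.vec_mul]; norm_num
  have e₄ : (vec s (1/5) (2/5) (-1/5) (4/15) (-2/15)) ^ 4 =
      vec s (101/5) (-128/5) (84/5) (-106/15) (6/5) := by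
    rw [show 4 = 2 * 2 from rfl, pow_mul, e₂, sq, h.vec_mul]; norm_num
  simp only [map_pow, map_mul, h.coe_int, map_ofNat]
  norm_num at e₄ ⊢
  rw [e₄, h.vec_mul]
  simp only [vec]; push_cast; ring

theorem fifteen_mul_int (h : IsFifthRoot s) (c₀ c₁ c₂ c₃ c₄ : ℤ) :
    15 * h.int c₀ c₁ c₂ c₃ c₄ = ((15 * c₀ + 6 * c₄ : ℤ) : 𝓞 K) +
      (15 * c₁ + 12 * c₄ : ℤ) * h.int 0 1 0 0 0 + (15 * c₂ + 24 * c₄ : ℤ) * h.int 0 1 0 0 0 ^ 2 +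
      (5 * c₃ - 2 * c₄ : ℤ) * h.int 0 1 0 0 0 ^ 3 + c₄ * h.int 0 1 0 0 0 ^ 4 := by
  apply RingOfIntegers.coe_injective
  simp only [map_add, map_mul, map_pow, map_intCast, h.coe_int, map_ofNat, vec]
  push_cast; ring

theorem int_pow_five (h : IsFifthRoot s) : h.int 0 1 0 0 0 ^ 5 = 18 := by
  apply RingOfIntegers.coe_injective
  simp only [map_pow, h.coe_int, map_ofNat, vec]
  have := h.pow_five
  push_cast
  linear_combination this

theorem int_mem_of_eval (h : IsFifthRoot s) {P : Ideal (𝓞 K)} (hP : P.IsPrime) {p : ℕ}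
    (hpP : (p : 𝓞 K) ∈ P) (hp : Nat.Coprime p 15) {r : ℕ}
    (hr : h.int 0 1 0 0 0 - (r : 𝓞 K) ∈ P) (c₀ c₁ c₂ c₃ c₄ : ℤ)
    (hd : (p : ℤ) ∣ 15 * c₀ + 6 * c₄ + (15 * c₁ + 12 * c₄) * r + (15 * c₂ + 24 * c₄) * r ^ 2 +
      (5 * c₃ - 2 * c₄) * r ^ 3 + c₄ * r ^ 4) : h.int c₀ c₁ c₂ c₃ c₄ ∈ P := by
  have h15 : (15 : 𝓞 K) ∉ P := by
    intro h15
    apply hP.ne_top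
    rw [Ideal.eq_top_iff_one]
    obtain ⟨a, b, hab⟩ := (Nat.isCoprime_iff_coprime.2 hp)
    have : (1 : 𝓞 K) = a * (p : 𝓞 K) + b * 15 := by
      exact_mod_cast congrArg (Int.cast (R := 𝓞 K)) hab.symm
    rw [this]
    exact P.add_mem (P.mul_mem_left _ hpP) (P.mul_mem_left _ h15)
  apply (hP.mem_or_mem _).resolve_left h15
  rw [h.fifteen_mul_int, ← Ideal.Quotient.eq_zero_iff_mem]
  obtain ⟨k, hk⟩ := hd
  have e : Ideal.Quotient.mk P (h.int 0 1 0 0 0) = (r : 𝓞 K ⧸ P) := by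
    rw [← map_natCast (Ideal.Quotient.mk P), Ideal.Quotient.eq]; exact hr
  have e2 : (p : 𝓞 K ⧸ P) = 0 := by
    rw [← map_natCast (Ideal.Quotient.mk P), Ideal.Quotient.eq_zero_iff_mem]; exact hpP
  have e3 := congrArg (Int.cast (R := 𝓞 K ⧸ P)) hk
  simp only [map_add, map_mul, map_pow, map_intCast, e]
  push_cast at e3 ⊢
  rw [e3, e2, zero_mul]

theorem dvd_of_sub_mem (h : IsFifthRoot s) {P : Ideal (𝓞 K)} (hP : P.IsPrime) {p : ℕ}
    (hp : p.Prime) (hN : Ideal.absNorm P = p) {r : ℕ} (hr : h.int 0 1 0 0 0 - (r : 𝓞 K) ∈ P) :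
    (p : ℤ) ∣ r ^ 5 - 18 := by
  have h1 : (((r ^ 5 - 18 : ℤ)) : 𝓞 K) ∈ P := by
    have e : Ideal.Quotient.mk P (h.int 0 1 0 0 0) = (r : 𝓞 K ⧸ P) := by
      rw [← map_natCast (Ideal.Quotient.mk P), Ideal.Quotient.eq]; exact hr
    have e2 := congrArg (Ideal.Quotient.mk P) h.int_pow_five
    rw [map_pow, e, map_ofNat] at e2
    rw [← Ideal.Quotient.eq_zero_iff_mem, map_intCast]
    push_cast
    rw [e2, sub_self]
  have hpP : (p : 𝓞 K) ∈ P := hN ▸ Ideal.absNorm_mem P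
  by_contra hd
  apply hP.ne_top
  rw [Ideal.eq_top_iff_one]
  obtain ⟨a, b, hab⟩ := ((Nat.prime_iff_prime_int.1 hp).coprime_iff_not_dvd).2 hd
  have : (1 : 𝓞 K) = a * (p : 𝓞 K) + b * ((r ^ 5 - 18 : ℤ) : 𝓞 K) := by
    exact_mod_cast congrArg (Int.cast (R := 𝓞 K)) hab.symm
  rw [this]
  exact P.add_mem (P.mul_mem_left _ hpP) (P.mul_mem_left _ h1)

theorem isPrincipal_of_absNorm_le (h : IsFifthRoot s) {P : Ideal (𝓞 K)} (hP : P.IsPrime) {p : ℕ}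
    (hp : p.Prime) (hN : Ideal.absNorm P = p) (h7 : 7 ≤ p) (h25 : p ≤ 25) : P.IsPrincipal := by
  have hpP : (p : 𝓞 K) ∈ P := hN ▸ Ideal.absNorm_mem P
  obtain ⟨r, hr, hmem⟩ := exists_sub_mem hP hp hN (h.int 0 1 0 0 0)
  have hd := h.dvd_of_sub_mem hP hp hN hmem
  have main : ∀ (c₀ c₁ c₂ c₃ c₄ n : ℤ), n.natAbs = p → Nat.Coprime p 15 →
      (p : ℤ) ∣ 15 * c₀ + 6 * c₄ + (15 * c₁ + 12 * c₄) * r + (15 * c₂ + 24 * c₄) * r ^ 2 +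
      (5 * c₃ - 2 * c₄) * r ^ 3 + c₄ * r ^ 4 →
      Algebra.norm ℚ (h.int c₀ c₁ c₂ c₃ c₄ : K) = n → P.IsPrincipal :=
    fun c₀ c₁ c₂ c₃ c₄ n hn hc hd hN => isPrincipal_of_mem hP (hn ▸ hp) hN
      (h.int_mem_of_eval hP hpP hc hmem c₀ c₁ c₂ c₃ c₄ hd)
  clear hmem hpP hN
  interval_cases p <;> try (exfalso; revert hp; norm_num; done)
  · have : ∀ r ∈ Finset.range 7, (7 : ℤ) ∣ r ^ 5 - 18 → r = 2 := by decide
    obtain rfl := this r hr hd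
    refine main 1 1 4 (-1) (-2) (-7) (by norm_num) (by norm_num) (by norm_num) ?_
    rw [h.coe_int, h.norm_vec]
    norm_num
  · have : ∀ r ∈ Finset.range 11, ¬ (11 : ℤ) ∣ r ^ 5 - 18 := by decide
    exact (this r hr hd).elim
  · have : ∀ r ∈ Finset.range 13, (13 : ℤ) ∣ r ^ 5 - 18 → r = 5 := by decide
    obtain rfl := this r hr hd
    refine main 1 1 0 1 0 (13) (by norm_num) (by norm_num) (by norm_num) ?_
    rw [h.coe_int, h.norm_vec]
    norm_num
  · have : ∀ r ∈ Finset.range 17, (17 : ℤ) ∣ r ^ 5 - 18 → r = 1 := by decide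
    obtain rfl := this r hr hd
    refine main 1 (-1) 0 0 0 (-17) (by norm_num) (by norm_num) (by norm_num) ?_
    rw [h.coe_int, h.norm_vec]
    norm_num
  · have : ∀ r ∈ Finset.range 19, (19 : ℤ) ∣ r ^ 5 - 18 → r = 18 := by decide
    obtain rfl := this r hr hd
    refine main 1 1 0 0 0 (19) (by norm_num) (by norm_num) (by norm_num) ?_
    rw [h.coe_int, h.norm_vec]
    norm_num
  · have : ∀ r ∈ Finset.range 23, (23 : ℤ) ∣ r ^ 5 - 18 → r = 12 := by decide
    obtain rfl := this r hr hd
    refine main 1 0 0 (-1) 0 (-23) (by norm_num) (by norm_num) (by norm_num) ?_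
    rw [h.coe_int, h.norm_vec]
    norm_num

open nonZeroDivisors Real in
theorem isPrincipalIdealRing (h : IsFifthRoot s) : IsPrincipalIdealRing (𝓞 K) := by
  apply RingOfIntegers.isPrincipalIdealRing_of_isPrincipal_of_pow_le_of_mem_primesOver_of_mem_Icc
  have hM := h.minkowski_lt
  intro p hp hprime P hP hle
  have h25 : ⌊(4 / π) ^ InfinitePlace.nrComplexPlaces K *
      ((finrank ℚ K).factorial / (finrank ℚ K) ^ (finrank ℚ K) * √|discr K|)⌋₊ ≤ 25 := by
    apply Nat.le_of_lt_succ
    rw [Nat.floor_lt' (by norm_num)]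
    exact_mod_cast hM
  have hP' := hP.1
  have hover := hP.2
  have hN := (Ideal.natAbs_pow_inertiaDeg (p : ℤ) P).symm
  rw [Int.natAbs_natCast] at hN
  have hp25 : p ^ P.inertiaDeg ℤ ≤ 25 := hle.trans h25
  have hmem : (p : 𝓞 K) ∈ P := by
    have := (Ideal.mem_of_liesOver P (Ideal.span {(p : ℤ)}) (p : ℤ)).1
      (Ideal.mem_span_singleton_self _)
    simpa using this
  have of_mem_two : (2 : 𝓞 K) ∈ P → P.IsPrincipal := fun h2 =>
    isPrincipal_of_mem hP' (by norm_num) h.norm_int_two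
      (hP'.mem_of_pow_mem 5 (h.int_two_pow ▸ P.mul_mem_right _ h2))
  have of_mem_three : (3 : 𝓞 K) ∈ P → P.IsPrincipal := fun h3 =>
    isPrincipal_of_mem hP' (by norm_num) h.norm_int_three
      (hP'.mem_of_pow_mem 5 (h.int_three_pow ▸ P.mul_mem_right _ h3))
  have of_mem_five : (5 : 𝓞 K) ∈ P → P.IsPrincipal := fun h5 =>
    (hP'.mem_or_mem (h.int_five_mul ▸ P.mul_mem_right _ h5)).elim
      (fun h6 => isPrincipal_of_mem hP' (by norm_num) h.norm_int_five h6)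
      (fun h6 => isPrincipal_of_mem hP' (by norm_num) h.norm_int_five' (hP'.mem_of_pow_mem 4 h6))
  by_cases h7 : 7 ≤ p
  · have hf0 : P.inertiaDeg ℤ ≠ 0 := by
      intro e
      rw [e, pow_zero, Ideal.absNorm_eq_one_iff] at hN
      exact hP'.ne_top hN
    have hf2 : P.inertiaDeg ℤ < 2 := by
      by_contra! h2
      have := Nat.pow_le_pow_right hprime.pos h2
      nlinarith
    have hf : P.inertiaDeg ℤ = 1 := by omega
    rw [hf, pow_one] at hN hp25
    exact h.isPrincipal_of_absNorm_le hP' hprime hN h7 hp25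
  · push Not at h7
    interval_cases p
    · exact absurd hprime (by norm_num)
    · exact absurd hprime (by norm_num)
    · exact of_mem_two (by exact_mod_cast hmem)
    · exact of_mem_three (by exact_mod_cast hmem)
    · exact absurd hprime (by norm_num)
    · exact of_mem_five (by exact_mod_cast hmem)
    · exact absurd hprime (by norm_num)

end IsFifthRoot
end

section
variable {K : Type*} [Field K] [NumberField K] {s : K}

theorem even_of_four_dvd_square {t₀ t₁ t₂ t₃ t₄ : ℤ}
    (h₀ : 4 ∣ t₀ ^ 2 + 36 * (t₁ * t₄ + t₂ * t₃))
    (h₁ : 4 ∣ 2 * (t₀ * t₁) + 18 * (2 * (t₂ * t₄) + t₃ ^ 2))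
    (h₂ : 4 ∣ 2 * (t₀ * t₂) + t₁ ^ 2 + 36 * (t₃ * t₄))
    (h₃ : 4 ∣ 2 * (t₀ * t₃) + 2 * (t₁ * t₂) + 18 * t₄ ^ 2)
    (h₄ : 4 ∣ 2 * (t₀ * t₄) + 2 * (t₁ * t₃) + t₂ ^ 2) :
    Even t₀ ∧ Even t₁ ∧ Even t₂ ∧ Even t₃ ∧ Even t₄ := by
  have e₀ : Even t₀ := by
    have : Even (t₀ ^ 2) := by rw [even_iff_two_dvd]; omega
    rwa [Int.even_pow' two_ne_zero] at this
  obtain ⟨a, ha⟩ := e₀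
  have e₁ : Even t₁ := by
    have : Even (t₁ ^ 2) := by rw [even_iff_two_dvd]; omega
    rwa [Int.even_pow' two_ne_zero] at this
  obtain ⟨b, hb⟩ := e₁
  have e₂ : Even t₂ := by
    have : Even (t₂ ^ 2) := by rw [even_iff_two_dvd]; omega
    rwa [Int.even_pow' two_ne_zero] at this
  obtain ⟨c, hc⟩ := e₂
  have e₃ : Even t₃ := by
    have : Even (t₃ ^ 2) := by
      rw [even_iff_two_dvd]
      have : t₀ * t₁ = 2 * (a * t₁) := by rw [ha]; ring
      omega
    rwa [Int.even_pow' two_ne_zero] at this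
  obtain ⟨d, hd⟩ := e₃
  have e₄ : Even t₄ := by
    have : Even (t₄ ^ 2) := by
      rw [even_iff_two_dvd]
      have : t₀ * t₃ = 2 * (a * t₃) := by rw [ha]; ring
      have : t₁ * t₂ = 2 * (b * t₂) := by rw [hb]; ring
      omega
    rwa [Int.even_pow' two_ne_zero] at this
  exact ⟨⟨a, ha⟩, ⟨b, hb⟩, ⟨c, hc⟩, ⟨d, hd⟩, e₄⟩

theorem exists_odd_square {c₀ c₁ c₂ c₃ c₄ : ℤ} : ∀ (n : ℕ) (t₀ t₁ t₂ t₃ t₄ : ℤ), 0 < n →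
    t₀ ^ 2 + 36 * (t₁ * t₄ + t₂ * t₃) = n ^ 2 * c₀ →
    2 * (t₀ * t₁) + 18 * (2 * (t₂ * t₄) + t₃ ^ 2) = n ^ 2 * c₁ →
    2 * (t₀ * t₂) + t₁ ^ 2 + 36 * (t₃ * t₄) = n ^ 2 * c₂ →
    2 * (t₀ * t₃) + 2 * (t₁ * t₂) + 18 * t₄ ^ 2 = n ^ 2 * c₃ →
    2 * (t₀ * t₄) + 2 * (t₁ * t₃) + t₂ ^ 2 = n ^ 2 * c₄ →
    ∃ n' : ℤ, Odd n' ∧ ∃ t₀ t₁ t₂ t₃ t₄ : ℤ,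
      t₀ ^ 2 + 36 * (t₁ * t₄ + t₂ * t₃) = n' ^ 2 * c₀ ∧
      2 * (t₀ * t₁) + 18 * (2 * (t₂ * t₄) + t₃ ^ 2) = n' ^ 2 * c₁ ∧
      2 * (t₀ * t₂) + t₁ ^ 2 + 36 * (t₃ * t₄) = n' ^ 2 * c₂ ∧
      2 * (t₀ * t₃) + 2 * (t₁ * t₂) + 18 * t₄ ^ 2 = n' ^ 2 * c₃ ∧
      2 * (t₀ * t₄) + 2 * (t₁ * t₃) + t₂ ^ 2 = n' ^ 2 * c₄ := by
  intro n
  induction n using Nat.strong_induction_on with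
  | _ n ih =>
    intro t₀ t₁ t₂ t₃ t₄ hn h₀ h₁ h₂ h₃ h₄
    rcases Nat.even_or_odd n with ⟨m, hm⟩ | ho
    · have hd : ∀ c : ℤ, (4 : ℤ) ∣ (n : ℤ) ^ 2 * c := fun c => ⟨m ^ 2 * c, by rw [hm]; push_cast; ring⟩
      obtain ⟨⟨a, rfl⟩, ⟨b, rfl⟩, ⟨c, rfl⟩, ⟨d, rfl⟩, ⟨e, rfl⟩⟩ :=
        even_of_four_dvd_square (h₀ ▸ hd _) (h₁ ▸ hd _) (h₂ ▸ hd _) (h₃ ▸ hd _) (h₄ ▸ hd _)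
      subst hm
      push_cast at *
      refine ih m (by omega) a b c d e (by omega) ?_ ?_ ?_ ?_ ?_ <;> linarith
    · exact ⟨n, by exact_mod_cast ho, t₀, t₁, t₂, t₃, t₄, h₀, h₁, h₂, h₃, h₄⟩

/-- Product of coordinate vectors on `1, s, s², s³, s⁴` modulo `8`. -/
def mulMod (a b : ℕ × ℕ × ℕ × ℕ × ℕ) : ℕ × ℕ × ℕ × ℕ × ℕ :=
  match a, b with
  | (a₀, a₁, a₂, a₃, a₄), (b₀, b₁, b₂, b₃, b₄) =>
    ((a₀ * b₀ + 18 * (a₁ * b₄ + a₂ * b₃ + a₃ * b₂ + a₄ * b₁)) % 8,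
      (a₀ * b₁ + a₁ * b₀ + 18 * (a₂ * b₄ + a₃ * b₃ + a₄ * b₂)) % 8,
      (a₀ * b₂ + a₁ * b₁ + a₂ * b₀ + 18 * (a₃ * b₄ + a₄ * b₃)) % 8,
      (a₀ * b₃ + a₁ * b₂ + a₂ * b₁ + a₃ * b₀ + 18 * (a₄ * b₄)) % 8,
      (a₀ * b₄ + a₁ * b₃ + a₂ * b₂ + a₃ * b₁ + a₄ * b₀) % 8)

/-- Whether a coordinate vector modulo `8` is a square modulo `8`; a square only depends on its
root modulo `4`. -/
def isSquareMod (c : ℕ × ℕ × ℕ × ℕ × ℕ) : Bool :=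
  (List.range 4).any fun t₀ => (List.range 4).any fun t₁ => (List.range 4).any fun t₂ =>
    (List.range 4).any fun t₃ => (List.range 4).any fun t₄ =>
      mulMod (t₀, t₁, t₂, t₃, t₄) (t₀, t₁, t₂, t₃, t₄) == c

/-- Reduction of an integral coordinate vector modulo `8`. -/
def redMod (c₀ c₁ c₂ c₃ c₄ : ℤ) : ℕ × ℕ × ℕ × ℕ × ℕ :=
  ((c₀ % 8).toNat, (c₁ % 8).toNat, (c₂ % 8).toNat, (c₃ % 8).toNat, (c₄ % 8).toNat)

theorem redMod_mul (a₀ a₁ a₂ a₃ a₄ b₀ b₁ b₂ b₃ b₄ : ℤ) :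
    redMod (a₀ * b₀ + 18 * (a₁ * b₄ + a₂ * b₃ + a₃ * b₂ + a₄ * b₁))
        (a₀ * b₁ + a₁ * b₀ + 18 * (a₂ * b₄ + a₃ * b₃ + a₄ * b₂))
        (a₀ * b₂ + a₁ * b₁ + a₂ * b₀ + 18 * (a₃ * b₄ + a₄ * b₃))
        (a₀ * b₃ + a₁ * b₂ + a₂ * b₁ + a₃ * b₀ + 18 * (a₄ * b₄))
        (a₀ * b₄ + a₁ * b₃ + a₂ * b₂ + a₃ * b₁ + a₄ * b₀) =
      mulMod (redMod a₀ a₁ a₂ a₃ a₄) (redMod b₀ b₁ b₂ b₃ b₄) := by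
  have key : ∀ a : ℤ, ∃ (n : ℕ) (k : ℤ), (a % 8).toNat = n ∧ a = n + 8 * k := fun a =>
    ⟨_, a / 8, rfl, by omega⟩
  have red : ∀ (z k : ℤ) (n : ℕ), z = n + 8 * k → (z % 8).toNat = n % 8 := by
    intro z k n h; omega
  obtain ⟨m₀, k₀, e₀, rfl⟩ := key a₀
  obtain ⟨m₁, k₁, e₁, rfl⟩ := key a₁
  obtain ⟨m₂, k₂, e₂, rfl⟩ := key a₂
  obtain ⟨m₃, k₃, e₃, rfl⟩ := key a₃
  obtain ⟨m₄, k₄, e₄, rfl⟩ := key a₄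
  obtain ⟨n₀, l₀, f₀, rfl⟩ := key b₀
  obtain ⟨n₁, l₁, f₁, rfl⟩ := key b₁
  obtain ⟨n₂, l₂, f₂, rfl⟩ := key b₂
  obtain ⟨n₃, l₃, f₃, rfl⟩ := key b₃
  obtain ⟨n₄, l₄, f₄, rfl⟩ := key b₄
  have mm : ∀ (m n : ℕ) (k l : ℤ), ((m + 8 * k) * (n + 8 * l) : ℤ) =
      (m * n : ℕ) + 8 * (m * l + k * n + 8 * k * l) := by intros; push_cast; ring
  simp only [redMod, mulMod, e₀, e₁, e₂, e₃, e₄, f₀, f₁, f₂, f₃, f₄, mm]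
  simp only [Prod.mk.injEq]
  refine ⟨?_, ?_, ?_, ?_, ?_⟩ <;> omega

theorem redMod_congr {a₀ a₁ a₂ a₃ a₄ b₀ b₁ b₂ b₃ b₄ : ℤ} (h₀ : a₀ ≡ b₀ [ZMOD 8])
    (h₁ : a₁ ≡ b₁ [ZMOD 8]) (h₂ : a₂ ≡ b₂ [ZMOD 8]) (h₃ : a₃ ≡ b₃ [ZMOD 8])
    (h₄ : a₄ ≡ b₄ [ZMOD 8]) : redMod a₀ a₁ a₂ a₃ a₄ = redMod b₀ b₁ b₂ b₃ b₄ := by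
  simp only [Int.ModEq] at *
  simp only [redMod, *]

theorem mulMod_self_emod (t₀ t₁ t₂ t₃ t₄ : ℤ) : ∃ m₀ < 4, ∃ m₁ < 4, ∃ m₂ < 4, ∃ m₃ < 4, ∃ m₄ < 4,
    mulMod (m₀, m₁, m₂, m₃, m₄) (m₀, m₁, m₂, m₃, m₄) =
      mulMod (redMod t₀ t₁ t₂ t₃ t₄) (redMod t₀ t₁ t₂ t₃ t₄) := by
  have key : ∀ a : ℤ, ∃ n < 4, ∃ k : ℤ, a = (n : ℕ) + 4 * k := fun a =>
    ⟨(a % 4).toNat, by omega, a / 4, by omega⟩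
  obtain ⟨m₀, h₀, k₀, rfl⟩ := key t₀
  obtain ⟨m₁, h₁, k₁, rfl⟩ := key t₁
  obtain ⟨m₂, h₂, k₂, rfl⟩ := key t₂
  obtain ⟨m₃, h₃, k₃, rfl⟩ := key t₃
  obtain ⟨m₄, h₄, k₄, rfl⟩ := key t₄
  refine ⟨m₀, h₀, m₁, h₁, m₂, h₂, m₃, h₃, m₄, h₄, ?_⟩
  have e : (m₀, m₁, m₂, m₃, m₄) = redMod m₀ m₁ m₂ m₃ m₄ := by
    simp only [redMod, Prod.mk.injEq]
    omega
  rw [e, ← redMod_mul, ← redMod_mul]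
  have red : ∀ x y k : ℤ, x = y + 8 * k → y ≡ x [ZMOD 8] := by
    intro x y k h
    rw [h]
    simp [Int.ModEq]
  apply redMod_congr
  · exact red _ _ (m₀ * k₀ + 2 * k₀ ^ 2 + 18 * (m₁ * k₄ + k₁ * m₄ + 4 * k₁ * k₄ + m₂ * k₃ + k₂ * m₃ +
      4 * k₂ * k₃)) (by ring)
  · exact red _ _ (m₀ * k₁ + k₀ * m₁ + 4 * k₀ * k₁ + 18 * (m₂ * k₄ + k₂ * m₄ + 4 * k₂ * k₄ +
      m₃ * k₃ + 2 * k₃ ^ 2)) (by ring)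
  · exact red _ _ (m₀ * k₂ + k₀ * m₂ + 4 * k₀ * k₂ + m₁ * k₁ + 2 * k₁ ^ 2 + 18 * (m₃ * k₄ +
      k₃ * m₄ + 4 * k₃ * k₄)) (by ring)
  · exact red _ _ (m₀ * k₃ + k₀ * m₃ + 4 * k₀ * k₃ + m₁ * k₂ + k₁ * m₂ + 4 * k₁ * k₂ +
      18 * (m₄ * k₄ + 2 * k₄ ^ 2)) (by ring)
  · exact red _ _ (m₀ * k₄ + k₀ * m₄ + 4 * k₀ * k₄ + m₁ * k₃ + k₁ * m₃ + 4 * k₁ * k₃ +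
      m₂ * k₂ + 2 * k₂ ^ 2) (by ring)

namespace IsFifthRoot

theorem isSquareMod_of_sq (h : IsFifthRoot s) {c₀ c₁ c₂ c₃ c₄ : ℤ} {t : K}
    (ht : vec s c₀ c₁ c₂ c₃ c₄ = t ^ 2) : isSquareMod (redMod c₀ c₁ c₂ c₃ c₄) = true := by
  obtain ⟨t₀, t₁, t₂, t₃, t₄, rfl⟩ := h.exists_vec t
  have hden : ∃ (n : ℕ), 0 < n ∧ ∃ a₀ a₁ a₂ a₃ a₄ : ℤ, t₀ = a₀ / n ∧ t₁ = a₁ / n ∧ t₂ = a₂ / n ∧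
      t₃ = a₃ / n ∧ t₄ = a₄ / n := by
    refine ⟨t₀.den * t₁.den * t₂.den * t₃.den * t₄.den, by positivity,
      t₀.num * t₁.den * t₂.den * t₃.den * t₄.den, t₁.num * t₀.den * t₂.den * t₃.den * t₄.den,
      t₂.num * t₀.den * t₁.den * t₃.den * t₄.den, t₃.num * t₀.den * t₁.den * t₂.den * t₄.den,
      t₄.num * t₀.den * t₁.den * t₂.den * t₃.den, ?_, ?_, ?_, ?_, ?_⟩ <;>
    [nth_rewrite 1 [← t₀.num_div_den]; nth_rewrite 1 [← t₁.num_div_den];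
     nth_rewrite 1 [← t₂.num_div_den]; nth_rewrite 1 [← t₃.num_div_den];
     nth_rewrite 1 [← t₄.num_div_den]] <;> push_cast <;> field_simp
  obtain ⟨n, hn, a₀, a₁, a₂, a₃, a₄, rfl, rfl, rfl, rfl, rfl⟩ := hden
  rw [sq, h.vec_mul] at ht
  obtain ⟨h₀, h₁, h₂, h₃, h₄⟩ := h.vec_inj ht
  have hn' : (n : ℚ) ≠ 0 := by positivity
  obtain ⟨n', ⟨k, hk⟩, t₀, t₁, t₂, t₃, t₄, f₀, f₁, f₂, f₃, f₄⟩ :=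
    exists_odd_square (c₀ := c₀) (c₁ := c₁) (c₂ := c₂) (c₃ := c₃) (c₄ := c₄) n a₀ a₁ a₂ a₃ a₄ hn
    (by
      have : (a₀ ^ 2 + 36 * (a₁ * a₄ + a₂ * a₃) : ℚ) = n ^ 2 * c₀ := by rw [h₀]; field_simp; ring
      exact_mod_cast this)
    (by
      have : (2 * (a₀ * a₁) + 18 * (2 * (a₂ * a₄) + a₃ ^ 2) : ℚ) = n ^ 2 * c₁ := by
        rw [h₁]; field_simp; ring
      exact_mod_cast this)
    (by
      have : (2 * (a₀ * a₂) + a₁ ^ 2 + 36 * (a₃ * a₄) : ℚ) = n ^ 2 * c₂ := by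
        rw [h₂]; field_simp; ring
      exact_mod_cast this)
    (by
      have : (2 * (a₀ * a₃) + 2 * (a₁ * a₂) + 18 * a₄ ^ 2 : ℚ) = n ^ 2 * c₃ := by
        rw [h₃]; field_simp; ring
      exact_mod_cast this)
    (by
      have : (2 * (a₀ * a₄) + 2 * (a₁ * a₃) + a₂ ^ 2 : ℚ) = n ^ 2 * c₄ := by
        rw [h₄]; field_simp; ring
      exact_mod_cast this)
  have h8 : n' ^ 2 ≡ 1 [ZMOD 8] := by
    obtain ⟨j, hj⟩ := Int.even_mul_succ_self k
    rw [Int.modEq_iff_dvd]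
    exact ⟨-j, by rw [hk]; linear_combination (-4) * hj⟩
  have hred : redMod c₀ c₁ c₂ c₃ c₄ = mulMod (redMod t₀ t₁ t₂ t₃ t₄) (redMod t₀ t₁ t₂ t₃ t₄) := by
    rw [← redMod_mul]
    have : ∀ c x : ℤ, x = n' ^ 2 * c → c ≡ x [ZMOD 8] := by
      intro c x hx
      simpa [hx] using ((h8.mul_right c).symm)
    exact redMod_congr (this _ _ (by rw [← f₀]; ring)) (this _ _ (by rw [← f₁]; ring))
      (this _ _ (by rw [← f₂]; ring)) (this _ _ (by rw [← f₃]; ring))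
      (this _ _ (by rw [← f₄]; ring))
  obtain ⟨m₀, h₀, m₁, h₁, m₂, h₂, m₃, h₃, m₄, h₄, hm⟩ := mulMod_self_emod t₀ t₁ t₂ t₃ t₄
  simp only [isSquareMod, List.any_eq_true, List.mem_range, beq_iff_eq]
  exact ⟨m₀, h₀, m₁, h₁, m₂, h₂, m₃, h₃, m₄, h₄, hm.trans hred.symm⟩

end IsFifthRoot
end

section
variable {K : Type*} [Field K] [NumberField K] {s : K}

/-- `z` has integral coordinates on the powers of `s`, congruent to `r` modulo `8`. -/
def HasRed (s z : K) (r : ℕ × ℕ × ℕ × ℕ × ℕ) : Prop :=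
  ∃ c₀ c₁ c₂ c₃ c₄ : ℤ, z = vec s c₀ c₁ c₂ c₃ c₄ ∧ redMod c₀ c₁ c₂ c₃ c₄ = r

theorem hasRed_vec (c₀ c₁ c₂ c₃ c₄ : ℤ) :
    HasRed s (vec s c₀ c₁ c₂ c₃ c₄) (redMod c₀ c₁ c₂ c₃ c₄) := ⟨_, _, _, _, _, rfl, rfl⟩

namespace IsFifthRoot

theorem hasRed_mul (h : IsFifthRoot s) {x y : K} {a b : ℕ × ℕ × ℕ × ℕ × ℕ} (hx : HasRed s x a)
    (hy : HasRed s y b) : HasRed s (x * y) (mulMod a b) := by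
  obtain ⟨a₀, a₁, a₂, a₃, a₄, rfl, rfl⟩ := hx
  obtain ⟨b₀, b₁, b₂, b₃, b₄, rfl, rfl⟩ := hy
  refine ⟨_, _, _, _, _, ?_, redMod_mul ..⟩
  rw [h.vec_mul]
  push_cast
  congr 1

theorem isSquareMod_of_isSquare (h : IsFifthRoot s) {z : K} {r : ℕ × ℕ × ℕ × ℕ × ℕ}
    (hz : HasRed s z r) (hs : IsSquare z) : isSquareMod r = true := by
  obtain ⟨c₀, c₁, c₂, c₃, c₄, rfl, rfl⟩ := hz
  obtain ⟨t, ht⟩ := hs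
  exact h.isSquareMod_of_sq (t := t) (by rw [ht, sq])

theorem nrRealPlaces_le (h : IsFifthRoot s) : InfinitePlace.nrRealPlaces K ≤ 1 := by
  classical
  rw [← InfinitePlace.card_real_embeddings, Fintype.card_le_one_iff_subsingleton]
  refine ⟨fun φ ψ => Subtype.ext ?_⟩
  have key : ∀ φ : {φ : K →+* ℂ // ComplexEmbedding.IsReal φ}, ∃ r : ℝ, r ^ 5 = 18 ∧ φ.1 s = r := by
    intro φ
    refine ⟨φ.2.embedding s, ?_, by simp⟩
    rw [← map_pow, h.pow_five, map_ofNat]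
  obtain ⟨a, ha, ha'⟩ := key φ
  obtain ⟨b, hb, hb'⟩ := key ψ
  have hab : a = b := (Odd.strictMono_pow (n := 5) (by decide)).injective (by simp [ha, hb])
  ext z
  obtain ⟨z₀, z₁, z₂, z₃, z₄, rfl⟩ := h.exists_vec z
  simp [vec, ha', hb', hab]

theorem rank_le (h : IsFifthRoot s) : Units.rank K ≤ 2 := by
  have h1 := InfinitePlace.card_add_two_mul_card_eq_rank K
  have h2 := InfinitePlace.card_eq_nrRealPlaces_add_nrComplexPlaces K
  rw [h.finrank_eq] at h1
  have h3 := h.nrRealPlaces_le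
  rw [Units.rank, h2]
  omega

theorem natCard_unit_quotient_le (h : IsFifthRoot s) :
    Finite ((𝓞 K)ˣ ⧸ (powMonoidHom 2 : (𝓞 K)ˣ →* (𝓞 K)ˣ).range) ∧
    Nat.card ((𝓞 K)ˣ ⧸ (powMonoidHom 2 : (𝓞 K)ˣ →* (𝓞 K)ˣ).range) ≤ 8 := by
  let g : Fin 2 × (Fin (Units.rank K) → Fin 2) →
      (𝓞 K)ˣ ⧸ (powMonoidHom 2 : (𝓞 K)ˣ →* (𝓞 K)ˣ).range := fun p =>
    QuotientGroup.mk ((-1) ^ (p.1 : ℕ) * ∏ i, Units.fundSystem K i ^ (p.2 i : ℕ))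
  have hg : Function.Surjective g := by
    intro q
    obtain ⟨u, rfl⟩ := QuotientGroup.mk_surjective q
    obtain ⟨⟨ζ, e⟩, hu, -⟩ := Units.exist_unique_eq_mul_prod K u
    have hζ : ∃ i : Fin 2, (ζ : (𝓞 K)ˣ) = (-1) ^ (i : ℕ) := by
      rcases Units.torsion_eq_one_or_neg_one_of_odd_finrank (by rw [h.finrank_eq]; decide) ζ with
        h | h
      · exact ⟨0, by simpa using h⟩
      · exact ⟨1, by simpa using h⟩
    obtain ⟨i, hi⟩ := hζ
    have he : ∀ k, ∃ j : Fin 2, ∃ m : ℤ, e k = (j : ℕ) + 2 * m := by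
      intro k
      rcases Int.even_or_odd' (e k) with ⟨m, hm | hm⟩
      · exact ⟨0, m, by simp [hm]⟩
      · exact ⟨1, m, by simp [hm, add_comm]⟩
    choose j m hm using he
    refine ⟨(i, j), ?_⟩
    rw [QuotientGroup.eq]
    refine ⟨∏ k, Units.fundSystem K k ^ m k, ?_⟩
    dsimp only at hu
    rw [hu, hi, powMonoidHom_apply, eq_inv_mul_iff_mul_eq, mul_assoc, ← Finset.prod_pow,
      ← Finset.prod_mul_distrib]
    congr 1
    refine Finset.prod_congr rfl fun k _ => ?_
    rw [hm k, zpow_add, zpow_natCast, mul_comm (2 : ℤ), zpow_mul]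
    norm_cast
  refine ⟨Finite.of_surjective g hg, (Nat.card_le_card_of_surjective g hg).trans ?_⟩
  have : 2 ^ Units.rank K ≤ 2 ^ 2 := Nat.pow_le_pow_right (by norm_num) h.rank_le
  simp only [Nat.card_eq_fintype_card, Fintype.card_prod, Fintype.card_fin, Fintype.card_pi,
    Finset.prod_const, Finset.card_univ]
  omega

/-- A unit of norm `1`. -/
noncomputable def nu (h : IsFifthRoot s) : (𝓞 K)ˣ where
  val := h.int 5 5 6 (-3) (-4)
  inv := h.int 55 (-85) (-279) 152 201
  val_inv := by
    apply RingOfIntegers.coe_injective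
    simp only [map_mul, h.coe_int, map_one, h.vec_mul]
    norm_num [vec]
  inv_val := by
    apply RingOfIntegers.coe_injective
    simp only [map_mul, h.coe_int, map_one, h.vec_mul]
    norm_num [vec]

/-- A unit of norm `-1`. -/
noncomputable def rho (h : IsFifthRoot s) : (𝓞 K)ˣ where
  val := h.int 3 4 6 (-1) (-4)
  inv := h.int (-17) 26 86 (-47) (-62)
  val_inv := by
    apply RingOfIntegers.coe_injective
    simp only [map_mul, h.coe_int, map_one, h.vec_mul]
    norm_num [vec]
  inv_val := by
    apply RingOfIntegers.coe_injective
    simp only [map_mul, h.coe_int, map_one, h.vec_mul]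
    norm_num [vec]

theorem coe_nu (h : IsFifthRoot s) : ((h.nu : 𝓞 K) : K) * 15 ^ 2 =
    vec s (765 : ℤ) (405 : ℤ) (-90 : ℤ) (-105 : ℤ) (-60 : ℤ) := by
  simp only [nu, h.coe_int, vec]
  push_cast
  ring

theorem coe_rho (h : IsFifthRoot s) : ((h.rho : 𝓞 K) : K) * 15 ^ 2 =
    vec s (315 : ℤ) (180 : ℤ) (-90 : ℤ) (45 : ℤ) (-60 : ℤ) := by
  simp only [rho, h.coe_int, vec]
  push_cast
  ring

/-- Square classes modulo `8` of products of `-1`, `nu`, `rho`. -/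
def unitRed (i j k : ℕ) : ℕ × ℕ × ℕ × ℕ × ℕ :=
  mulMod (mulMod (if i = 0 then (1, 0, 0, 0, 0) else (7, 0, 0, 0, 0))
    (if j = 0 then (1, 0, 0, 0, 0) else (5, 5, 6, 7, 4)))
    (if k = 0 then (1, 0, 0, 0, 0) else (3, 4, 6, 5, 4))

theorem eq_zero_of_isSquareMod_unitRed : ∀ i j k : Fin 2,
    isSquareMod (unitRed i j k) = true → i = 0 ∧ j = 0 ∧ k = 0 := by
  decide +kernel

theorem hasRed_unit (h : IsFifthRoot s) (i j k : Fin 2) :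
    HasRed s (((-1) ^ (i : ℕ) * ((h.nu : 𝓞 K) : K) ^ (j : ℕ) * ((h.rho : 𝓞 K) : K) ^ (k : ℕ)) *
      (15 ^ ((j : ℕ) + k)) ^ 2) (unitRed i j k) := by
  have e : ((-1) ^ (i : ℕ) * ((h.nu : 𝓞 K) : K) ^ (j : ℕ) * ((h.rho : 𝓞 K) : K) ^ (k : ℕ)) *
      (15 ^ ((j : ℕ) + k)) ^ 2 = ((-1) ^ (i : ℕ) * (((h.nu : 𝓞 K) : K) * 15 ^ 2) ^ (j : ℕ)) *
        (((h.rho : 𝓞 K) : K) * 15 ^ 2) ^ (k : ℕ) := by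
    rw [← pow_mul, mul_comm _ 2, pow_mul, pow_add]; generalize (15 : K) ^ 2 = c; ring
  have h1 : HasRed s 1 (1, 0, 0, 0, 0) := ⟨1, 0, 0, 0, 0, by simp [vec], by decide⟩
  rw [e]
  refine h.hasRed_mul (h.hasRed_mul ?_ ?_) ?_
  · fin_cases i
    · simpa using h1
    · exact ⟨-1, 0, 0, 0, 0, by simp [vec], by decide⟩
  · fin_cases j
    · simpa using h1
    · exact ⟨_, _, _, _, _, by rw [← h.coe_nu]; exact pow_one _, by decide⟩
  · fin_cases k
    · simpa using h1
    · exact ⟨_, _, _, _, _, by rw [← h.coe_rho]; exact pow_one _, by decide⟩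

theorem eq_zero_of_isSquare_unit (h : IsFifthRoot s) {i j k : Fin 2}
    (hs : IsSquare ((-1) ^ (i : ℕ) * h.nu ^ (j : ℕ) * h.rho ^ (k : ℕ))) :
    i = 0 ∧ j = 0 ∧ k = 0 := by
  apply eq_zero_of_isSquareMod_unitRed
  refine h.isSquareMod_of_isSquare (h.hasRed_unit i j k) ?_
  refine IsSquare.mul ?_ (IsSquare.sq _)
  have := (hs.map (Units.coeHom (𝓞 K))).map (algebraMap (𝓞 K) K)
  simpa using this

/-- Modulo squares the units are generated by `-1`, `nu` and `rho`. -/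
theorem exists_unit_eq (h : IsFifthRoot s) (u : (𝓞 K)ˣ) : ∃ (i j k : Fin 2) (w : (𝓞 K)ˣ),
    u = (-1) ^ (i : ℕ) * h.nu ^ (j : ℕ) * h.rho ^ (k : ℕ) * w ^ 2 := by
  obtain ⟨hfin, hcard⟩ := h.natCard_unit_quotient_le
  let f : Fin 2 × Fin 2 × Fin 2 → (𝓞 K)ˣ ⧸ (powMonoidHom 2 : (𝓞 K)ˣ →* (𝓞 K)ˣ).range :=
    fun p => QuotientGroup.mk ((-1) ^ (p.1 : ℕ) * h.nu ^ (p.2.1 : ℕ) * h.rho ^ (p.2.2 : ℕ))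
  have key : ∀ i i' : Fin 2, ∃ j : Fin 2, ∃ m : ℕ, (i : ℕ) + i' = j + 2 * m ∧ (j = 0 → i = i') := by
    intro i i'
    fin_cases i <;> fin_cases i'
    exacts [⟨0, 0, by simp⟩, ⟨1, 0, by simp⟩, ⟨1, 0, by simp⟩, ⟨0, 1, by simp⟩]
  have hf : Function.Injective f := by
    rintro ⟨i, j, k⟩ ⟨i', j', k'⟩ hpq
    obtain ⟨w, hw⟩ := QuotientGroup.eq.1 hpq
    dsimp only at hw
    rw [powMonoidHom_apply, eq_inv_mul_iff_mul_eq] at hw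
    obtain ⟨i'', a, hi, hi'⟩ := key i i'
    obtain ⟨j'', b, hj, hj'⟩ := key j j'
    obtain ⟨k'', c, hk, hk'⟩ := key k k'
    have h2 : IsSquare (((-1) ^ (i'' : ℕ) * h.nu ^ (j'' : ℕ) * h.rho ^ (k'' : ℕ)) *
        ((-1) ^ a * h.nu ^ b * h.rho ^ c) ^ 2) := by
      refine ⟨w * ((-1) ^ (i : ℕ) * h.nu ^ (j : ℕ) * h.rho ^ (k : ℕ)), ?_⟩
      have hw' := congrArg (((-1) ^ (i : ℕ) * h.nu ^ (j : ℕ) * h.rho ^ (k : ℕ)) * ·) hw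
      refine (Eq.trans ?_ hw'.symm).trans ?_
      · trans (-1 : (𝓞 K)ˣ) ^ ((i : ℕ) + i') * h.nu ^ ((j : ℕ) + j') * h.rho ^ ((k : ℕ) + k')
        · rw [hi, hj, hk]
          exact Units.ext (by push_cast; ring)
        · exact Units.ext (by push_cast; ring)
      · exact Units.ext (by push_cast; ring)
    have h3 : IsSquare ((-1) ^ (i'' : ℕ) * h.nu ^ (j'' : ℕ) * h.rho ^ (k'' : ℕ)) := by
      obtain ⟨r, hr⟩ := h2
      refine ⟨r * ((-1) ^ a * h.nu ^ b * h.rho ^ c)⁻¹, ?_⟩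
      rw [mul_mul_mul_comm, ← hr, ← sq, inv_pow, mul_inv_cancel_right]
    obtain ⟨r₁, r₂, r₃⟩ := h.eq_zero_of_isSquare_unit h3
    rw [hi' r₁, hj' r₂, hk' r₃]
  have hb := hf.bijective_of_nat_card_le (by simpa using hcard)
  obtain ⟨⟨i, j, k⟩, hp⟩ := hb.2 (QuotientGroup.mk u)
  obtain ⟨w, hw⟩ := QuotientGroup.eq.1 hp
  rw [powMonoidHom_apply, eq_inv_mul_iff_mul_eq] at hw
  exact ⟨i, j, k, w, hw.symm⟩

end IsFifthRoot
end

section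

/-- The prime `q` divides `z` to an even power. -/
def EvenAt {R : Type*} [CommRing R] (q z : R) : Prop :=
  ∃ (n : ℕ) (w : R), z = q ^ (2 * n) * w ∧ ¬ q ∣ w

theorem evenAt_of_mul_eq_neg_sq {R : Type*} [CommRing R] [IsDomain R] [UniqueFactorizationMonoid R]
    {q x y z : R} (hq : Prime q) (hx : x ≠ 0) (hy : ¬ q ∣ y) (h : x * y = -z ^ 2) : EvenAt q x := by
  have hz : z ≠ 0 := by
    rintro rfl
    rw [zero_pow two_ne_zero, neg_zero, mul_eq_zero] at h
    exact h.elim hx fun h => hy (h ▸ dvd_zero _)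
  obtain ⟨m, v, hv, rfl⟩ := WfDvdMonoid.max_power_factor hx hq.irreducible
  obtain ⟨n, w, hw, rfl⟩ := WfDvdMonoid.max_power_factor hz hq.irreducible
  have hvy : ¬ q ∣ v * y := fun h => (hq.dvd_or_dvd h).elim hv hy
  have hww : ¬ q ∣ -w ^ 2 := by
    rw [dvd_neg]
    exact fun h => hw (hq.dvd_of_dvd_pow h)
  have h' : q ^ m * (v * y) = q ^ (2 * n) * (-w ^ 2) := by rw [← mul_assoc, h]; ring
  have hm : m = 2 * n := by
    rcases lt_trichotomy m (2 * n) with hlt | heq | hlt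
    · obtain ⟨k, hk⟩ := Nat.exists_eq_add_of_lt hlt
      rw [hk, add_assoc, pow_add, mul_assoc, mul_right_inj' (pow_ne_zero _ hq.ne_zero)] at h'
      exact absurd ⟨q ^ k * -w ^ 2, by rw [h']; ring⟩ hvy
    · exact heq
    · obtain ⟨k, hk⟩ := Nat.exists_eq_add_of_lt hlt
      rw [hk, add_assoc, pow_add, mul_assoc, mul_right_inj' (pow_ne_zero _ hq.ne_zero)] at h'
      exact absurd ⟨q ^ k * (v * y), by rw [← h']; ring⟩ hww
  exact ⟨n, v, by rw [hm], hv⟩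

theorem EvenAt.not_dvd_squarefree {R : Type*} [CommRing R] [IsDomain R]
    [UniqueFactorizationMonoid R] {q r w : R} (hq : Prime q) (hr : Squarefree r) (hw : w ≠ 0)
    (h : EvenAt q (r * w ^ 2)) : ¬ q ∣ r := by
  rintro ⟨r', rfl⟩
  have hr' : ¬ q ∣ r' := fun ⟨t, ht⟩ =>
    hq.not_isUnit (hr q ⟨t, by rw [ht]; ring⟩)
  obtain ⟨n, w, hw', rfl⟩ := WfDvdMonoid.max_power_factor hw hq.irreducible
  obtain ⟨m, v, hv, hv'⟩ := h
  have h1 : q ^ (2 * m) * v = q ^ (2 * n + 1) * (r' * w ^ 2) := by rw [hv.symm]; ring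
  have h2 : ¬ q ∣ r' * w ^ 2 := fun h =>
    (hq.dvd_or_dvd h).elim hr' fun h => hw' (hq.dvd_of_dvd_pow h)
  rcases lt_or_ge (2 * m) (2 * n + 1) with hlt | hlt
  · obtain ⟨k, hk⟩ := Nat.exists_eq_add_of_lt hlt
    rw [hk, add_assoc, pow_add, mul_assoc, mul_right_inj' (pow_ne_zero _ hq.ne_zero)] at h1
    exact hv' ⟨q ^ k * (r' * w ^ 2), by rw [h1]; ring⟩
  · obtain ⟨k, hk⟩ := Nat.exists_eq_add_of_lt (show 2 * n + 1 < 2 * m by omega)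
    rw [hk, add_assoc, pow_add, mul_assoc, mul_right_inj' (pow_ne_zero _ hq.ne_zero)] at h1
    exact h2 ⟨q ^ k * v, by rw [← h1]; ring⟩

theorem exists_squarefree_mul_sq {R : Type*} [CommRing R] [IsDomain R]
    [UniqueFactorizationMonoid R] {z : R} (hz : z ≠ 0) :
    ∃ r w : R, z = r * w ^ 2 ∧ Squarefree r := by
  induction z using UniqueFactorizationMonoid.induction_on_prime with
  | h₁ => exact absurd rfl hz
  | h₂ u hu => exact ⟨u, 1, by simp, hu.squarefree⟩
  | h₃ a p ha hp ih =>
    obtain ⟨r, w, rfl, hr⟩ := ih ha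
    by_cases hpr : p ∣ r
    · obtain ⟨r', rfl⟩ := hpr
      exact ⟨r', p * w, by ring, hr.of_mul_right⟩
    · refine ⟨p * r, w, by ring, ?_⟩
      rw [squarefree_mul_iff]
      exact ⟨(hp.irreducible.isRelPrime_iff_not_dvd).2 hpr, hp.squarefree, hr⟩

theorem exists_eq_pow_mul_of_squarefree {R : Type*} [CommRing R] [IsDomain R] {r q : R}
    (hq : Prime q) (hr : Squarefree r) : ∃ (e : Fin 2) (r' : R), r = q ^ (e : ℕ) * r' ∧
      ¬ q ∣ r' ∧ Squarefree r' ∧ r' ∣ r := by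
  by_cases h : q ∣ r
  · obtain ⟨r', rfl⟩ := h
    refine ⟨1, r', by simp, fun ⟨t, ht⟩ => ?_, hr.of_mul_right, dvd_mul_left _ _⟩
    exact hq.not_isUnit (hr q ⟨t, by rw [ht]; ring⟩)
  · exact ⟨0, r, by simp, h, hr, dvd_rfl⟩

theorem exists_eq_C_mul_of_map_eq_zero {p : ℕ} {P : ℤ[X]}
    (h : P.map (Int.castRingHom (ZMod p)) = 0) : ∃ Q : ℤ[X], P = C (p : ℤ) * Q := by
  change C (p : ℤ) ∣ P
  rw [C_dvd_iff_dvd_coeff]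
  intro i
  have := congrArg (coeff · i) h
  simpa [coeff_map, ZMod.intCast_zmod_eq_zero_iff_dvd] using this

theorem evenAt_aeval {R : Type*} [CommRing R] [IsDomain R] [UniqueFactorizationMonoid R] {q x : R}
    (hq : Prime q) {p : ℕ} (hp : p.Prime) (hqp : ∀ n : ℤ, q ∣ (n : R) ↔ (p : ℤ) ∣ n)
    (hp30 : ¬ (p : ℤ) ∣ 30) (hx : x ^ 5 = 768) {A : ℤ[X]} (hA : A.natDegree ≤ 2)
    (hAp : A.map (Int.castRingHom (ZMod p)) ≠ 0) (hAx : aeval x A ≠ 0) :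
    ∀ (n : ℕ) (D : ℤ) (B C' : ℤ[X]), D.natAbs = n → D ≠ 0 →
      C (D ^ 2) * (X ^ 5 - 768) - B ^ 2 = A * C' → EvenAt q (aeval x A) := by
  have : Fact p.Prime := ⟨hp⟩
  have h768 : aeval x (768 : ℤ[X]) = 768 := map_ofNat _ _
  have hevenof : ∀ (D : ℤ) (B C' : ℤ[X]), C (D ^ 2) * (X ^ 5 - 768) - B ^ 2 = A * C' →
      ¬ q ∣ aeval x C' → EvenAt q (aeval x A) := by
    intro D B C' h hC
    refine evenAt_of_mul_eq_neg_sq (z := aeval x B) hq hAx hC ?_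
    rw [← map_mul, ← h]
    simp [hx, h768]
  intro n
  induction n using Nat.strong_induction_on with
  | _ n ih =>
    intro D B C' hDn hD h
    by_cases hpD : (p : ℤ) ∣ D
    · obtain ⟨D₁, rfl⟩ := hpD
      set φ := Int.castRingHom (ZMod p) with hφ
      have hsurj : Function.Surjective (Polynomial.map φ) :=
        map_surjective _ (ZMod.ringHom_surjective φ)
      obtain ⟨Q, hQ⟩ := hsurj (B.map φ / A.map φ)
      have hpφ : φ (p : ℤ) = 0 := by simp [hφ]
      have hmap : (B - A * Q).map φ = B.map φ % A.map φ := by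
        rw [Polynomial.map_sub, Polynomial.map_mul, hQ, ← EuclideanDomain.mod_eq_sub_mul_div]
      have h2 : C ((p * D₁) ^ 2) * (X ^ 5 - 768) - (B - A * Q) ^ 2 =
          A * (C' + 2 * B * Q - A * Q ^ 2) := by linear_combination h
      set B₂ := B - A * Q with hB₂
      set C₂ := C' + 2 * B * Q - A * Q ^ 2 with hC₂
      by_cases hr : B.map φ % A.map φ = 0
      · obtain ⟨B₁, hB₁⟩ := exists_eq_C_mul_of_map_eq_zero (hmap.trans hr)
        have hCp : Prime (C (p : ℤ)) := prime_C_iff.2 (Nat.prime_iff_prime_int.1 hp)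
        have hAC : ¬ C (p : ℤ) ∣ A := by
          rintro ⟨E, rfl⟩
          apply hAp
          rw [Polynomial.map_mul, map_C, hpφ, C_0, zero_mul]
        rw [hB₁] at h2
        have h3 : C (p : ℤ) ^ 2 * (C (D₁ ^ 2) * (X ^ 5 - 768) - B₁ ^ 2) = A * C₂ := by
          rw [← h2]; simp only [map_mul, map_pow]; ring
        obtain ⟨C₃, hC₃⟩ := (hCp.pow_dvd_of_dvd_mul_left 2 hAC ⟨_, h3.symm⟩)
        rw [hC₃, mul_left_comm] at h3
        refine ih D₁.natAbs ?_ D₁ B₁ C₃ rfl (right_ne_zero_of_mul hD)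
          (mul_left_cancel₀ (pow_ne_zero _ hCp.ne_zero) h3)
        rw [← hDn, Int.natAbs_mul, Int.natAbs_natCast]
        have := Int.natAbs_pos.2 (right_ne_zero_of_mul hD)
        have := hp.two_le
        nlinarith
      · have h4 : -(B.map φ % A.map φ) ^ 2 = A.map φ * C₂.map φ := by
          have := congrArg (Polynomial.map φ) h2
          rw [Polynomial.map_sub, Polynomial.map_mul, Polynomial.map_mul, Polynomial.map_pow, map_C,
            map_pow, map_mul, hpφ, hmap] at this
          rw [← this]; simp
        have hC₂0 : C₂.map φ ≠ 0 := by
          intro h0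
          rw [h0, mul_zero, neg_eq_zero] at h4
          exact hr (pow_eq_zero_iff two_ne_zero |>.1 h4)
        have h5 : 2 * (B.map φ % A.map φ).natDegree =
            (A.map φ).natDegree + (C₂.map φ).natDegree := by
          rw [← natDegree_mul hAp hC₂0, ← h4, natDegree_neg, natDegree_pow]
        have h6 : (A.map φ).natDegree ≤ 2 := (natDegree_map_le).trans hA
        have h7 : (A.map φ).natDegree ≠ 0 := by
          intro h0
          rw [eq_C_of_natDegree_eq_zero h0] at hr
          apply hr
          rw [EuclideanDomain.mod_eq_zero]
          have : IsUnit (C ((A.map φ).coeff 0)) := by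
            rw [isUnit_C, isUnit_iff_ne_zero]
            rintro h00
            exact hAp (by rw [eq_C_of_natDegree_eq_zero h0, h00, C_0])
          exact this.dvd
        have h8 : (B.map φ % A.map φ).natDegree < (A.map φ).natDegree := natDegree_mod_lt _ h7
        have h9 : (C₂.map φ).natDegree = 0 := by omega
        obtain ⟨E, hE⟩ := exists_eq_C_mul_of_map_eq_zero (p := p) (P := C₂ - C (C₂.coeff 0)) (by
          rw [Polynomial.map_sub, map_C, eq_C_of_natDegree_eq_zero h9, coeff_map, sub_self])
        refine hevenof _ _ _ h2 fun hdvd => hC₂0 ?_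
        have h10 : aeval x C₂ = (C₂.coeff 0 : ℤ) + (p : ℤ) * aeval x E := by
          rw [sub_eq_iff_eq_add] at hE
          conv_lhs => rw [hE]
          simp [add_comm]
        have hqp' : q ∣ ((p : ℤ) : R) := (hqp p).2 dvd_rfl
        rw [h10, dvd_add_left (hqp'.mul_right _), hqp] at hdvd
        rw [eq_C_of_natDegree_eq_zero h9, coeff_map]
        have : φ (C₂.coeff 0) = 0 := by
          simpa [hφ, ZMod.intCast_zmod_eq_zero_iff_dvd] using hdvd
        rw [this, C_0]
    · by_cases hA' : q ∣ aeval x A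
      · by_cases hC' : q ∣ aeval x C'
        · exfalso
          have hB : q ∣ aeval x B := by
            refine hq.dvd_of_dvd_pow (n := 2) ?_
            have : aeval x B ^ 2 = -(aeval x A * aeval x C') := by
              rw [← map_mul, ← h]; simp [hx, h768]
            rw [this]
            exact (hA'.mul_right _).neg_right
          have h2 : C (D ^ 2) * (5 * X ^ 4) - 2 * B * derivative B =
              derivative A * C' + A * derivative C' := by
            have := congrArg derivative h
            rw [derivative_sub, derivative_mul, derivative_C, derivative_mul, derivative_sq,
              derivative_sub, derivative_X_pow, derivative_ofNat] at this
            rw [← this]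
            simp
          replace h2 := congrArg (aeval x) h2
          simp only [map_sub, map_mul, map_add, map_pow, aeval_C, aeval_X, map_ofNat] at h2
          have h3 : q ∣ ((D ^ 2 * 5 : ℤ) : R) * x ^ 4 := by
            obtain ⟨a, ha⟩ := hA'
            obtain ⟨b, hb⟩ := hB
            obtain ⟨c, hc⟩ := hC'
            rw [ha, hb, hc] at h2
            refine ⟨2 * b * aeval x (derivative B) + aeval x (derivative A) * c +
              a * aeval x (derivative C'), ?_⟩
            push_cast
            rw [algebraMap_int_eq, eq_intCast] at h2
            linear_combination h2
          rcases hq.dvd_or_dvd h3 with h4 | h4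
          · rw [hqp] at h4
            rcases (Nat.prime_iff_prime_int.1 hp).dvd_or_dvd h4 with h5 | h5
            · exact hpD ((Nat.prime_iff_prime_int.1 hp).dvd_of_dvd_pow h5)
            · exact hp30 (h5.trans (by norm_num))
          · have h5 : q ∣ ((768 : ℤ) : R) := by
              have := (hq.dvd_of_dvd_pow h4).trans (dvd_pow_self x (n := 5) (by norm_num))
              rw [hx] at this
              exact_mod_cast this
            rw [hqp] at h5
            have h6 : (768 : ℤ) = 2 ^ 8 * 3 := by norm_num
            rw [h6] at h5
            rcases (Nat.prime_iff_prime_int.1 hp).dvd_or_dvd h5 with h5 | h5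
            · exact hp30 (((Nat.prime_iff_prime_int.1 hp).dvd_of_dvd_pow h5).trans (by norm_num))
            · exact hp30 (h5.trans (by norm_num))
        · exact hevenof _ _ _ h hC'
      · exact ⟨0, _, by simp, hA'⟩

end

section
variable {K : Type*} [Field K] [NumberField K] {s : K}

theorem exists_prime_dvd_iff {q : 𝓞 K} (hq : Prime q) :
    ∃ p : ℕ, p.Prime ∧ ∀ n : ℤ, q ∣ (n : 𝓞 K) ↔ (p : ℤ) ∣ n := by
  have hn : Ideal.absNorm (Ideal.span {q}) ≠ 0 := by
    rw [Ideal.absNorm_ne_zero_iff_mem_nonZeroDivisors, mem_nonZeroDivisors_iff_ne_zero]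
    simpa using hq.ne_zero
  have hdvd : q ∣ ((Ideal.absNorm (Ideal.span {q}) : ℕ) : 𝓞 K) :=
    Ideal.mem_span_singleton.1 (Ideal.absNorm_mem _)
  rw [← Nat.prod_primeFactorsList hn, Nat.cast_list_prod, hq.dvd_prod_iff] at hdvd
  obtain ⟨a, ha, hqa⟩ := hdvd
  obtain ⟨p, hp, rfl⟩ := List.mem_map.1 ha
  have hpp := Nat.prime_of_mem_primeFactorsList hp
  refine ⟨p, hpp, fun n => ⟨fun h => ?_, fun ⟨m, hm⟩ => ?_⟩⟩
  · by_contra hpn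
    obtain ⟨a, b, hab⟩ := ((Nat.prime_iff_prime_int.1 hpp).coprime_iff_not_dvd).2 hpn
    refine hq.not_isUnit (isUnit_of_dvd_one ?_)
    have : (1 : 𝓞 K) = a * (p : 𝓞 K) + b * (n : 𝓞 K) := by exact_mod_cast hab.symm
    rw [this]
    exact dvd_add (hqa.mul_left _) (h.mul_left _)
  · rw [hm]
    push_cast
    exact hqa.mul_right _

theorem prime_of_norm {g : 𝓞 K} {n : ℤ} (hn : n.natAbs.Prime) (hN : Algebra.norm ℚ (g : K) = n) :
    Prime g := by
  apply Ideal.prime_of_irreducible_absNorm_span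
  · rintro rfl
    have : Module.Finite ℚ K := inferInstance
    rw [RingOfIntegers.coe_eq_algebraMap, map_zero, Algebra.norm_zero] at hN
    have : n = 0 := by exact_mod_cast hN.symm
    simp [this] at hn
    exact absurd hn (by norm_num)
  · rw [Ideal.absNorm_span_singleton, IsFifthRoot.norm_int_eq g n hN]
    exact hn

theorem exists_int_poly (a : ℚ[X]) :
    ∃ (A : ℤ[X]) (n : ℤ), n ≠ 0 ∧ A.map (Int.castRingHom ℚ) = C (n : ℚ) * a := by
  obtain ⟨b, hb, h⟩ := IsLocalization.integerNormalization_spec (nonZeroDivisors ℤ) a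
  refine ⟨IsLocalization.integerNormalization (nonZeroDivisors ℤ) a, b,
    nonZeroDivisors.ne_zero hb, ?_⟩
  simpa using h

theorem exists_primitive_int_poly {a : ℚ[X]} (ha : a ≠ 0) :
    ∃ (A : ℤ[X]) (k : ℚ), k ≠ 0 ∧ A.IsPrimitive ∧ A.map (Int.castRingHom ℚ) = C k * a := by
  obtain ⟨P, b, hb, h⟩ := exists_int_poly a
  have hb0 : (b : ℚ) ≠ 0 := by exact_mod_cast hb
  have hP : P ≠ 0 := by
    rintro rfl
    rw [Polynomial.map_zero] at h
    exact (mul_ne_zero (C_ne_zero.2 hb0) ha) h.symm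
  have hc : (P.content : ℚ) ≠ 0 := by exact_mod_cast mt content_eq_zero_iff.1 hP
  refine ⟨P.primPart, (P.content : ℚ)⁻¹ * b, mul_ne_zero (inv_ne_zero hc) hb0,
    P.isPrimitive_primPart, ?_⟩
  have h2 : C (P.content : ℚ) * P.primPart.map (Int.castRingHom ℚ) = C (b : ℚ) * a := by
    rw [← h]
    conv_rhs => rw [P.eq_C_content_mul_primPart, Polynomial.map_mul, map_C, eq_intCast]
  rw [C_mul, mul_assoc, ← h2, ← mul_assoc, ← C_mul, inv_mul_cancel₀ hc, C_1, one_mul]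

/-- The root of `4 X ^ 5 - 3`. -/
noncomputable def theta (s : K) : K := s ^ 3 / 6

theorem map_ne_zero_of_isPrimitive {A : ℤ[X]} (hA : A.IsPrimitive) {p : ℕ} (hp : p.Prime) :
    A.map (Int.castRingHom (ZMod p)) ≠ 0 := by
  intro h0
  obtain ⟨Q, hQ⟩ := exists_eq_C_mul_of_map_eq_zero h0
  have := hA p ⟨Q, hQ⟩
  exact (Nat.prime_iff_prime_int.1 hp).not_isUnit this

namespace IsFifthRoot

theorem theta_pow (h : IsFifthRoot s) : 4 * theta s ^ 5 = 3 := by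
  have : theta s ^ 5 = (s ^ 5) ^ 3 / 6 ^ 5 := by rw [theta]; ring
  rw [this, h.pow_five]
  norm_num

theorem coe_int_theta (h : IsFifthRoot s) : (h.int 0 0 0 2 0 : K) = 4 * theta s := by
  rw [h.coe_int, theta]
  simp [vec]
  ring

/-- Scaling a rational factor of `4 X ^ 5 - 3 - b ^ 2` to an integral primitive factor. -/
theorem exists_int_factor (h : IsFifthRoot s) {a b c : ℚ[X]} (ha : a ≠ 0) (hd : a.natDegree ≤ 2)
    (habc : 4 * X ^ 5 - 3 - b ^ 2 = a * c) :
    ∃ (A : ℤ[X]) (k : ℚ), k ≠ 0 ∧ A.IsPrimitive ∧ A.natDegree ≤ 2 ∧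
      (aeval (h.int 0 0 0 2 0) A : K) = k * aeval (theta s) a ∧
      ∃ (D : ℤ) (B C' : ℤ[X]), D ≠ 0 ∧ C (D ^ 2) * (X ^ 5 - 768) - B ^ 2 = A * C' := by
  set τ : ℚ[X] := C (1 / 4) * X with hτ
  have hτd : τ.natDegree = 1 := natDegree_C_mul_X _ (by norm_num)
  have ha' : a.comp τ ≠ 0 := by
    intro h0
    rw [comp_eq_zero_iff] at h0
    rcases h0 with h0 | ⟨-, h0⟩
    · exact ha h0
    · rw [h0, natDegree_C] at hτd; omega
  obtain ⟨A, k, hk, hA, hAk⟩ := exists_primitive_int_poly ha'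
  obtain ⟨B, m, hm, hB⟩ := exists_int_poly (C 16 * b.comp τ)
  obtain ⟨E, n, hn, hE⟩ := exists_int_poly (C (256 / k) * c.comp τ)
  refine ⟨A, k, hk, hA, ?_, ?_, m * n, C n * B, C (m ^ 2 * n) * E, mul_ne_zero hm hn, ?_⟩
  · have : A.natDegree = (A.map (Int.castRingHom ℚ)).natDegree :=
      (natDegree_map_eq_of_injective (RingHom.injective_int _) A).symm
    rw [this, hAk, natDegree_C_mul hk, natDegree_comp, hτd]
    omega
  · have h1 : (aeval (h.int 0 0 0 2 0) A : K) = aeval (h.int 0 0 0 2 0 : K) A :=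
      (aeval_algebraMap_apply K _ A).symm
    have h2 : aeval (h.int 0 0 0 2 0 : K) A =
        aeval (h.int 0 0 0 2 0 : K) (A.map (Int.castRingHom ℚ)) :=
      (aeval_map_algebraMap ℚ _ A).symm
    rw [h1, h2, hAk, map_mul, aeval_C, aeval_comp, h.coe_int_theta]
    congr 2
    simp [hτ]
  · apply map_injective (Int.castRingHom ℚ) (RingHom.injective_int _)
    have h3 := congrArg (fun P => C 256 * P.comp τ) habc
    simp only [sub_comp, mul_comp, pow_comp, X_comp, ofNat_comp] at h3
    have h4 : C (256 : ℚ) = C k * C (256 / k) := by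
      rw [← C_mul, mul_div_cancel₀ _ hk]
    simp only [Polynomial.map_sub, Polynomial.map_mul, Polynomial.map_pow, map_X, hB, hE,
      hAk, eq_intCast, Polynomial.map_ofNat]
    have h5 : C (256 : ℚ) * (4 * τ ^ 5 - 3) = X ^ 5 - 768 := by
      have : (4 : ℚ[X]) = C 4 := rfl
      have h3 : (3 : ℚ[X]) = C 3 := rfl
      have h7 : (768 : ℚ[X]) = C 768 := rfl
      rw [this, h3, h7, hτ, mul_pow, ← C_pow, mul_sub, ← mul_assoc, ← mul_assoc, ← C_mul, ← C_mul,
        ← C_mul]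
      norm_num
    have h6 : C (256 : ℚ) = C 16 ^ 2 := by rw [← C_pow]; norm_num
    rw [← h5]
    simp only [map_intCast, Polynomial.map_mul, Polynomial.map_pow,
      Polynomial.map_intCast, Int.cast_mul, Int.cast_pow]
    linear_combination (m : ℚ[X]) ^ 2 * (n : ℚ[X]) ^ 2 * h3 +
      (m : ℚ[X]) ^ 2 * (n : ℚ[X]) ^ 2 * (b.comp τ) ^ 2 * h6 +
      (m : ℚ[X]) ^ 2 * (n : ℚ[X]) ^ 2 * a.comp τ * c.comp τ * h4

end IsFifthRoot
end

section
variable {K : Type*} [Field K] [NumberField K] {s : K}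

namespace IsFifthRoot

theorem prime_int_two (h : IsFifthRoot s) : Prime (h.int 0 1 2 0 (-1)) :=
  prime_of_norm (by norm_num) h.norm_int_two

theorem prime_int_three (h : IsFifthRoot s) : Prime (h.int 1 (-1) (-3) 1 2) :=
  prime_of_norm (by norm_num) h.norm_int_three

theorem prime_int_five (h : IsFifthRoot s) : Prime (h.int 1 0 (-1) 1 1) :=
  prime_of_norm (by norm_num) h.norm_int_five

theorem prime_int_five' (h : IsFifthRoot s) : Prime (h.int 1 2 3 0 (-2)) :=
  prime_of_norm (by norm_num) h.norm_int_five'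

theorem int_mul_int_eq_one (h : IsFifthRoot s) :
    h.int 19 10 2 (-11) (-3) * h.int 7 (-20) (-6) (-7) 9 = 1 ∧
    h.int 107 (-165) (-541) 293 389 * h.int 99 15 122 (-26) (-68) = 1 ∧
    h.int (-3) (-8) (-9) (-1) 7 * h.int 3 0 (-5) 3 4 = 1 := by
  refine ⟨?_, ?_, ?_⟩ <;> apply RingOfIntegers.coe_injective <;>
    simp only [map_mul, h.coe_int, map_one, h.vec_mul] <;> norm_num [vec]

theorem exists_unit_two (h : IsFifthRoot s) : ∃ u : (𝓞 K)ˣ, 2 = h.int 0 1 2 0 (-1) ^ 5 * u :=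
  ⟨⟨_, _, mul_comm (h.int 19 10 2 (-11) (-3)) _ ▸ h.int_mul_int_eq_one.1,
    h.int_mul_int_eq_one.1⟩, by
    dsimp only
    rw [h.int_two_pow, mul_assoc, h.int_mul_int_eq_one.1, mul_one]⟩

theorem exists_unit_three (h : IsFifthRoot s) : ∃ u : (𝓞 K)ˣ, 3 = h.int 1 (-1) (-3) 1 2 ^ 5 * u :=
  ⟨⟨_, _, mul_comm (h.int 107 (-165) (-541) 293 389) _ ▸ h.int_mul_int_eq_one.2.1,
    h.int_mul_int_eq_one.2.1⟩, by
    dsimp only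
    rw [h.int_three_pow, mul_assoc, h.int_mul_int_eq_one.2.1, mul_one]⟩

theorem exists_unit_five (h : IsFifthRoot s) :
    ∃ u : (𝓞 K)ˣ, 5 = h.int 1 0 (-1) 1 1 * h.int 1 2 3 0 (-2) ^ 4 * u :=
  ⟨⟨_, _, mul_comm (h.int (-3) (-8) (-9) (-1) 7) _ ▸ h.int_mul_int_eq_one.2.2,
    h.int_mul_int_eq_one.2.2⟩, by
    dsimp only
    rw [h.int_five_mul, mul_assoc, h.int_mul_int_eq_one.2.2, mul_one]⟩

theorem coe_mul_eq (h : IsFifthRoot s) :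
    (h.int 0 1 2 0 (-1) * h.int 1 0 (-1) 1 1 * h.int 1 2 3 0 (-2) : K) = s + 2 := by
  simp only [h.coe_int, h.vec_mul]
  norm_num [vec]
  ring

/-- An element whose valuation is even away from `30`, in terms of the primes above `30`. -/
theorem exists_eq_of_evenAt (h : IsFifthRoot s) {z : 𝓞 K} (hz : z ≠ 0)
    (hev : ∀ q : 𝓞 K, Prime q → ¬ q ∣ 30 → EvenAt q z) :
    ∃ (e₁ e₂ e₃ e₄ : Fin 2) (u : (𝓞 K)ˣ) (w : 𝓞 K), w ≠ 0 ∧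
      z = h.int 0 1 2 0 (-1) ^ (e₁ : ℕ) * h.int 1 (-1) (-3) 1 2 ^ (e₂ : ℕ) *
        h.int 1 0 (-1) 1 1 ^ (e₃ : ℕ) * h.int 1 2 3 0 (-2) ^ (e₄ : ℕ) * u * w ^ 2 := by
  have := h.isPrincipalIdealRing
  obtain ⟨r, w, rfl, hr⟩ := exists_squarefree_mul_sq hz
  have hw : w ≠ 0 := by rintro rfl; simp at hz
  have h30 : ∀ q : 𝓞 K, Prime q → q ∣ r → q ∣ 30 := by
    intro q hq hqr
    by_contra hq30
    exact (hev q hq hq30).not_dvd_squarefree hq hr hw hqr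
  obtain ⟨e₁, r₁, rfl, n₁, s₁, -⟩ := exists_eq_pow_mul_of_squarefree h.prime_int_two hr
  obtain ⟨e₂, r₂, rfl, n₂, s₂, d₂⟩ := exists_eq_pow_mul_of_squarefree h.prime_int_three s₁
  obtain ⟨e₃, r₃, rfl, n₃, s₃, d₃⟩ := exists_eq_pow_mul_of_squarefree h.prime_int_five s₂
  obtain ⟨e₄, r₄, rfl, n₄, s₄, d₄⟩ := exists_eq_pow_mul_of_squarefree h.prime_int_five' s₃
  have hu : IsUnit r₄ := by
    by_contra hu
    obtain ⟨q, hqi, hq⟩ := WfDvdMonoid.exists_irreducible_factor hu s₄.ne_zero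
    have hqp := hqi.prime
    have key : ∀ g : 𝓞 K, Prime g → q ∣ g → g ∣ r₄ := fun g hg hqg =>
      ((hqp.dvd_prime_iff_associated hg).1 hqg).symm.dvd.trans hq
    have h3 := h30 q hqp ((((hq.mul_left _).mul_left _).mul_left _).mul_left _)
    obtain ⟨u₂, hu₂⟩ := h.exists_unit_two
    obtain ⟨u₃, hu₃⟩ := h.exists_unit_three
    obtain ⟨u₅, hu₅⟩ := h.exists_unit_five
    have e30 : (30 : 𝓞 K) = 2 * 3 * 5 := by norm_num
    rw [e30, hu₂, hu₃, hu₅] at h3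
    have hun : ∀ u : (𝓞 K)ˣ, ¬ q ∣ u := fun u hqu => hqp.not_isUnit (isUnit_of_dvd_unit hqu u.isUnit)
    rcases hqp.dvd_or_dvd h3 with h3 | h3
    · rcases hqp.dvd_or_dvd h3 with h3 | h3
      · rcases hqp.dvd_or_dvd h3 with h3 | h3
        · exact n₁ (((((key _ h.prime_int_two (hqp.dvd_of_dvd_pow h3)).mul_left _).mul_left _)).mul_left _)
        · exact hun _ h3
      · rcases hqp.dvd_or_dvd h3 with h3 | h3
        · exact n₂ (((key _ h.prime_int_three (hqp.dvd_of_dvd_pow h3)).mul_left _).mul_left _)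
        · exact hun _ h3
    · rcases hqp.dvd_or_dvd h3 with h3 | h3
      · rcases hqp.dvd_or_dvd h3 with h3 | h3
        · exact n₃ ((key _ h.prime_int_five h3).mul_left _)
        · exact n₄ (key _ h.prime_int_five' (hqp.dvd_of_dvd_pow h3))
      · exact hun _ h3
  obtain ⟨u, rfl⟩ := hu
  exact ⟨e₁, e₂, e₃, e₄, u, w, hw, by ring⟩

theorem norm_unit (u : (𝓞 K)ˣ) : ∃ ε : ℤˣ, Algebra.norm ℚ ((u : 𝓞 K) : K) = (ε : ℤ) := by
  refine ⟨Units.map (Algebra.norm ℤ : 𝓞 K →* ℤ) u, ?_⟩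
  rw [Units.coe_map, ← Algebra.coe_norm_int]

/-- A factor `a` of degree at most `2` of `4 X ^ 5 - 3 - b ^ 2` takes at `theta` a value whose square
class is supported on `nu`, `-rho` and `(s + 2) / 2`. -/
theorem norm_nu (h : IsFifthRoot s) : Algebra.norm ℚ ((h.nu : 𝓞 K) : K) = 1 := by
  have := congrArg (Algebra.norm ℚ) h.coe_nu
  rw [h.norm_vec, map_mul, map_pow, show (15 : K) = algebraMap ℚ K 15 by simp,
    Algebra.norm_algebraMap, h.finrank_eq] at this
  norm_num at this
  linarith

theorem norm_rho (h : IsFifthRoot s) : Algebra.norm ℚ ((h.rho : 𝓞 K) : K) = -1 := by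
  have := congrArg (Algebra.norm ℚ) h.coe_rho
  rw [h.norm_vec, map_mul, map_pow, show (15 : K) = algebraMap ℚ K 15 by simp,
    Algebra.norm_algebraMap, h.finrank_eq] at this
  norm_num at this
  linarith

theorem norm_half (h : IsFifthRoot s) : Algebra.norm ℚ ((s + 2) / 2) = 25 / 16 := by
  have : (s + 2) / 2 = vec s 1 (1 / 2) 0 0 0 := by
    simp only [vec]
    push_cast
    ring
  rw [this, h.norm_vec]
  norm_num

theorem norm_neg_one (h : IsFifthRoot s) : Algebra.norm ℚ (-1 : K) = -1 := by
  have : (-1 : K) = vec s (-1) 0 0 0 0 := by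
    simp only [vec]
    push_cast
    ring
  rw [this, h.norm_vec]
  norm_num

theorem exists_selmer (h : IsFifthRoot s) {a b c : ℚ[X]} (hd : a.natDegree ≤ 2)
    (habc : 4 * X ^ 5 - 3 - b ^ 2 = a * c) (ha : aeval (theta s) a ≠ 0)
    (hN : IsSquare (Algebra.norm ℚ (aeval (theta s) a))) :
    ∃ i j k : Fin 2, IsSquare (aeval (theta s) a * ((h.nu : 𝓞 K) : K) ^ (i : ℕ) *
      (-((h.rho : 𝓞 K) : K)) ^ (j : ℕ) * ((s + 2) / 2) ^ (k : ℕ)) := by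
  have hP := h.isPrincipalIdealRing
  have ha0 : a ≠ 0 := by rintro rfl; simp at ha
  obtain ⟨A, k, hk, hA, hAd, hAk, D, B, C', hD, hDB⟩ := h.exists_int_factor ha0 hd habc
  set z := aeval (h.int 0 0 0 2 0) A with hz
  have hkK : (k : K) ≠ 0 := by exact_mod_cast hk
  have hz0 : z ≠ 0 := by
    intro h0
    rw [h0] at hAk
    exact (mul_ne_zero hkK ha) (by rw [← hAk]; rfl)
  obtain ⟨e₁, e₂, e₃, e₄, u, w, hw, hzu⟩ := h.exists_eq_of_evenAt hz0 (by
    intro q hq hq30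
    obtain ⟨p, hp, hqp⟩ := exists_prime_dvd_iff hq
    refine evenAt_aeval hq hp hqp ?_ ?_ hAd (map_ne_zero_of_isPrimitive hA hp) hz0 _ D B C' rfl hD
      hDB
    · rw [← hqp]; exact_mod_cast hq30
    · apply RingOfIntegers.coe_injective
      rw [map_pow, map_ofNat]
      change (h.int 0 0 0 2 0 : K) ^ 5 = 768
      rw [h.coe_int_theta]
      linear_combination 256 * h.theta_pow)
  have hzK := congrArg (algebraMap (𝓞 K) K) hzu
  obtain ⟨u₂, hu₂⟩ := h.exists_unit_two
  obtain ⟨u₃, hu₃⟩ := h.exists_unit_three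
  obtain ⟨u₅, hu₅⟩ := h.exists_unit_five
  replace hu₂ := congrArg (algebraMap (𝓞 K) K) hu₂
  replace hu₃ := congrArg (algebraMap (𝓞 K) K) hu₃
  replace hu₅ := congrArg (algebraMap (𝓞 K) K) hu₅
  simp only [map_mul, map_pow, map_ofNat] at hzK hu₂ hu₃ hu₅
  change (z : K) = _ at hzK
  rw [hAk] at hzK
  obtain ⟨m, hm⟩ := hN
  obtain ⟨ε, hε⟩ := norm_unit u
  have hNa : Algebra.norm ℚ (aeval (theta s) a) ≠ 0 := by rwa [Algebra.norm_ne_zero_iff]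
  have hm0 : m ≠ 0 := by
    rintro rfl
    rw [zero_mul] at hm
    exact hNa hm
  have hnorm := congrArg (Algebra.norm ℚ) hzK
  simp only [map_mul, map_pow] at hnorm
  have hNk : Algebra.norm ℚ (k : K) = k ^ 5 := by
    have := Algebra.norm_algebraMap (S := K) k
    rwa [h.finrank_eq] at this
  have hcoe : ∀ x : 𝓞 K, algebraMap (𝓞 K) K x = (x : K) := fun _ => rfl
  simp only [hcoe] at hnorm hzK hu₂ hu₃ hu₅
  rw [hNk, hm, h.norm_int_two, h.norm_int_three, h.norm_int_five, h.norm_int_five', hε] at hnorm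
  have hk2 : k = (ε : ℤ) * (2 ^ (e₁ : ℕ) * 3 ^ (e₂ : ℕ) * 5 ^ (e₃ : ℕ) * 5 ^ (e₄ : ℕ)) *
      (Algebra.norm ℚ (w : K) / (k ^ 2 * m)) ^ 2 := by
    field_simp
    push_cast at hnorm
    linear_combination hnorm
  set t : ℚ := Algebra.norm ℚ (w : K) / (k ^ 2 * m)
  have hprod := h.coe_mul_eq
  generalize (h.int 0 1 2 0 (-1) : K) = p₂ at *
  generalize (h.int 1 (-1) (-3) 1 2 : K) = p₃ at *
  generalize (h.int 1 0 (-1) 1 1 : K) = q₁ at *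
  generalize (h.int 1 2 3 0 (-2) : K) = q₂ at *
  have hp₂ : p₂ ≠ 0 := by
    rintro rfl
    rw [zero_pow (by norm_num), zero_mul] at hu₂
    exact two_ne_zero hu₂
  have hu₂0 : ((u₂ : 𝓞 K) : K) ≠ 0 := by
    intro h0
    rw [h0, mul_zero] at hu₂
    exact two_ne_zero hu₂
  have hinv : (((u₂⁻¹ : (𝓞 K)ˣ) : 𝓞 K) : K) = ((u₂ : 𝓞 K) : K)⁻¹ := by
    refine eq_inv_of_mul_eq_one_left ?_
    rw [← map_mul, Units.inv_mul, map_one]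
  have f₂ : 2 * p₂ = (u₂ : 𝓞 K) * (p₂ ^ 3) ^ 2 := by rw [hu₂]; ring
  have f₃ : 3 * p₃ = (u₃ : 𝓞 K) * (p₃ ^ 3) ^ 2 := by rw [hu₃]; ring
  have f₅ : 5 * q₁ = (u₅ : 𝓞 K) * (q₁ * q₂ ^ 2) ^ 2 := by rw [hu₅]; ring
  have f₅' : 5 * q₂ * ((s + 2) / 2) =
      ((u₅ : 𝓞 K) * ((u₂ : 𝓞 K) : K)⁻¹) * (q₁ * q₂ ^ 3 / p₂ ^ 2) ^ 2 := by
    have h2 : (s + 2) / 2 = q₁ * q₂ / (p₂ ^ 4 * (u₂ : 𝓞 K)) := by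
      rw [div_eq_div_iff two_ne_zero (mul_ne_zero (pow_ne_zero _ hp₂) hu₂0)]
      linear_combination -p₂ ^ 4 * (u₂ : 𝓞 K) * hprod - q₁ * q₂ * hu₂
    rw [h2, hu₅]
    field_simp
  have hsq : aeval (theta s) a * ((s + 2) / 2) ^ (e₄ : ℕ) = (ε : ℤ) * ((u₂ : 𝓞 K) : K) ^ (e₁ : ℕ) *
      ((u₃ : 𝓞 K) : K) ^ (e₂ : ℕ) * ((u₅ : 𝓞 K) : K) ^ (e₃ : ℕ) *
      ((u₅ : 𝓞 K) * ((u₂ : 𝓞 K) : K)⁻¹) ^ (e₄ : ℕ) * (u : 𝓞 K) *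
      ((p₂ ^ 3) ^ (e₁ : ℕ) * (p₃ ^ 3) ^ (e₂ : ℕ) * (q₁ * q₂ ^ 2) ^ (e₃ : ℕ) *
        (q₁ * q₂ ^ 3 / p₂ ^ 2) ^ (e₄ : ℕ) * (t * w / k)) ^ 2 := by
    calc _ = (k : K) * (k * aeval (theta s) a) * ((s + 2) / 2) ^ (e₄ : ℕ) / k ^ 2 := by
          field_simp
      _ = (ε : ℤ) * (2 * p₂) ^ (e₁ : ℕ) * (3 * p₃) ^ (e₂ : ℕ) * (5 * q₁) ^ (e₃ : ℕ) *
          (5 * q₂ * ((s + 2) / 2)) ^ (e₄ : ℕ) * (u : 𝓞 K) * (t * w / k) ^ 2 := by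
          have hk2' := congrArg (fun x : ℚ => (x : K)) hk2
          push_cast at hk2'
          rw [hzK, mul_pow _ ((s + 2) / 2)]
          generalize ((s + 2) / 2) ^ (e₄ : ℕ) = κ
          linear_combination (p₂ ^ (e₁ : ℕ) * p₃ ^ (e₂ : ℕ) * q₁ ^ (e₃ : ℕ) * q₂ ^ (e₄ : ℕ) *
            (u : 𝓞 K) * (w : K) ^ 2 * κ / k ^ 2) * hk2'
      _ = _ := by
          rw [f₂, f₃, f₅, f₅']
          simp only [mul_pow]
          ring
  obtain ⟨i, j, l, v, hv⟩ := h.exists_unit_eq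
    (Units.map (Int.castRingHom (𝓞 K) : ℤ →* 𝓞 K) ε * u₂ ^ (e₁ : ℕ) * u₃ ^ (e₂ : ℕ) * u₅ ^ (e₃ : ℕ) *
      (u₅ * u₂⁻¹) ^ (e₄ : ℕ) * u)
  replace hv := congrArg (fun x : (𝓞 K)ˣ => ((x : 𝓞 K) : K)) hv
  simp only [Units.val_mul, Units.val_pow_eq_pow_val, Units.coe_map, Units.val_neg, Units.val_one,
    map_mul, map_pow, map_neg, map_one, hinv] at hv
  replace hv : ((ε : ℤ) : K) * ((u₂ : 𝓞 K) : K) ^ (e₁ : ℕ) *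
      ((u₃ : 𝓞 K) : K) ^ (e₂ : ℕ) * ((u₅ : 𝓞 K) : K) ^ (e₃ : ℕ) *
      ((u₅ : 𝓞 K) * ((u₂ : 𝓞 K) : K)⁻¹) ^ (e₄ : ℕ) * (u : 𝓞 K) =
      (-1) ^ (i : ℕ) * (h.nu : 𝓞 K) ^ (j : ℕ) * (h.rho : 𝓞 K) ^ (l : ℕ) * (v : 𝓞 K) ^ 2 := by
    rw [← hv]
    simp
  rw [hv, mul_assoc _ (_ ^ 2), ← mul_pow] at hsq
  generalize ((v : 𝓞 K) : K) * _ = r at hsq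
  have hil : i = l := by
    have := congrArg (Algebra.norm ℚ) hsq
    simp only [map_mul, map_pow] at this
    rw [hm, h.norm_nu, h.norm_rho, h.norm_half, h.norm_neg_one, one_pow, mul_one] at this
    by_contra hne
    have h1 : ((-1 : ℚ)) ^ (i : ℕ) * (-1) ^ (l : ℕ) = -1 := by
      revert hne
      fin_cases i <;> fin_cases l <;> simp
    rw [h1] at this
    have h2 : 0 < m * m * (25 / 16) ^ (e₄ : ℕ) := mul_pos (mul_self_pos.2 hm0) (by positivity)
    nlinarith [sq_nonneg (Algebra.norm ℚ r)]
  subst hil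
  refine ⟨j, i, e₄, (h.nu : 𝓞 K) ^ (j : ℕ) * (h.rho : 𝓞 K) ^ (i : ℕ) * r, ?_⟩
  have h1 : ((-1 : K) ^ (i : ℕ)) ^ 2 = 1 := by rw [← pow_mul, mul_comm, pow_mul]; simp
  rw [neg_pow ((h.rho : 𝓞 K) : K)]
  generalize (-1 : K) ^ (i : ℕ) = ι at *
  generalize ((h.rho : 𝓞 K) : K) ^ (i : ℕ) = R at *
  generalize ((h.nu : 𝓞 K) : K) ^ (j : ℕ) = V at *
  linear_combination ι * R * V * hsq + V ^ 2 * R ^ 2 * r ^ 2 * h1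

end IsFifthRoot
end

section
variable {K : Type*} [Field K] [NumberField K] {s : K}

/-- Square classes modulo `8` of products of `nu`, `-rho` and `(s + 2) / 2`. -/
def selmerRed (i j k : Fin 2) : ℕ × ℕ × ℕ × ℕ × ℕ :=
  mulMod (mulMod (if i = 0 then (1, 0, 0, 0, 0) else (5, 5, 6, 7, 4))
    (if j = 0 then (1, 0, 0, 0, 0) else (5, 4, 2, 3, 4)))
    (if k = 0 then (1, 0, 0, 0, 0) else (1, 0, 0, 0, 1))

namespace IsFifthRoot

theorem hasRed_selmer (h : IsFifthRoot s) (i j k : Fin 2) : ∃ g : K, g ≠ 0 ∧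
    HasRed s ((((h.nu : 𝓞 K) : K) ^ (i : ℕ) * (-((h.rho : 𝓞 K) : K)) ^ (j : ℕ) *
      ((s + 2) / 2) ^ (k : ℕ)) * g ^ 2) (selmerRed i j k) := by
  have hs : s ≠ 0 := by
    rintro rfl
    simpa using h.pow_five
  have h1 : HasRed s 1 (1, 0, 0, 0, 0) := ⟨1, 0, 0, 0, 0, by simp [vec], by decide⟩
  refine ⟨15 ^ (i : ℕ) * 15 ^ (j : ℕ) * (s ^ 2) ^ (k : ℕ),
    mul_ne_zero (mul_ne_zero (pow_ne_zero _ (by norm_num)) (pow_ne_zero _ (by norm_num)))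
      (pow_ne_zero _ (pow_ne_zero _ hs)), ?_⟩
  have e : (((h.nu : 𝓞 K) : K) ^ (i : ℕ) * (-((h.rho : 𝓞 K) : K)) ^ (j : ℕ) *
      ((s + 2) / 2) ^ (k : ℕ)) * (15 ^ (i : ℕ) * 15 ^ (j : ℕ) * (s ^ 2) ^ (k : ℕ)) ^ 2 =
      (((h.nu : 𝓞 K) : K) * 15 ^ 2) ^ (i : ℕ) * (-(((h.rho : 𝓞 K) : K) * 15 ^ 2)) ^ (j : ℕ) *
      ((s + 2) / 2 * (s ^ 2) ^ 2) ^ (k : ℕ) := by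
    rw [mul_pow _ _ 2, mul_pow _ _ 2, ← pow_mul, ← pow_mul, ← pow_mul, mul_comm _ 2, mul_comm _ 2,
      mul_comm _ 2, pow_mul, pow_mul, pow_mul, ← neg_mul, mul_pow, mul_pow, mul_pow]
    ring
  rw [e]
  refine h.hasRed_mul (h.hasRed_mul ?_ ?_) ?_
  · fin_cases i
    · simpa using h1
    · exact ⟨_, _, _, _, _, by rw [← h.coe_nu]; exact pow_one _, by decide⟩
  · fin_cases j
    · simpa using h1
    · refine ⟨-315, -180, 90, -45, 60, ?_, by decide⟩
      rw [h.coe_rho]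
      simp only [vec]
      push_cast
      ring
  · fin_cases k
    · simpa using h1
    · refine ⟨9, 0, 0, 0, 1, ?_, by decide⟩
      simp only [vec]
      push_cast
      linear_combination (1 / 2 : K) * h.pow_five

theorem exists_isSquareMod (h : IsFifthRoot s) {a b c : ℚ[X]} (hd : a.natDegree ≤ 2)
    (habc : 4 * X ^ 5 - 3 - b ^ 2 = a * c) (ha : aeval (theta s) a ≠ 0)
    (hN : IsSquare (Algebra.norm ℚ (aeval (theta s) a))) {g : K} {r : ℕ × ℕ × ℕ × ℕ × ℕ}
    (hg : HasRed s (aeval (theta s) a * g ^ 2) r) :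
    ∃ i j k : Fin 2, isSquareMod (mulMod r (selmerRed i j k)) = true ∧
      (i = 0 → j = 0 → k = 0 → IsSquare (aeval (theta s) a)) := by
  obtain ⟨i, j, k, hs⟩ := h.exists_selmer hd habc ha hN
  obtain ⟨g', hg', hr'⟩ := h.hasRed_selmer i j k
  refine ⟨i, j, k, h.isSquareMod_of_isSquare (h.hasRed_mul hg hr') ?_, ?_⟩
  · have := hs.mul (IsSquare.sq (g * g'))
    generalize ((h.nu : 𝓞 K) : K) ^ (i : ℕ) = t₁ at *
    generalize (-((h.rho : 𝓞 K) : K)) ^ (j : ℕ) = t₂ at *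
    generalize ((s + 2) / 2) ^ (k : ℕ) = t₃ at *
    rwa [show aeval (theta s) a * g ^ 2 * (t₁ * t₂ * t₃ * g' ^ 2) =
      aeval (theta s) a * t₁ * t₂ * t₃ * (g * g') ^ 2 by ring]
  · rintro rfl rfl rfl
    simpa using hs

end IsFifthRoot
end

/-- The quadratic polynomial `x ^ 2 - σ x + ρ` and the line `y = β₁ x + β₀` cut out a divisor on
`y ^ 2 = 4 x ^ 5 - 3`. -/
structure IsMumford (σ ρ β₁ β₀ : ℚ) : Prop where
  lin : 2 * β₀ * β₁ + β₁ ^ 2 * σ = 4 * (σ ^ 4 - 3 * σ ^ 2 * ρ + ρ ^ 2)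
  const : β₀ ^ 2 - β₁ ^ 2 * ρ = -4 * ρ * (σ ^ 3 - 2 * σ * ρ) - 3

/-- The fourth coordinate on the Kummer surface. -/
def kappa (σ ρ β₁ : ℚ) : ℚ := (β₁ ^ 2 - 4 * σ ^ 3 + 4 * σ * ρ) / 4

section
variable {R : Type*} [CommRing R]

/-- The quartic form defining the Kummer surface. -/
def kummer (k₁ k₂ k₃ k₄ : R) : R :=
  3 * k₁ * k₂ ^ 3 - 3 * k₁ ^ 2 * k₂ * k₃ + 3 * k₁ ^ 3 * k₄ + k₃ ^ 4 - 2 * k₂ * k₃ ^ 2 * k₄ +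
    k₂ ^ 2 * k₄ ^ 2 - 4 * k₁ * k₃ * k₄ ^ 2

/-- The first coordinate of duplication on the Kummer surface. -/
def delta₁ (k₁ k₂ k₃ k₄ : R) : R :=
  8 * k₃ ^ 3 * k₄ - 4 * k₂ * k₃ * k₄ ^ 2 - 3 * k₂ ^ 4 + 4 * k₁ * k₄ ^ 3 + 12 * k₁ * k₂ ^ 2 * k₃ -
    12 * k₁ ^ 2 * k₃ ^ 2 + 24 * k₁ ^ 2 * k₂ * k₄

/-- The second coordinate of duplication on the Kummer surface. -/
def delta₂ (k₁ k₂ k₃ k₄ : R) : R :=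
  4 * k₃ ^ 2 * k₄ ^ 2 + 4 * k₂ * k₄ ^ 3 - 6 * k₂ ^ 3 * k₃ - 24 * k₁ * k₂ * k₃ ^ 2 -
    6 * k₁ * k₂ ^ 2 * k₄ + 12 * k₁ ^ 2 * k₃ * k₄ + 9 * k₁ ^ 4

/-- The third coordinate of duplication on the Kummer surface. -/
def delta₃ (k₁ k₂ k₃ k₄ : R) : R :=
  4 * k₃ * k₄ ^ 3 - 9 * k₂ ^ 2 * k₃ ^ 2 + 6 * k₂ ^ 3 * k₄ + 12 * k₁ * k₃ ^ 3 +
    18 * k₁ * k₂ * k₃ * k₄ + 9 * k₁ ^ 2 * k₄ ^ 2 - 18 * k₁ ^ 3 * k₂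

/-- The fourth coordinate of duplication on the Kummer surface. -/
def delta₄ (k₁ k₂ k₃ k₄ : R) : R :=
  k₄ ^ 4 + 6 * k₂ * k₃ ^ 3 + 12 * k₂ ^ 2 * k₃ * k₄ + 6 * k₁ * k₃ ^ 2 * k₄ - 6 * k₁ * k₂ * k₄ ^ 2 +
    9 * k₁ ^ 2 * k₂ ^ 2 + 18 * k₁ ^ 3 * k₃

end

namespace IsMumford
variable {σ ρ β₁ β₀ : ℚ}

theorem sq_lin (h : IsMumford σ ρ β₁ β₀) :
    (4 * (σ ^ 4 - 3 * σ ^ 2 * ρ + ρ ^ 2) - β₁ ^ 2 * σ) ^ 2 =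
      4 * β₁ ^ 2 * (β₁ ^ 2 * ρ + (-4 * ρ * (σ ^ 3 - 2 * σ * ρ) - 3)) := by
  rw [← h.lin, ← h.const]
  ring

theorem kummer_eq_zero (h : IsMumford σ ρ β₁ β₀) : kummer 1 σ ρ (kappa σ ρ β₁) = 0 := by
  simp only [kummer, kappa]
  linear_combination h.sq_lin / 16

theorem delta₁_eq (h : IsMumford σ ρ β₁ β₀) {N l₁ : ℚ}
    (h₁ : N * l₁ = -(β₁ * (4 * σ ^ 3 - 16 * σ * ρ - β₁ ^ 2) - β₀ * (12 * σ ^ 2 - 8 * ρ)) / 2) :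
    4 * delta₁ 1 σ ρ (kappa σ ρ β₁) = (N * l₁) ^ 2 := by
  rw [h₁]
  simp only [delta₁, kappa]
  linear_combination (-36 * σ ^ 4 + 48 * ρ * σ ^ 2 - 16 * ρ ^ 2) * h.const +
    (12 * σ ^ 5 - 3 * β₁ ^ 2 * σ ^ 2 - 56 * ρ * σ ^ 3 + 2 * β₁ ^ 2 * ρ + 32 * ρ ^ 2 * σ) * h.lin +
    (2 * σ) * h.sq_lin

theorem delta₂_eq (h : IsMumford σ ρ β₁ β₀) {N l₁ l₀ : ℚ}
    (hN : N = β₀ ^ 2 + β₀ * β₁ * σ + β₁ ^ 2 * ρ)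
    (h₁ : N * l₁ = -(β₁ * (4 * σ ^ 3 - 16 * σ * ρ - β₁ ^ 2) - β₀ * (12 * σ ^ 2 - 8 * ρ)) / 2)
    (h₀ : N * l₀ = (β₁ * ρ * (12 * σ ^ 2 - 8 * ρ) +
      (β₀ + β₁ * σ) * (4 * σ ^ 3 - 16 * σ * ρ - β₁ ^ 2)) / 2) :
    4 * delta₂ 1 σ ρ (kappa σ ρ β₁) = N ^ 2 * (4 - 2 * l₁ * l₀) := by
  rw [show N ^ 2 * (4 - 2 * l₁ * l₀) = 4 * N ^ 2 - 2 * (N * l₁) * (N * l₀) by ring, h₁, h₀, hN]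
  simp only [delta₂, kappa]
  linear_combination (24 * σ ^ 5 - 10 * β₁ ^ 2 * σ ^ 2 - 96 * ρ * σ ^ 3 - 8 * β₀ * β₁ * σ - 8 * β₁ ^ 2 * ρ + 32
      * ρ ^ 2 * σ - 4 * β₀ ^ 2 + 12) * h.const +
    (8 * σ ^ 6 - β₁ ^ 2 * σ ^ 3 + 28 * ρ * σ ^ 4 - 14 * β₁ ^ 2 * ρ * σ - 1 / 4 * β₁ ^ 4 - 112 *
      ρ ^ 2 * σ ^ 2 + 16 * ρ ^ 3 + 12 * σ) * h.lin +
    (σ ^ 2 + 4 * ρ) * h.sq_lin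

theorem delta₃_eq (h : IsMumford σ ρ β₁ β₀) {N l₁ l₀ : ℚ}
    (hN : N = β₀ ^ 2 + β₀ * β₁ * σ + β₁ ^ 2 * ρ)
    (h₁ : N * l₁ = -(β₁ * (4 * σ ^ 3 - 16 * σ * ρ - β₁ ^ 2) - β₀ * (12 * σ ^ 2 - 8 * ρ)) / 2)
    (h₀ : N * l₀ = (β₁ * ρ * (12 * σ ^ 2 - 8 * ρ) +
      (β₀ + β₁ * σ) * (4 * σ ^ 3 - 16 * σ * ρ - β₁ ^ 2)) / 2) :
    4 * delta₃ 1 σ ρ (kappa σ ρ β₁) = N ^ 2 * (l₀ ^ 2 + 2 * β₁ * l₁ - 8 * σ) := by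
  rw [show N ^ 2 * (l₀ ^ 2 + 2 * β₁ * l₁ - 8 * σ) =
    (N * l₀) ^ 2 + 2 * β₁ * (N * l₁) * N - 8 * σ * N ^ 2 by ring, h₁, h₀, hN]
  simp only [delta₃, kappa]
  linear_combination (-4 * σ ^ 6 + 2 * β₁ ^ 2 * σ ^ 3 + 4 * β₀ * β₁ * σ ^ 2 + 8 * β₁ ^ 2 * ρ * σ - 5 / 4 * β₁ ^
      4 + 8 * β₀ * β₁ * ρ + 8 * β₀ ^ 2 * σ - 24 * σ) * h.const +
    (-4 * σ ^ 7 + 4 * β₁ ^ 2 * σ ^ 4 + 12 * ρ * σ ^ 5 - 9 * β₁ ^ 2 * ρ * σ ^ 2 - 3 / 4 * β₁ ^ 4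
      * σ - 8 * ρ ^ 2 * σ ^ 3 + 6 * β₁ ^ 2 * ρ ^ 2 - 6 * σ ^ 2 - 12 * ρ) * h.lin +
    (-σ ^ 3 + 1 / 2 * β₁ ^ 2) * h.sq_lin

theorem delta₄_eq (h : IsMumford σ ρ β₁ β₀) {N l₁ l₀ : ℚ}
    (hN : N = β₀ ^ 2 + β₀ * β₁ * σ + β₁ ^ 2 * ρ)
    (h₁ : N * l₁ = -(β₁ * (4 * σ ^ 3 - 16 * σ * ρ - β₁ ^ 2) - β₀ * (12 * σ ^ 2 - 8 * ρ)) / 2)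
    (h₀ : N * l₀ = (β₁ * ρ * (12 * σ ^ 2 - 8 * ρ) +
      (β₀ + β₁ * σ) * (4 * σ ^ 3 - 16 * σ * ρ - β₁ ^ 2)) / 2) :
    16 * N ^ 2 * delta₄ 1 σ ρ (kappa σ ρ β₁) = N ^ 4 * (l₁ ^ 4 * ρ ^ 2 +
      2 * (β₀ + ρ * l₀) * l₁ * (l₁ * l₀ + σ * l₁ ^ 2 - 4) + (l₀ ^ 2 + 2 * β₁ * l₁ - 8 * σ) *
        (l₀ ^ 2 + 2 * σ * (l₁ * l₀ - 4) + σ ^ 2 * l₁ ^ 2)) := by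
  rw [show N ^ 4 * (l₁ ^ 4 * ρ ^ 2 +
      2 * (β₀ + ρ * l₀) * l₁ * (l₁ * l₀ + σ * l₁ ^ 2 - 4) + (l₀ ^ 2 + 2 * β₁ * l₁ - 8 * σ) *
        (l₀ ^ 2 + 2 * σ * (l₁ * l₀ - 4) + σ ^ 2 * l₁ ^ 2)) = (N * l₁) ^ 4 * ρ ^ 2 +
      2 * (β₀ * N + ρ * (N * l₀)) * (N * l₁) * (N * l₁ * (N * l₀) + σ * (N * l₁) ^ 2 - 4 * N ^ 2) +
      ((N * l₀) ^ 2 + 2 * β₁ * (N * l₁) * N - 8 * σ * N ^ 2) *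
        ((N * l₀) ^ 2 + 2 * σ * (N * l₁ * (N * l₀) - 4 * N ^ 2) + σ ^ 2 * (N * l₁) ^ 2) by ring,
    h₁, h₀, hN]
  simp only [delta₄, kappa]
  linear_combination (-240 * β₁ ^ 2 * σ ^ 14 + 960 * ρ * σ ^ 15 - 480 * β₀ * β₁ * σ ^ 13 - 1744 * β₁ ^ 2 * ρ * σ
      ^ 12 + 176 * β₁ ^ 4 * σ ^ 11 - 8832 * ρ ^ 2 * σ ^ 13 + 2432 * β₀ * β₁ * ρ * σ ^ 11 + 608 *
      β₀ * β₁ ^ 3 * σ ^ 10 - 240 * β₀ ^ 2 * σ ^ 12 + 17264 * β₁ ^ 2 * ρ ^ 2 * σ ^ 10 + 2180 * β₁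
      ^ 4 * ρ * σ ^ 9 - 43 * β₁ ^ 6 * σ ^ 8 + 31424 * ρ ^ 3 * σ ^ 11 - 2336 * β₀ * β₁ * ρ ^ 2 *
      σ ^ 9 - 976 * β₀ * β₁ ^ 3 * ρ * σ ^ 8 - 210 * β₀ * β₁ ^ 5 * σ ^ 7 + 656 * β₀ ^ 2 * β₁ ^ 2
      * σ ^ 9 + 1728 * β₀ ^ 2 * ρ * σ ^ 10 - 41616 * β₁ ^ 2 * ρ ^ 3 * σ ^ 8 - 10088 * β₁ ^ 4 * ρ
      ^ 2 * σ ^ 7 - 805 * β₁ ^ 6 * ρ * σ ^ 6 + 7 / 2 * β₁ ^ 8 * σ ^ 5 - 55936 * ρ ^ 4 * σ ^ 9 -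
      4096 * β₀ * β₁ * ρ ^ 3 * σ ^ 7 - 3696 * β₀ * β₁ ^ 3 * ρ ^ 2 * σ ^ 6 - 396 * β₀ * β₁ ^ 5 *
      ρ * σ ^ 5 + 22 * β₀ * β₁ ^ 7 * σ ^ 4 - 2808 * β₀ ^ 2 * β₁ ^ 2 * ρ * σ ^ 7 - 351 * β₀ ^ 2 *
      β₁ ^ 4 * σ ^ 6 - 4400 * β₀ ^ 2 * ρ ^ 2 * σ ^ 8 + 192 * β₀ ^ 3 * β₁ * σ ^ 8 + 40336 * β₁ ^
      2 * ρ ^ 4 * σ ^ 6 + 9720 * β₁ ^ 4 * ρ ^ 3 * σ ^ 5 + 1192 * β₁ ^ 6 * ρ ^ 2 * σ ^ 4 + 177 /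
      2 * β₁ ^ 8 * ρ * σ ^ 3 + 56256 * ρ ^ 5 * σ ^ 7 + 720 * σ ^ 12 + 7712 * β₀ * β₁ * ρ ^ 4 * σ
      ^ 5 + 6368 * β₀ * β₁ ^ 3 * ρ ^ 3 * σ ^ 4 + 1492 * β₀ * β₁ ^ 5 * ρ ^ 2 * σ ^ 3 + 117 * β₀ *
      β₁ ^ 7 * ρ * σ ^ 2 + 2720 * β₀ ^ 2 * β₁ ^ 2 * ρ ^ 2 * σ ^ 5 + 450 * β₀ ^ 2 * β₁ ^ 4 * ρ *
      σ ^ 4 + 99 / 2 * β₀ ^ 2 * β₁ ^ 6 * σ ^ 3 + 5184 * β₀ ^ 2 * ρ ^ 3 * σ ^ 6 - 1104 * β₀ ^ 3 *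
      β₁ * ρ * σ ^ 6 - 244 * β₀ ^ 3 * β₁ ^ 3 * σ ^ 5 - 32 * β₀ ^ 4 * σ ^ 7 - 20176 * β₁ ^ 2 * ρ
      ^ 5 * σ ^ 4 - 2064 * β₁ ^ 2 * σ ^ 9 - 1472 * β₁ ^ 4 * ρ ^ 4 * σ ^ 3 + 702 * β₁ ^ 6 * ρ ^ 3
      * σ ^ 2 + 86 * β₁ ^ 8 * ρ ^ 2 * σ - 5184 * ρ * σ ^ 10 - 35712 * ρ ^ 6 * σ ^ 5 - 5632 * β₀
      * β₁ * ρ ^ 5 * σ ^ 3 - 768 * β₀ * β₁ * σ ^ 8 - 3264 * β₀ * β₁ ^ 3 * ρ ^ 4 * σ ^ 2 - 400 *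
      β₀ * β₁ ^ 5 * ρ ^ 3 * σ + 16 * β₀ * β₁ ^ 7 * ρ ^ 2 - 1296 * β₀ ^ 2 * β₁ ^ 2 * ρ ^ 3 * σ ^
      3 + 234 * β₀ ^ 2 * β₁ ^ 4 * ρ ^ 2 * σ ^ 2 + 66 * β₀ ^ 2 * β₁ ^ 6 * ρ * σ - 3696 * β₀ ^ 2 *
      ρ ^ 4 * σ ^ 4 + 1024 * β₀ ^ 3 * β₁ * ρ ^ 2 * σ ^ 4 + 424 * β₀ ^ 3 * β₁ ^ 3 * ρ * σ ^ 3 +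
      51 * β₀ ^ 3 * β₁ ^ 5 * σ ^ 2 - 76 * β₀ ^ 4 * β₁ ^ 2 * σ ^ 4 + 7128 * β₁ ^ 2 * ρ * σ ^ 7 +
      4864 * β₁ ^ 2 * ρ ^ 6 * σ ^ 2 - 512 * β₁ ^ 4 * ρ ^ 5 * σ + 1101 * β₁ ^ 4 * σ ^ 6 - 248 *
      β₁ ^ 6 * ρ ^ 4 + 13968 * ρ ^ 2 * σ ^ 8 + 13312 * ρ ^ 7 * σ ^ 3 + 2928 * β₀ * β₁ * ρ * σ ^
      6 + 1536 * β₀ * β₁ * ρ ^ 6 * σ + 768 * β₀ * β₁ ^ 3 * ρ ^ 5 + 828 * β₀ * β₁ ^ 3 * σ ^ 5 +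
      832 * β₀ ^ 2 * β₁ ^ 2 * ρ ^ 4 * σ - 168 * β₀ ^ 2 * β₁ ^ 4 * ρ ^ 3 + 1536 * β₀ ^ 2 * ρ ^ 5
      * σ ^ 2 - 192 * β₀ ^ 3 * β₁ * ρ ^ 3 * σ ^ 2 - 256 * β₀ ^ 3 * β₁ ^ 3 * ρ ^ 2 * σ + 12 * β₀
      ^ 3 * β₁ ^ 5 * ρ - 8 * β₀ ^ 4 * β₁ ^ 2 * ρ * σ ^ 2 + 24 * β₀ ^ 4 * β₁ ^ 4 * σ - 192 * β₀ ^
      4 * ρ ^ 2 * σ ^ 3 - 32 * β₀ ^ 5 * β₁ * σ ^ 3 - 6432 * β₁ ^ 2 * ρ ^ 2 * σ ^ 5 - 768 * β₁ ^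
      2 * ρ ^ 7 - 666 * β₁ ^ 4 * ρ * σ ^ 4 - 309 / 2 * β₁ ^ 6 * σ ^ 3 - 19392 * ρ ^ 3 * σ ^ 6 -
      2048 * ρ ^ 8 * σ - 3456 * β₀ * β₁ * ρ ^ 2 * σ ^ 4 - 1128 * β₀ * β₁ ^ 3 * ρ * σ ^ 3 - 165 *
      β₀ * β₁ ^ 5 * σ ^ 2 + 276 * β₀ ^ 2 * β₁ ^ 2 * σ ^ 4 - 192 * β₀ ^ 2 * ρ * σ ^ 5 - 256 * β₀
      ^ 2 * ρ ^ 6 + 256 * β₀ ^ 3 * β₁ * ρ ^ 4 - 96 * β₀ ^ 4 * β₁ ^ 2 * ρ ^ 2 + 384 * β₀ ^ 4 * ρ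
      ^ 3 * σ - 96 * β₀ ^ 5 * β₁ * ρ * σ + 4 * β₀ ^ 5 * β₁ ^ 3 - 16 * β₀ ^ 6 * σ ^ 2 + 3600 * β₁
      ^ 2 * ρ ^ 3 * σ ^ 3 - 1230 * β₁ ^ 4 * ρ ^ 2 * σ ^ 2 - 288 * β₁ ^ 6 * ρ * σ + 16464 * ρ ^ 4
      * σ ^ 4 + 3264 * β₀ * β₁ * ρ ^ 3 * σ ^ 2 + 1008 * β₀ * β₁ ^ 3 * ρ ^ 2 * σ - 48 * β₀ * β₁ ^
      5 * ρ + 72 * β₀ ^ 2 * β₁ ^ 2 * ρ * σ ^ 2 - 78 * β₀ ^ 2 * β₁ ^ 4 * σ + 576 * β₀ ^ 2 * ρ ^ 2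
      * σ ^ 3 + 96 * β₀ ^ 3 * β₁ * σ ^ 3 - 32 * β₀ ^ 6 * ρ + 960 * β₁ ^ 2 * ρ ^ 4 * σ + 960 * β₁
      ^ 4 * ρ ^ 3 - 6144 * ρ ^ 5 * σ ^ 2 - 768 * β₀ * β₁ * ρ ^ 4 + 408 * β₀ ^ 2 * β₁ ^ 2 * ρ ^ 2
      - 192 * β₀ ^ 2 * ρ ^ 3 * σ + 288 * β₀ ^ 3 * β₁ * ρ * σ - 12 * β₀ ^ 3 * β₁ ^ 3 + 48 * β₀ ^
      4 * σ ^ 2 - 684 * β₁ ^ 2 * σ ^ 4 + 576 * ρ * σ ^ 5 + 768 * ρ ^ 6 + 96 * β₀ ^ 4 * ρ + 360 *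
      β₁ ^ 2 * ρ * σ ^ 2 + 234 * β₁ ^ 4 * σ - 1728 * ρ ^ 2 * σ ^ 3 - 288 * β₀ * β₁ * ρ * σ + 36
      * β₀ * β₁ ^ 3 - 648 * β₁ ^ 2 * ρ ^ 2 + 576 * ρ ^ 3 * σ) * h.const +
    (960 * ρ * σ ^ 16 - 1696 * β₁ ^ 2 * ρ * σ ^ 13 - 6784 * ρ ^ 2 * σ ^ 14 + 7200 * β₁ ^ 2 * ρ
      ^ 2 * σ ^ 11 + 900 * β₁ ^ 4 * ρ * σ ^ 10 + 14400 * ρ ^ 3 * σ ^ 12 - 1824 * β₁ ^ 2 * ρ ^ 3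
      * σ ^ 9 - 1152 * β₁ ^ 4 * ρ ^ 2 * σ ^ 8 - 192 * β₁ ^ 6 * ρ * σ ^ 7 - 1152 * ρ ^ 4 * σ ^ 10
      - 25152 * β₁ ^ 2 * ρ ^ 4 * σ ^ 7 - 5912 * β₁ ^ 4 * ρ ^ 3 * σ ^ 6 - 328 * β₁ ^ 6 * ρ ^ 2 *
      σ ^ 5 + 29 / 2 * β₁ ^ 8 * ρ * σ ^ 4 - 31808 * ρ ^ 5 * σ ^ 8 + 720 * σ ^ 13 + 35232 * β₁ ^
      2 * ρ ^ 5 * σ ^ 5 - 912 * β₁ ^ 2 * σ ^ 10 + 10320 * β₁ ^ 4 * ρ ^ 4 * σ ^ 4 + 1300 * β₁ ^ 6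
      * ρ ^ 3 * σ ^ 3 + 68 * β₁ ^ 8 * ρ ^ 2 * σ ^ 2 - 2112 * ρ * σ ^ 11 + 42112 * ρ ^ 6 * σ ^ 6
      - 672 * β₁ ^ 2 * ρ * σ ^ 8 - 18944 * β₁ ^ 2 * ρ ^ 6 * σ ^ 3 - 4160 * β₁ ^ 4 * ρ ^ 5 * σ ^
      2 + 315 * β₁ ^ 4 * σ ^ 7 - 208 * β₁ ^ 6 * ρ ^ 4 * σ + 8 * β₁ ^ 8 * ρ ^ 3 - 5424 * ρ ^ 2 *
      σ ^ 9 - 25600 * ρ ^ 7 * σ ^ 4 + 12576 * β₁ ^ 2 * ρ ^ 2 * σ ^ 6 + 3584 * β₁ ^ 2 * ρ ^ 7 * σ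
      + 1386 * β₁ ^ 4 * ρ * σ ^ 5 + 512 * β₁ ^ 4 * ρ ^ 6 - 33 * β₁ ^ 6 * σ ^ 4 + 24768 * ρ ^ 3 *
      σ ^ 7 + 6144 * ρ ^ 8 * σ ^ 2 - 17808 * β₁ ^ 2 * ρ ^ 3 * σ ^ 4 - 3366 * β₁ ^ 4 * ρ ^ 2 * σ
      ^ 3 - 264 * β₁ ^ 6 * ρ * σ ^ 2 - 31920 * ρ ^ 4 * σ ^ 5 + 10752 * β₁ ^ 2 * ρ ^ 4 * σ ^ 2 +
      936 * β₁ ^ 4 * ρ ^ 3 * σ - 48 * β₁ ^ 6 * ρ ^ 2 + 23040 * ρ ^ 5 * σ ^ 3 + 1152 * σ ^ 8 -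
      1536 * β₁ ^ 2 * ρ ^ 5 - 1242 * β₁ ^ 2 * σ ^ 5 - 4392 * ρ * σ ^ 6 - 5376 * ρ ^ 6 * σ + 1764
      * β₁ ^ 2 * ρ * σ ^ 3 + 495 / 2 * β₁ ^ 4 * σ ^ 2 + 5760 * ρ ^ 2 * σ ^ 4 - 1224 * β₁ ^ 2 * ρ
      ^ 2 * σ + 90 * β₁ ^ 4 * ρ - 6048 * ρ ^ 3 * σ ^ 2 + 1152 * ρ ^ 4 - 54 * β₁ ^ 2 + 432 * ρ *
      σ) * h.lin +
    (240 * ρ * σ ^ 12 - 304 * β₁ ^ 2 * ρ * σ ^ 9 - 1216 * ρ ^ 2 * σ ^ 10 + 840 * β₁ ^ 2 * ρ ^ 2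
      * σ ^ 7 + 105 * β₁ ^ 4 * ρ * σ ^ 6 + 1680 * ρ ^ 3 * σ ^ 8 - 56 * β₁ ^ 2 * ρ ^ 3 * σ ^ 5 -
      48 * β₁ ^ 4 * ρ ^ 2 * σ ^ 4 - 11 * β₁ ^ 6 * ρ * σ ^ 3 - 160 * ρ ^ 4 * σ ^ 6 - 768 * β₁ ^ 2
      * ρ ^ 4 * σ ^ 3 - 224 * β₁ ^ 4 * ρ ^ 3 * σ ^ 2 - 20 * β₁ ^ 6 * ρ ^ 2 * σ - 768 * ρ ^ 5 * σ
      ^ 4 + 180 * σ ^ 9 + 384 * β₁ ^ 2 * ρ ^ 5 * σ - 138 * β₁ ^ 2 * σ ^ 6 + 64 * β₁ ^ 4 * ρ ^ 4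
      - 348 * ρ * σ ^ 7 + 512 * ρ ^ 6 * σ ^ 2 - 96 * β₁ ^ 2 * ρ * σ ^ 4 + 45 / 2 * β₁ ^ 4 * σ ^
      3 - 348 * ρ ^ 2 * σ ^ 5 + 384 * β₁ ^ 2 * ρ ^ 2 * σ ^ 2 + 66 * β₁ ^ 4 * ρ * σ + 576 * ρ ^ 3
      * σ ^ 3 - 192 * β₁ ^ 2 * ρ ^ 3 - 576 * ρ ^ 4 * σ + 153 * σ ^ 4 - 54 * β₁ ^ 2 * σ - 72 * ρ
      * σ ^ 2 + 144 * ρ ^ 2) * h.sq_lin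

end IsMumford

noncomputable section

/-- The monic quadratic polynomial with given sum and product of roots. -/
def quad (σ ρ : ℚ) : ℚ[X] := X ^ 2 - C σ * X + C ρ

theorem natDegree_quad (σ ρ : ℚ) : (quad σ ρ).natDegree = 2 := by
  unfold quad
  compute_degree!

theorem IsMumford.sub_sq_eq {σ ρ β₁ β₀ : ℚ} (h : IsMumford σ ρ β₁ β₀) :
    4 * X ^ 5 - 3 - (C β₁ * X + C β₀) ^ 2 = quad σ ρ *
      (4 * X ^ 3 + 4 * C σ * X ^ 2 + C (4 * σ ^ 2 - 4 * ρ) * X +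
        C (4 * σ ^ 3 - 8 * σ * ρ - β₁ ^ 2)) := by
  have e₁ := congrArg (C : ℚ → ℚ[X]) h.lin
  have e₀ := congrArg (C : ℚ → ℚ[X]) h.const
  simp only [quad, map_sub, map_mul, map_add, map_pow, map_ofNat, map_neg] at *
  linear_combination -X * e₁ - e₀

section
variable {K : Type*} [Field K] [NumberField K] {s : K}

theorem IsMumford.sq_res_eq {σ ρ β₁ β₀ : ℚ} (h : IsMumford σ ρ β₁ β₀) :
    (β₀ ^ 2 + β₀ * β₁ * σ + β₁ ^ 2 * ρ) ^ 2 = (-4 * ρ * (σ ^ 3 - 2 * σ * ρ) - 3) ^ 2 +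
      (-4 * ρ * (σ ^ 3 - 2 * σ * ρ) - 3) * (4 * (σ ^ 4 - 3 * σ ^ 2 * ρ + ρ ^ 2)) * σ +
      (4 * (σ ^ 4 - 3 * σ ^ 2 * ρ + ρ ^ 2)) ^ 2 * ρ := by
  rw [← h.lin, ← h.const]
  ring

namespace IsFifthRoot

theorem aeval_quad (h : IsFifthRoot s) (σ ρ : ℚ) :
    aeval (theta s) (quad σ ρ) = vec s ρ (1 / 2) 0 (-σ / 6) 0 := by
  simp only [quad, theta, vec, map_add, map_sub, map_mul, map_pow, aeval_X, aeval_C,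
    eq_ratCast]
  push_cast
  linear_combination (s / 36) * h.pow_five

theorem aeval_quad_ne_zero (h : IsFifthRoot s) (σ ρ : ℚ) : aeval (theta s) (quad σ ρ) ≠ 0 := by
  rw [h.aeval_quad]
  intro h0
  have : vec s ρ (1 / 2) 0 (-σ / 6) 0 = vec s 0 0 0 0 0 := by rw [h0]; simp [vec]
  have := (h.vec_inj this).2.1
  norm_num at this

theorem norm_quad (h : IsFifthRoot s) {σ ρ β₁ β₀ : ℚ} (hm : IsMumford σ ρ β₁ β₀) :
    Algebra.norm ℚ (aeval (theta s) (quad σ ρ)) =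
      ((β₀ ^ 2 + β₀ * β₁ * σ + β₁ ^ 2 * ρ) / 4) ^ 2 := by
  rw [h.aeval_quad, h.norm_vec]
  linear_combination -hm.sq_res_eq / 16

theorem res_ne_zero (h : IsFifthRoot s) {σ ρ β₁ β₀ : ℚ} (hm : IsMumford σ ρ β₁ β₀) :
    β₀ ^ 2 + β₀ * β₁ * σ + β₁ ^ 2 * ρ ≠ 0 := by
  intro h0
  have := h.norm_quad hm
  rw [h0, zero_div, zero_pow two_ne_zero, Algebra.norm_eq_zero_iff] at this
  exact h.aeval_quad_ne_zero σ ρ this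

theorem exists_isSquareMod_quad (h : IsFifthRoot s) {σ ρ β₁ β₀ : ℚ} (hm : IsMumford σ ρ β₁ β₀)
    {g : K} {r : ℕ × ℕ × ℕ × ℕ × ℕ} (hg : HasRed s (aeval (theta s) (quad σ ρ) * g ^ 2) r) :
    ∃ i j k : Fin 2, isSquareMod (mulMod r (selmerRed i j k)) = true ∧
      (i = 0 → j = 0 → k = 0 → IsSquare (aeval (theta s) (quad σ ρ))) :=
  h.exists_isSquareMod (natDegree_quad σ ρ).le hm.sub_sq_eq (h.aeval_quad_ne_zero σ ρ)
    (by rw [h.norm_quad hm]; exact IsSquare.sq _) hg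

theorem dvd_of_aeval_eq_zero (h : IsFifthRoot s) {p : ℚ[X]} (hp : aeval (theta s) p = 0) :
    (4 * X ^ 5 - 3 : ℚ[X]) ∣ p := by
  have hmon : (X ^ 5 - C (3 / 4 : ℚ)).Monic := by monicity!
  have hf : (4 * X ^ 5 - 3 : ℚ[X]) = C 4 * (X ^ 5 - C (3 / 4)) := by
    rw [mul_sub, ← C_mul]
    norm_num
    rfl
  have hθ := h.theta_pow
  have hdiv := EuclideanDomain.div_add_mod p (X ^ 5 - C (3 / 4 : ℚ))
  have hr0 : p %ₘ (X ^ 5 - C (3 / 4 : ℚ)) = 0 := by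
    have hdeg := degree_modByMonic_lt p hmon
    have hdeg5 : degree (X ^ 5 - C (3 / 4 : ℚ)) = 5 := by compute_degree!
    rw [hdeg5] at hdeg
    have hsum := modByMonic_add_div p (X ^ 5 - C (3 / 4 : ℚ))
    generalize p %ₘ (X ^ 5 - C (3 / 4 : ℚ)) = r at hdeg hsum
    have hr : aeval (theta s) r = 0 := by
      have := congrArg (aeval (theta s)) hsum
      rw [map_add, map_mul, hp] at this
      have h0 : aeval (theta s) (X ^ 5 - C (3 / 4 : ℚ)) = 0 := by
        simp only [map_sub, map_pow, aeval_X, aeval_C, eq_ratCast]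
        push_cast
        linear_combination hθ / 4
      rwa [h0, zero_mul, add_zero] at this
    have hr5 : r.natDegree < 5 := by
      by_cases hr0 : r = 0
      · simp [hr0]
      · exact (natDegree_lt_iff_degree_lt hr0).2 hdeg
    rw [as_sum_range' r 5 hr5] at hr
    have hv : vec s (r.coeff 0) (r.coeff 2 / 2) (r.coeff 4 / 4) (r.coeff 1 / 6) (r.coeff 3 / 12) =
        vec s 0 0 0 0 0 := by
      simp only [Finset.sum_range_succ, Finset.sum_range_zero, map_add, aeval_monomial, theta,
        eq_ratCast, map_zero] at hr
      simp only [vec]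
      push_cast
      linear_combination hr - (r.coeff 2 * s / 36 + r.coeff 3 * (s ^ 4 / 216) +
        r.coeff 4 * (s ^ 5 + 18) * s ^ 2 / 1296) * h.pow_five
    obtain ⟨h0, h2, h4, h1, h3⟩ := h.vec_inj hv
    ext n
    rcases lt_or_ge n 5 with hn | hn
    · interval_cases n <;> simp <;> linarith
    · rw [coeff_eq_zero_of_degree_lt (hdeg.trans_le (by exact_mod_cast hn)), coeff_zero]
  rw [hf]
  exact (isUnit_C.2 (by norm_num : IsUnit (4 : ℚ))).mul_left_dvd.2
    ((modByMonic_eq_zero_iff_dvd hmon).1 hr0)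

theorem irreducible_poly (h : IsFifthRoot s) : Irreducible (4 * X ^ 5 - 3 : ℚ[X]) := by
  have hθ : aeval (theta s) (4 * X ^ 5 - 3 : ℚ[X]) = 0 := by
    simp only [map_sub, map_mul, map_pow, aeval_X, map_ofNat]
    linear_combination h.theta_pow
  have hdeg : (4 * X ^ 5 - 3 : ℚ[X]).natDegree = 5 := by compute_degree!
  refine Prime.irreducible ⟨?_, ?_, ?_⟩
  · intro h0
    simp [h0] at hdeg
  · intro h0
    rw [natDegree_eq_zero_of_isUnit h0] at hdeg
    norm_num at hdeg
  · rintro p q ⟨r, hr⟩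
    have := congrArg (aeval (theta s)) hr
    rw [map_mul, map_mul, hθ, zero_mul, mul_eq_zero] at this
    exact this.imp h.dvd_of_aeval_eq_zero h.dvd_of_aeval_eq_zero

end IsFifthRoot
end
end

noncomputable section
variable {K : Type*} [Field K] [NumberField K] {s : K}

namespace IsFifthRoot

theorem exists_aeval_eq (h : IsFifthRoot s) (c : K) {a : ℚ[X]} (ha : a ≠ 0) (b : ℚ[X]) {m : ℕ}
    (hm : 2 + a.natDegree ≤ m) :
    ∃ (u v : ℚ[X]) (r : ℚ), (u ≠ 0 ∨ v ≠ 0 ∨ r ≠ 0) ∧ u.degree < 3 ∧ v.degree < m ∧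
      c * aeval (theta s) u = aeval (theta s) v ∧ a ∣ v - C r * b := by
  have : FiniteDimensional ℚ (AdjoinRoot a) := (AdjoinRoot.powerBasis ha).finite
  let L : (degreeLT ℚ 3 × degreeLT ℚ m × ℚ) →ₗ[ℚ] K × AdjoinRoot a :=
    LinearMap.prod
      ((LinearMap.mulLeft ℚ c ∘ₗ (aeval (theta s)).toLinearMap ∘ₗ (degreeLT ℚ 3).subtype ∘ₗ
        LinearMap.fst _ _ _) - (aeval (theta s)).toLinearMap ∘ₗ (degreeLT ℚ m).subtype ∘ₗ
          LinearMap.fst _ _ _ ∘ₗ LinearMap.snd _ _ _)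
      ((AdjoinRoot.mkₐ a).toLinearMap ∘ₗ ((degreeLT ℚ m).subtype ∘ₗ
          LinearMap.fst _ _ _ ∘ₗ LinearMap.snd _ _ _ -
        (LinearMap.toSpanSingleton ℚ ℚ[X] b) ∘ₗ LinearMap.snd _ _ _ ∘ₗ LinearMap.snd _ _ _))
  have hker : LinearMap.ker L ≠ ⊥ := by
    apply LinearMap.ker_ne_bot_of_finrank_lt
    have hA : finrank ℚ (AdjoinRoot a) = a.natDegree := by
      rw [(AdjoinRoot.powerBasis ha).finrank, AdjoinRoot.powerBasis_dim]
    simp only [finrank_prod, hA, h.finrank_eq, finrank_self, finrank_eq_card_basis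
      (degreeLT.basis ℚ _), Fintype.card_fin]
    omega
  obtain ⟨⟨u, v, r⟩, hmem, hne⟩ := (Submodule.ne_bot_iff _).1 hker
  rw [LinearMap.mem_ker] at hmem
  have h1 := congrArg Prod.fst hmem
  have h2 := congrArg Prod.snd hmem
  refine ⟨u, v, r, ?_, mem_degreeLT.1 u.2, mem_degreeLT.1 v.2, ?_, ?_⟩
  · by_contra! hc
    apply hne
    obtain ⟨hu, hv, hr⟩ := hc
    ext1
    · exact Subtype.ext hu
    · ext1
      · exact Subtype.ext hv
      · exact hr
  · simpa [L, sub_eq_zero] using h1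
  · rw [← AdjoinRoot.mk_eq_zero, ← smul_eq_C_mul]
    simpa [L] using h2

/-- If `a` takes a square value at `theta` then `4 X ^ 5 - 3` is of the form `v ^ 2 - a u ^ 2`. -/
theorem exists_sq_sub_mul_sq (h : IsFifthRoot s) {a b w : ℚ[X]} (hd : a.natDegree ≤ 2)
    (hd0 : 0 < a.natDegree) (habw : 4 * X ^ 5 - 3 - b ^ 2 = a * w)
    (hsq : IsSquare (aeval (theta s) a)) (hns : ∀ u v : ℚ[X], v ^ 2 = a * u ^ 2 → u = 0) :
    ∃ u v : ℚ[X], u.degree < 3 ∧ v.degree < (2 + a.natDegree : ℕ) ∧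
      v ^ 2 - a * u ^ 2 = 4 * X ^ 5 - 3 ∧ a ∣ v - b := by
  obtain ⟨c, hc⟩ := hsq
  have ha : a ≠ 0 := by
    rintro rfl
    simp at hd0
  obtain ⟨u, v, r, hne, hu, hv, hcuv, t, ht⟩ := h.exists_aeval_eq c ha b (m := 2 + a.natDegree)
    le_rfl
  have hf := h.irreducible_poly
  have hfdeg : (4 * X ^ 5 - 3 : ℚ[X]).natDegree = 5 := by compute_degree!
  obtain ⟨q, hq⟩ : (4 * X ^ 5 - 3 : ℚ[X]) ∣ v ^ 2 - a * u ^ 2 := by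
    apply h.dvd_of_aeval_eq_zero
    rw [map_sub, map_mul, map_pow, map_pow, ← hcuv, hc]
    ring
  have hu' : u.natDegree ≤ 2 := by
    by_cases hu0 : u = 0
    · simp [hu0]
    · exact Nat.lt_succ_iff.1 ((natDegree_lt_iff_degree_lt hu0).2 hu)
  have hv' : v.natDegree ≤ 1 + a.natDegree := by
    by_cases hv0 : v = 0
    · simp [hv0]
    · exact Nat.lt_succ_iff.1 ((natDegree_lt_iff_degree_lt hv0).2 (by rwa [Nat.succ_eq_add_one,
        show 1 + a.natDegree + 1 = 2 + a.natDegree by omega]))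
  have hqdeg : (q - C (r ^ 2)).natDegree < a.natDegree := by
    have h1 : (q).natDegree < a.natDegree := by
      by_cases hq0 : q = 0
      · simpa [hq0]
      have h2 := congrArg natDegree hq
      rw [natDegree_mul hf.ne_zero hq0, hfdeg] at h2
      have h3 : (v ^ 2 - a * u ^ 2).natDegree ≤ 4 + a.natDegree := by
        have h4 : (v ^ 2).natDegree ≤ 2 * v.natDegree := natDegree_pow_le
        have h5 : (u ^ 2).natDegree ≤ 2 * u.natDegree := natDegree_pow_le
        have h6 : (a * u ^ 2).natDegree ≤ a.natDegree + (u ^ 2).natDegree := natDegree_mul_le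
        exact (natDegree_sub_le _ _).trans (max_le (by omega) (by omega))
      omega
    exact (natDegree_sub_C (p := q) (a := r ^ 2)).trans_lt h1
  have hdvd : a ∣ (4 * X ^ 5 - 3) * (q - C (r ^ 2)) := by
    refine ⟨t * (v + C r * b) - u ^ 2 - C r ^ 2 * w, ?_⟩
    rw [C_pow]
    linear_combination -hq + (v + C r * b) * ht - C r ^ 2 * habw
  have hcop : IsCoprime a (4 * X ^ 5 - 3) := by
    refine ((hf.coprime_iff_not_dvd).2 fun hdv => ?_).symm
    have := natDegree_le_of_dvd hdv ha
    omega
  have hqr : q = C (r ^ 2) := by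
    rw [← sub_eq_zero]
    exact eq_zero_of_dvd_of_natDegree_lt (hcop.dvd_of_dvd_mul_left hdvd) hqdeg
  have hr : r ≠ 0 := by
    rintro rfl
    rw [hqr, zero_pow two_ne_zero, C_0, mul_zero, sub_eq_zero] at hq
    have hu0 := hns u v hq
    rw [hu0, zero_pow two_ne_zero, mul_zero] at hq
    simp [hu0, pow_eq_zero_iff (two_ne_zero) |>.1 hq] at hne
  have hrr : C r⁻¹ * C r = (1 : ℚ[X]) := by rw [← C_mul, inv_mul_cancel₀ hr, C_1]
  refine ⟨C r⁻¹ * u, C r⁻¹ * v, ?_, ?_, ?_, C r⁻¹ * t, ?_⟩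
  · rwa [degree_C_mul (inv_ne_zero hr)]
  · rwa [degree_C_mul (inv_ne_zero hr)]
  · rw [hqr, C_pow] at hq
    linear_combination C r⁻¹ ^ 2 * hq + (4 * X ^ 5 - 3) * (C r⁻¹ * C r + 1) * hrr
  · linear_combination C r⁻¹ * ht + b * hrr

end IsFifthRoot

theorem quad_ne_sq {σ ρ : ℚ} (hd : σ ^ 2 ≠ 4 * ρ) (u v : ℚ[X]) (huv : v ^ 2 = quad σ ρ * u ^ 2) :
    u = 0 := by
  by_contra hu
  obtain ⟨t, rfl⟩ : u ∣ v := by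
    rw [← UniqueFactorizationMonoid.pow_dvd_pow_iff_dvd two_ne_zero]
    exact ⟨quad σ ρ, by rw [huv, mul_comm]⟩
  have ht : t ^ 2 = quad σ ρ := by
    rw [mul_pow, mul_comm] at huv
    exact mul_right_cancel₀ (pow_ne_zero 2 hu) huv
  have htd : t.natDegree ≤ 1 := by
    have := congrArg natDegree ht
    rw [natDegree_pow, natDegree_quad] at this
    omega
  obtain ⟨α, β, rfl⟩ := exists_eq_X_add_C_of_natDegree_le_one htd
  apply hd
  have e₀ := congrArg (eval 0) ht
  have e₁ := congrArg (eval 1) ht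
  have e₂ := congrArg (eval (-1)) ht
  simp [quad] at e₀ e₁ e₂
  have f₁ : σ = -2 * α * β := by linarith
  have f₂ : α ^ 2 = 1 := by linarith
  rw [f₁, ← e₀]
  linear_combination 4 * β ^ 2 * f₂

theorem sub_ne_sq (x : ℚ) (u v : ℚ[X]) (huv : v ^ 2 = (C x - X) * u ^ 2) : u = 0 := by
  by_contra hu
  have hx : (C x - X : ℚ[X]).natDegree = 1 := by compute_degree!
  have := congrArg natDegree huv
  rw [natDegree_mul (by rintro h0; simp [h0] at hx) (pow_ne_zero 2 hu), hx, natDegree_pow,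
    natDegree_pow] at this
  omega
end

noncomputable section

theorem coeff_eq_zero_of_forall {c₆ c₅ c₄ c₃ c₂ c₁ c₀ : ℚ} (h : ∀ x : ℚ, c₆ * x ^ 6 + c₅ * x ^ 5 +
    c₄ * x ^ 4 + c₃ * x ^ 3 + c₂ * x ^ 2 + c₁ * x + c₀ = 0) :
    c₆ = 0 ∧ c₅ = 0 ∧ c₄ = 0 ∧ c₃ = 0 ∧ c₂ = 0 ∧ c₁ = 0 ∧ c₀ = 0 := by
  have h₀ := h 0
  have h₁ := h 1
  have h₂ := h (-1)
  have h₃ := h 2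
  have h₄ := h (-2)
  have h₅ := h 3
  have h₆ := h (-3)
  norm_num at *
  refine ⟨?_, ?_, ?_, ?_, ?_, ?_, ?_⟩ <;> linarith

theorem eval_eq_sum_of_degree_lt {p : ℚ[X]} {n : ℕ} (hn : n ≠ 0) (hp : p.degree < n) (x : ℚ) :
    p.eval x = ∑ i ∈ Finset.range n, p.coeff i * x ^ i := by
  refine eval_eq_sum_range' ?_ x
  by_cases h0 : p = 0
  · rw [h0, natDegree_zero]
    omega
  · exact (natDegree_lt_iff_degree_lt h0).2 hp

/-- A divisor `(σ, ρ, β₁, β₀)` lying on the curve cut out by `y = v x`, where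
`v ^ 2 - a u ^ 2 = 4 x ^ 5 - 3`. -/
theorem exists_isMumford_of_forall {v₃ v₂ v₁ v₀ u₂ u₁ u₀ a₂ a₁ a₀ : ℚ}
    (hv : ∀ x : ℚ, (v₃ * x ^ 3 + v₂ * x ^ 2 + v₁ * x + v₀) ^ 2 -
      (a₂ * x ^ 2 + a₁ * x + a₀) * (u₂ * x ^ 2 + u₁ * x + u₀) ^ 2 = 4 * x ^ 5 - 3) :
    ∃ σ ρ β₁ β₀ l₀ : ℚ, IsMumford σ ρ β₁ β₀ ∧ u₂ ≠ 0 ∧ u₀ = u₂ * ρ ∧ v₂ = l₀ - σ * v₃ ∧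
      v₀ = β₀ + ρ * l₀ ∧ u₂ ^ 2 * a₂ = v₃ ^ 2 ∧ u₂ ^ 2 * a₁ = 2 * v₃ * l₀ - 4 ∧
      u₂ ^ 2 * a₀ = l₀ ^ 2 + 2 * β₁ * v₃ - 8 * σ ∧
      (β₀ ^ 2 + β₀ * β₁ * σ + β₁ ^ 2 * ρ) * v₃ =
        -(β₁ * (4 * σ ^ 3 - 16 * σ * ρ - β₁ ^ 2) - β₀ * (12 * σ ^ 2 - 8 * ρ)) / 2 ∧
      (β₀ ^ 2 + β₀ * β₁ * σ + β₁ ^ 2 * ρ) * l₀ = (β₁ * ρ * (12 * σ ^ 2 - 8 * ρ) +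
        (β₀ + β₁ * σ) * (4 * σ ^ 3 - 16 * σ * ρ - β₁ ^ 2)) / 2 := by
  have hu : u₂ ≠ 0 := by
    rintro rfl
    obtain ⟨h₆, h₅, -⟩ := coeff_eq_zero_of_forall (c₆ := v₃ ^ 2) (c₅ := 2 * v₃ * v₂ - 4)
      (c₄ := v₂ ^ 2 + 2 * v₃ * v₁ - a₂ * u₁ ^ 2)
      (c₃ := 2 * v₃ * v₀ + 2 * v₂ * v₁ - a₁ * u₁ ^ 2 - 2 * a₂ * u₁ * u₀)
      (c₂ := v₁ ^ 2 + 2 * v₂ * v₀ - a₀ * u₁ ^ 2 - 2 * a₁ * u₁ * u₀ - a₂ * u₀ ^ 2)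
      (c₁ := 2 * v₁ * v₀ - 2 * a₀ * u₁ * u₀ - a₁ * u₀ ^ 2)
      (c₀ := v₀ ^ 2 - a₀ * u₀ ^ 2 + 3) fun x => by linear_combination hv x
    rw [pow_eq_zero_iff two_ne_zero] at h₆
    rw [h₆] at h₅
    norm_num at h₅
  obtain ⟨σ, rfl⟩ : ∃ σ, u₁ = -u₂ * σ := ⟨-u₁ / u₂, by field_simp⟩
  obtain ⟨ρ, rfl⟩ : ∃ ρ, u₀ = u₂ * ρ := ⟨u₀ / u₂, by field_simp⟩
  obtain ⟨l₀, rfl⟩ : ∃ l₀, v₂ = l₀ - σ * v₃ := ⟨v₂ + σ * v₃, by ring⟩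
  obtain ⟨β₁, rfl⟩ : ∃ β₁, v₁ = β₁ + ρ * v₃ - σ * l₀ := ⟨v₁ - ρ * v₃ + σ * l₀, by ring⟩
  obtain ⟨β₀, rfl⟩ : ∃ β₀, v₀ = β₀ + ρ * l₀ := ⟨v₀ - ρ * l₀, by ring⟩
  obtain ⟨d₂, hd₂⟩ : ∃ d₂, d₂ = v₃ ^ 2 - u₂ ^ 2 * a₂ := ⟨_, rfl⟩
  obtain ⟨d₁, hd₁⟩ : ∃ d₁, d₁ = 2 * v₃ * l₀ - u₂ ^ 2 * a₁ := ⟨_, rfl⟩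
  obtain ⟨d₀, hd₀⟩ : ∃ d₀, d₀ = l₀ ^ 2 - u₂ ^ 2 * a₀ := ⟨_, rfl⟩
  obtain ⟨h₆, h₅, h₄, h₃, h₂, h₁, h₀⟩ := coeff_eq_zero_of_forall
    (c₆ := d₂) (c₅ := d₁ - 2 * σ * d₂ - 4)
    (c₄ := 2 * β₁ * v₃ + d₀ - 2 * σ * d₁ + (σ ^ 2 + 2 * ρ) * d₂)
    (c₃ := 2 * (β₁ * l₀ + β₀ * v₃) - 2 * σ * β₁ * v₃ - 2 * σ * d₀ + (σ ^ 2 + 2 * ρ) * d₁ -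
      2 * σ * ρ * d₂)
    (c₂ := β₁ ^ 2 + 2 * β₀ * l₀ - 2 * σ * (β₁ * l₀ + β₀ * v₃) + 2 * ρ * β₁ * v₃ +
      (σ ^ 2 + 2 * ρ) * d₀ - 2 * σ * ρ * d₁ + ρ ^ 2 * d₂)
    (c₁ := 2 * β₁ * β₀ - 2 * σ * β₀ * l₀ + 2 * ρ * (β₁ * l₀ + β₀ * v₃) - 2 * σ * ρ * d₀ +
      ρ ^ 2 * d₁)
    (c₀ := β₀ ^ 2 + 2 * ρ * β₀ * l₀ + ρ ^ 2 * d₀ + 3) fun x => by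
      rw [hd₂, hd₁, hd₀]
      linear_combination hv x
  rw [h₆] at h₅ h₄ h₃ h₂ hd₂
  have e₁ : d₁ = 4 := by linear_combination h₅
  rw [e₁] at h₄ h₃ h₂ h₁ hd₁
  have e₀ : d₀ = 8 * σ - 2 * β₁ * v₃ := by linear_combination h₄
  rw [e₀] at h₃ h₂ h₁ h₀ hd₀
  have r₁ : 2 * β₁ * l₀ + (2 * β₀ + 2 * β₁ * σ) * v₃ = 12 * σ ^ 2 - 8 * ρ := by
    linear_combination h₃
  have r₀ : 2 * β₀ * l₀ - 2 * β₁ * ρ * v₃ = 4 * σ ^ 3 - 16 * σ * ρ - β₁ ^ 2 := by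
    linear_combination h₂ + σ * r₁
  refine ⟨σ, ρ, β₁, β₀, l₀, ⟨?_, ?_⟩, hu, rfl, rfl, rfl, ?_, ?_, ?_, ?_, ?_⟩
  · linear_combination h₁ - ρ * r₁ + σ * r₀
  · linear_combination h₀ - ρ * r₀
  · linear_combination hd₂
  · linear_combination hd₁
  · linear_combination hd₀
  · linear_combination β₀ / 2 * r₁ - β₁ / 2 * r₀
  · linear_combination β₁ * ρ / 2 * r₁ + (β₀ + β₁ * σ) / 2 * r₀

section
variable {K : Type*} [Field K] [NumberField K] {s : K}

/-- A divisor class of degree `2` whose image under the descent map is trivial is twice a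
divisor class. -/
theorem IsFifthRoot.exists_delta_eq (h : IsFifthRoot s) {σ' ρ' γ₁ γ₀ : ℚ}
    (hm : IsMumford σ' ρ' γ₁ γ₀) (hd : σ' ^ 2 ≠ 4 * ρ')
    (hsq : IsSquare (aeval (theta s) (quad σ' ρ'))) :
    ∃ σ ρ β₁ β₀ r : ℚ, IsMumford σ ρ β₁ β₀ ∧
      delta₁ 1 σ ρ (kappa σ ρ β₁) = r ∧ delta₂ 1 σ ρ (kappa σ ρ β₁) = r * σ' ∧
      delta₃ 1 σ ρ (kappa σ ρ β₁) = r * ρ' ∧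
      delta₄ 1 σ ρ (kappa σ ρ β₁) = r * kappa σ' ρ' γ₁ := by
  have hdeg := natDegree_quad σ' ρ'
  obtain ⟨u, v, hu, hv, huv, t, ht⟩ := h.exists_sq_sub_mul_sq (by omega) (by omega) hm.sub_sq_eq
    hsq (quad_ne_sq hd)
  rw [hdeg] at hv
  have hq0 : quad σ' ρ' ≠ 0 := by
    rintro h0
    simp [h0] at hdeg
  have htd : t.natDegree ≤ 1 := by
    by_cases ht0 : t = 0
    · simp [ht0]
    have h1 := congrArg natDegree ht
    rw [natDegree_mul hq0 ht0, hdeg] at h1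
    have h2 : v.natDegree ≤ 3 := by
      by_cases hv0 : v = 0
      · simp [hv0]
      · exact Nat.lt_succ_iff.1 ((natDegree_lt_iff_degree_lt hv0).2 hv)
    have h3 : (C γ₁ * X + C γ₀).natDegree ≤ 1 := by compute_degree
    have h4 := natDegree_sub_le v (C γ₁ * X + C γ₀)
    omega
  obtain ⟨t₁, t₀, rfl⟩ := exists_eq_X_add_C_of_natDegree_le_one htd
  have hw : u ^ 2 + (4 * X ^ 3 + 4 * C σ' * X ^ 2 + C (4 * σ' ^ 2 - 4 * ρ') * X +
      C (4 * σ' ^ 3 - 8 * σ' * ρ' - γ₁ ^ 2)) =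
      2 * v * (C t₁ * X + C t₀) - quad σ' ρ' * (C t₁ * X + C t₀) ^ 2 := by
    apply mul_left_cancel₀ hq0
    linear_combination (v - quad σ' ρ' * (C t₁ * X + C t₀) + (C γ₁ * X + C γ₀)) * ht - huv -
      hm.sub_sq_eq
  have hu' := fun x => eval_eq_sum_of_degree_lt three_ne_zero hu x
  have hv' := fun x => eval_eq_sum_of_degree_lt four_ne_zero hv x
  simp only [Finset.sum_range_succ, Finset.sum_range_zero, pow_zero, zero_add, mul_one,
    pow_one] at hu' hv'
  have huv' : ∀ x : ℚ, (v.coeff 3 * x ^ 3 + v.coeff 2 * x ^ 2 + v.coeff 1 * x + v.coeff 0) ^ 2 -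
      (1 * x ^ 2 + (-σ') * x + ρ') * (u.coeff 2 * x ^ 2 + u.coeff 1 * x + u.coeff 0) ^ 2 =
      4 * x ^ 5 - 3 := by
    intro x
    have := congrArg (eval x) huv
    simp only [quad, eval_sub, eval_add, eval_mul, eval_pow, eval_X, eval_C, eval_ofNat, hu',
      hv'] at this
    rw [← this]
    ring
  obtain ⟨-, -, -, e₃, e₂, -, -⟩ := coeff_eq_zero_of_forall (c₆ := 0) (c₅ := 0) (c₄ := 0)
    (c₃ := v.coeff 3 - t₁) (c₂ := v.coeff 2 - t₀ + t₁ * σ')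
    (c₁ := v.coeff 1 - γ₁ - t₁ * ρ' + t₀ * σ') (c₀ := v.coeff 0 - γ₀ - t₀ * ρ') fun x => by
      have := congrArg (eval x) ht
      simp only [quad, eval_sub, eval_add, eval_mul, eval_pow, eval_X, eval_C, hv'] at this
      linear_combination this
  have hw₀ := congrArg (eval 0) hw
  simp [hu', hv', quad] at hw₀
  obtain ⟨σ, ρ, β₁, β₀, l₀, hM, hu₂, hu₀, hv₂, hv₀, ha₂, ha₁, ha₀, hl₁, hl₀⟩ :=
    exists_isMumford_of_forall huv'
  clear huv' hw hv' hu'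
  generalize v.coeff 3 = l₁ at *
  obtain rfl : l₁ = t₁ := by linear_combination e₃
  generalize u.coeff 2 = u₂ at *
  rw [hu₀, hv₀] at hw₀
  rw [hv₂] at e₂
  have hN := h.res_ne_zero hM
  have h₁ := hM.delta₁_eq hl₁
  have h₂ := hM.delta₂_eq rfl hl₁ hl₀
  have h₃ := hM.delta₃_eq rfl hl₁ hl₀
  have h₄ := hM.delta₄_eq rfl hl₁ hl₀
  generalize β₀ ^ 2 + β₀ * β₁ * σ + β₁ ^ 2 * ρ = N at *
  refine ⟨σ, ρ, β₁, β₀, N ^ 2 * u₂ ^ 2 / 4, hM, ?_, ?_, ?_, ?_⟩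
  · linear_combination h₁ / 4 - N ^ 2 / 4 * ha₂
  · linear_combination h₂ / 4 + N ^ 2 / 4 * ha₁
  · linear_combination h₃ / 4 - N ^ 2 / 4 * ha₀
  · apply mul_left_cancel₀ (show 16 * N ^ 2 ≠ 0 by positivity)
    have ht₀ : t₀ = l₀ - σ * l₁ + l₁ * σ' := by linear_combination -e₂
    have ha₁' : l₁ ^ 2 * σ' = 4 - 2 * l₁ * l₀ := by linear_combination -ha₁ - σ' * ha₂
    have ha₀' : l₁ ^ 2 * ρ' = l₀ ^ 2 + 2 * β₁ * l₁ - 8 * σ := by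
      linear_combination ha₀ - ρ' * ha₂
    rw [ht₀] at hw₀
    rw [h₄, kappa]
    linear_combination N ^ 4 * (-(γ₁ ^ 2 - 4 * σ' ^ 3 + 4 * σ' * ρ') * ha₂ + l₁ ^ 2 * hw₀ -
      l₁ ^ 2 * ρ ^ 2 * ha₂ + 2 * (β₀ + ρ * l₀) * l₁ * ha₁' -
      ρ' * l₁ ^ 2 * (σ' - 2 * σ) * ha₁' -
      (l₀ ^ 2 + 2 * σ * (l₁ * l₀ - 4) + σ ^ 2 * l₁ ^ 2) * ha₀')

/-- The analogue of `IsFifthRoot.exists_delta_eq` for a rational point. -/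
theorem IsFifthRoot.exists_delta_eq_of_point (h : IsFifthRoot s) {x y : ℚ}
    (hxy : y ^ 2 = 4 * x ^ 5 - 3) (hsq : IsSquare (aeval (theta s) (C x - X))) :
    ∃ σ ρ β₁ β₀ r : ℚ, IsMumford σ ρ β₁ β₀ ∧
      delta₁ 1 σ ρ (kappa σ ρ β₁) = 0 ∧ delta₂ 1 σ ρ (kappa σ ρ β₁) = r ∧
      delta₃ 1 σ ρ (kappa σ ρ β₁) = r * x ∧ delta₄ 1 σ ρ (kappa σ ρ β₁) = r * x ^ 2 := by
  have hdeg : (C x - X : ℚ[X]).natDegree = 1 := by compute_degree!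
  have hw : 4 * X ^ 5 - 3 - (C y) ^ 2 = (C x - X) *
      (-4 * (X ^ 4 + C x * X ^ 3 + C x ^ 2 * X ^ 2 + C x ^ 3 * X + C x ^ 4)) := by
    have := congrArg (C : ℚ → ℚ[X]) hxy
    simp only [map_sub, map_mul, map_pow, map_ofNat] at this
    linear_combination -this
  obtain ⟨u, v, hu, hv, huv, -, -⟩ := h.exists_sq_sub_mul_sq (by omega) (by omega) hw
    hsq (sub_ne_sq x)
  rw [hdeg] at hv
  have hu' := fun x => eval_eq_sum_of_degree_lt three_ne_zero hu x
  have hv' := fun x => eval_eq_sum_of_degree_lt three_ne_zero hv x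
  simp only [Finset.sum_range_succ, Finset.sum_range_zero, pow_zero, zero_add, mul_one,
    pow_one] at hu' hv'
  have huv' : ∀ t : ℚ, (0 * t ^ 3 + v.coeff 2 * t ^ 2 + v.coeff 1 * t + v.coeff 0) ^ 2 -
      (0 * t ^ 2 + (-1) * t + x) * (u.coeff 2 * t ^ 2 + u.coeff 1 * t + u.coeff 0) ^ 2 =
      4 * t ^ 5 - 3 := by
    intro t
    have := congrArg (eval t) huv
    simp only [eval_sub, eval_mul, eval_pow, eval_X, eval_C, eval_ofNat, hu', hv'] at this
    rw [← this]
    ring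
  obtain ⟨σ, ρ, β₁, β₀, l₀, hM, hu₂, -, -, -, -, ha₁, ha₀, hl₁, hl₀⟩ :=
    exists_isMumford_of_forall huv'
  have hN := h.res_ne_zero hM
  have h₁ := hM.delta₁_eq hl₁
  have h₂ := hM.delta₂_eq rfl hl₁ hl₀
  have h₃ := hM.delta₃_eq rfl hl₁ hl₀
  have h₄ := hM.delta₄_eq rfl hl₁ hl₀
  generalize β₀ ^ 2 + β₀ * β₁ * σ + β₁ ^ 2 * ρ = N at *
  have hx : l₀ ^ 2 - 8 * σ = 4 * x := by linear_combination -ha₀ - x * ha₁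
  refine ⟨σ, ρ, β₁, β₀, N ^ 2, hM, ?_, ?_, ?_, ?_⟩
  · linear_combination h₁ / 4
  · linear_combination h₂ / 4
  · linear_combination h₃ / 4 + N ^ 2 / 4 * hx
  · apply mul_left_cancel₀ (show 16 * N ^ 2 ≠ 0 by positivity)
    linear_combination h₄ + N ^ 4 * (l₀ ^ 2 - 8 * σ + 4 * x) * hx

end
end

noncomputable section

/-- The integers `k₁, k₂, k₃, k₄` with `k₁ ≠ 0` are the coordinates on the Kummer surface of a
rational divisor. -/
def IsKummerPoint (k₁ k₂ k₃ k₄ : ℤ) : Prop :=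
  k₁ ≠ 0 ∧ ∃ σ ρ β₁ β₀ : ℚ, IsMumford σ ρ β₁ β₀ ∧ (k₂ : ℚ) = k₁ * σ ∧ (k₃ : ℚ) = k₁ * ρ ∧
    (k₄ : ℚ) = k₁ * kappa σ ρ β₁

/-- The point `x` of the Kummer surface is primitive at `2`, and doubling it gives `k`. -/
structure IsHalf (x₁ x₂ x₃ x₄ k₁ k₂ k₃ k₄ : ℤ) : Prop where
  kummer_eq : kummer x₁ x₂ x₃ x₄ = 0
  eq₁ : delta₁ x₁ x₂ x₃ x₄ * k₄ = delta₄ x₁ x₂ x₃ x₄ * k₁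
  eq₂ : delta₂ x₁ x₂ x₃ x₄ * k₄ = delta₄ x₁ x₂ x₃ x₄ * k₂
  eq₃ : delta₃ x₁ x₂ x₃ x₄ * k₄ = delta₄ x₁ x₂ x₃ x₄ * k₃
  primitive : ¬(2 ∣ x₁ ∧ 2 ∣ x₂ ∧ 2 ∣ x₃ ∧ 2 ∣ x₄)

section homogeneous
variable {R : Type*} [CommRing R] (c k₁ k₂ k₃ k₄ : R)

theorem kummer_mul : kummer (c * k₁) (c * k₂) (c * k₃) (c * k₄) = c ^ 4 * kummer k₁ k₂ k₃ k₄ := by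
  simp only [kummer]; ring

theorem delta₁_mul : delta₁ (c * k₁) (c * k₂) (c * k₃) (c * k₄) = c ^ 4 * delta₁ k₁ k₂ k₃ k₄ := by
  simp only [delta₁]; ring

theorem delta₂_mul : delta₂ (c * k₁) (c * k₂) (c * k₃) (c * k₄) = c ^ 4 * delta₂ k₁ k₂ k₃ k₄ := by
  simp only [delta₂]; ring

theorem delta₃_mul : delta₃ (c * k₁) (c * k₂) (c * k₃) (c * k₄) = c ^ 4 * delta₃ k₁ k₂ k₃ k₄ := by
  simp only [delta₃]; ring

theorem delta₄_mul : delta₄ (c * k₁) (c * k₂) (c * k₃) (c * k₄) = c ^ 4 * delta₄ k₁ k₂ k₃ k₄ := by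
  simp only [delta₄]; ring

theorem kummer_cast (a b c d : ℤ) : ((kummer a b c d : ℤ) : ℚ) = kummer (a : ℚ) b c d := by
  simp [kummer]

theorem delta₁_cast (a b c d : ℤ) : ((delta₁ a b c d : ℤ) : ℚ) = delta₁ (a : ℚ) b c d := by
  simp [delta₁]

theorem delta₂_cast (a b c d : ℤ) : ((delta₂ a b c d : ℤ) : ℚ) = delta₂ (a : ℚ) b c d := by
  simp [delta₂]

theorem delta₃_cast (a b c d : ℤ) : ((delta₃ a b c d : ℤ) : ℚ) = delta₃ (a : ℚ) b c d := by
  simp [delta₃]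

theorem delta₄_cast (a b c d : ℤ) : ((delta₄ a b c d : ℤ) : ℚ) = delta₄ (a : ℚ) b c d := by
  simp [delta₄]

end homogeneous

theorem exists_int_primitive (a b c : ℚ) : ∃ n₁ n₂ n₃ n₄ : ℤ, n₁ ≠ 0 ∧
    ¬(2 ∣ n₁ ∧ 2 ∣ n₂ ∧ 2 ∣ n₃ ∧ 2 ∣ n₄) ∧ (n₂ : ℚ) = n₁ * a ∧ (n₃ : ℚ) = n₁ * b ∧
      (n₄ : ℚ) = n₁ * c := by
  have key : ∀ n : ℕ, n ≠ 0 → ∀ n₂ n₃ n₄ : ℤ, (n₂ : ℚ) = n * a → (n₃ : ℚ) = n * b →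
      (n₄ : ℚ) = n * c → ∃ n₁ n₂ n₃ n₄ : ℤ, n₁ ≠ 0 ∧
        ¬(2 ∣ n₁ ∧ 2 ∣ n₂ ∧ 2 ∣ n₃ ∧ 2 ∣ n₄) ∧ (n₂ : ℚ) = n₁ * a ∧ (n₃ : ℚ) = n₁ * b ∧
          (n₄ : ℚ) = n₁ * c := by
    intro n
    induction n using Nat.strong_induction_on with
    | _ n ih =>
    intro hn n₂ n₃ n₄ h₂ h₃ h₄
    by_cases hp : 2 ∣ (n : ℤ) ∧ 2 ∣ n₂ ∧ 2 ∣ n₃ ∧ 2 ∣ n₄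
    · obtain ⟨h1, ⟨m₂, rfl⟩, ⟨m₃, rfl⟩, ⟨m₄, rfl⟩⟩ := hp
      obtain ⟨m, rfl⟩ : 2 ∣ n := by omega
      push_cast at h₂ h₃ h₄
      exact ih m (by omega) (by omega) m₂ m₃ m₄ (by linarith) (by linarith) (by linarith)
    · exact ⟨n, n₂, n₃, n₄, by exact_mod_cast hn, hp, by simpa using h₂, by simpa using h₃,
        by simpa using h₄⟩
  have ha := Rat.mul_den_eq_num a
  have hb := Rat.mul_den_eq_num b
  have hc := Rat.mul_den_eq_num c
  refine key (a.den * b.den * c.den) (by simp) (a.num * b.den * c.den) (b.num * a.den * c.den)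
    (c.num * a.den * b.den) ?_ ?_ ?_
  · push_cast
    linear_combination -(b.den * c.den : ℚ) * ha
  · push_cast
    linear_combination -(a.den * c.den : ℚ) * hb
  · push_cast
    linear_combination -(a.den * b.den : ℚ) * hc

theorem exists_isHalf_of_delta_eq {σ ρ β₁ β₀ r : ℚ} (hM : IsMumford σ ρ β₁ β₀) {k₁ k₂ k₃ k₄ : ℤ}
    (h₁ : delta₁ 1 σ ρ (kappa σ ρ β₁) = r * k₁)
    (h₂ : delta₂ 1 σ ρ (kappa σ ρ β₁) = r * k₂) (h₃ : delta₃ 1 σ ρ (kappa σ ρ β₁) = r * k₃)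
    (h₄ : delta₄ 1 σ ρ (kappa σ ρ β₁) = r * k₄) :
    ∃ x₁ x₂ x₃ x₄ : ℤ, IsKummerPoint x₁ x₂ x₃ x₄ ∧ IsHalf x₁ x₂ x₃ x₄ k₁ k₂ k₃ k₄ := by
  obtain ⟨x₁, x₂, x₃, x₄, hx, hp, e₂, e₃, e₄⟩ := exists_int_primitive σ ρ (kappa σ ρ β₁)
  have d₀ := kummer_mul (x₁ : ℚ) 1 σ ρ (kappa σ ρ β₁)
  have d₁ := delta₁_mul (x₁ : ℚ) 1 σ ρ (kappa σ ρ β₁)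
  have d₂ := delta₂_mul (x₁ : ℚ) 1 σ ρ (kappa σ ρ β₁)
  have d₃ := delta₃_mul (x₁ : ℚ) 1 σ ρ (kappa σ ρ β₁)
  have d₄ := delta₄_mul (x₁ : ℚ) 1 σ ρ (kappa σ ρ β₁)
  rw [← e₂, ← e₃, ← e₄, mul_one] at d₀ d₁ d₂ d₃ d₄
  rw [hM.kummer_eq_zero, mul_zero, ← kummer_cast] at d₀
  rw [h₁, ← delta₁_cast] at d₁
  rw [h₂, ← delta₂_cast] at d₂
  rw [h₃, ← delta₃_cast] at d₃
  rw [h₄, ← delta₄_cast] at d₄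
  refine ⟨x₁, x₂, x₃, x₄, ⟨hx, σ, ρ, β₁, β₀, hM, e₂, e₃, e₄⟩, by exact_mod_cast d₀, ?_, ?_, ?_, hp⟩
  all_goals
    rw [← Int.cast_inj (α := ℚ), Int.cast_mul, Int.cast_mul]
  · linear_combination k₄ * d₁ - k₁ * d₄
  · linear_combination k₄ * d₂ - k₂ * d₄
  · linear_combination k₄ * d₃ - k₃ * d₄

namespace IsHalf
variable {x₁ x₂ x₃ x₄ k₁ k₂ k₃ k₄ : ℤ}

set_option synthInstance.maxHeartbeats 400000 in
set_option synthInstance.maxSize 1000 in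
theorem parity (h : IsHalf x₁ x₂ x₃ x₄ k₁ k₂ k₃ k₄) (h₁ : 2 ∣ k₁) (h₂ : 2 ∣ k₂) (h₄ : ¬2 ∣ k₄) :
    2 ∣ x₁ ∧ 2 ∣ x₂ ∧ 2 ∣ x₃ ∧ ¬2 ∣ x₄ := by
  have e₀ := congrArg (Int.cast : ℤ → ZMod 2) h.kummer_eq
  have e₁ := congrArg (Int.cast : ℤ → ZMod 2) h.eq₁
  have e₂ := congrArg (Int.cast : ℤ → ZMod 2) h.eq₂
  have e₃ := h.primitive
  have hz : ∀ n : ℤ, 2 ∣ n ↔ (n : ZMod 2) = 0 := fun n =>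
    (ZMod.intCast_zmod_eq_zero_iff_dvd n 2).symm
  simp only [kummer, delta₁, delta₂, delta₄] at e₀ e₁ e₂
  simp only [hz] at *
  push_cast at *
  rw [h₁] at e₁
  rw [h₂] at e₂
  generalize (x₁ : ZMod 2) = a at *
  generalize (x₂ : ZMod 2) = b at *
  generalize (x₃ : ZMod 2) = c at *
  generalize (x₄ : ZMod 2) = d at *
  generalize (k₄ : ZMod 2) = e at *
  clear h₁ h₂ h
  revert a b c d e
  decide +kernel

/-- One step of the successive approximation of a half of a point close to the origin. -/
theorem dvd_step (h : IsHalf x₁ x₂ x₃ x₄ k₁ k₂ k₃ k₄) (h₄ : ¬2 ∣ k₄) (hx₄ : ¬2 ∣ x₄) {L : ℤ}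
    (hL : L ≠ 0) (h₁ : 16 * L ∣ k₁) (h₂ : 16 * L ∣ k₂) (h₃ : 16 * L ∣ k₃) (hx₁ : 2 * L ∣ x₁)
    (hx₂ : 2 * L ∣ x₂) (hx₃ : 2 * L ∣ x₃) : 4 * L ∣ x₁ ∧ 4 * L ∣ x₂ ∧ 4 * L ∣ x₃ := by
  obtain ⟨y₁, rfl⟩ := hx₁
  obtain ⟨y₂, rfl⟩ := hx₂
  obtain ⟨y₃, rfl⟩ := hx₃
  obtain ⟨n₁, rfl⟩ := h₁
  obtain ⟨n₂, rfl⟩ := h₂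
  obtain ⟨n₃, rfl⟩ := h₃
  have e₁ := h.eq₁
  have e₂ := h.eq₂
  have e₃ := h.eq₃
  have hodd : ∀ {y n : ℤ}, y * x₄ ^ 3 * k₄ = 2 * n → 2 ∣ y := by
    intro y n hy
    have : (2 : ℤ) ∣ y * x₄ ^ 3 * k₄ := ⟨n, hy⟩
    have h2 := Int.prime_two
    rcases h2.dvd_or_dvd this with h3 | h3
    · exact (h2.dvd_or_dvd h3).resolve_right fun h5 => hx₄ (h2.dvd_of_dvd_pow h5)
    · exact absurd h3 h₄
  have hD : ∃ D, D = delta₄ (2 * L * y₁) (2 * L * y₂) (2 * L * y₃) x₄ := ⟨_, rfl⟩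
  obtain ⟨D, hD⟩ := hD
  rw [← hD] at e₁ e₂ e₃
  simp only [delta₁, delta₂, delta₃] at e₁ e₂ e₃
  have hy₁ : 2 ∣ y₁ := by
    refine hodd (n := D * n₁ + k₄ * L * y₂ * y₃ * x₄ ^ 2 - 4 * k₄ * L ^ 2 * y₃ ^ 3 * x₄ +
      3 * k₄ * L ^ 3 * y₂ ^ 4 - 12 * k₄ * L ^ 3 * y₁ * y₂ ^ 2 * y₃ +
      12 * k₄ * L ^ 3 * y₁ ^ 2 * y₃ ^ 2 - 12 * k₄ * L ^ 2 * y₁ ^ 2 * y₂ * x₄) ?_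
    apply mul_left_cancel₀ (show 8 * L ≠ 0 by positivity)
    linear_combination e₁
  have hy₂ : 2 ∣ y₂ := by
    refine hodd (n := D * n₂ - k₄ * L * y₃ ^ 2 * x₄ ^ 2 + 6 * k₄ * L ^ 3 * y₂ ^ 3 * y₃ +
      24 * k₄ * L ^ 3 * y₁ * y₂ * y₃ ^ 2 + 3 * k₄ * L ^ 2 * y₁ * y₂ ^ 2 * x₄ -
      6 * k₄ * L ^ 2 * y₁ ^ 2 * y₃ * x₄ - 9 * k₄ * L ^ 3 * y₁ ^ 4) ?_
    apply mul_left_cancel₀ (show 8 * L ≠ 0 by positivity)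
    linear_combination e₂
  obtain ⟨z₁, rfl⟩ := hy₁
  obtain ⟨z₂, rfl⟩ := hy₂
  refine ⟨⟨z₁, by ring⟩, ⟨z₂, by ring⟩, ?_⟩
  obtain ⟨z₃, rfl⟩ : 2 ∣ y₃ := by
    refine hodd (n := D * n₃ + k₄ * (36 * L ^ 3 * z₂ ^ 2 * y₃ ^ 2 - 24 * L ^ 2 * z₂ ^ 3 * x₄ -
      24 * L ^ 3 * z₁ * y₃ ^ 3 - 36 * L ^ 2 * z₁ * z₂ * y₃ * x₄ - 9 * L * z₁ ^ 2 * x₄ ^ 2 +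
      288 * L ^ 3 * z₁ ^ 3 * z₂)) ?_
    apply mul_left_cancel₀ (show 8 * L ≠ 0 by positivity)
    linear_combination e₃
  exact ⟨z₃, by ring⟩

theorem four_pow_dvd (h : IsHalf x₁ x₂ x₃ x₄ k₁ k₂ k₃ k₄) {j : ℕ} (h₁ : 4 ^ (j + 1) ∣ k₁)
    (h₂ : 4 ^ (j + 1) ∣ k₂) (h₃ : 4 ^ (j + 1) ∣ k₃) (h₄ : ¬2 ∣ k₄) :
    4 ^ j ∣ x₁ ∧ 4 ^ j ∣ x₂ ∧ 4 ^ j ∣ x₃ ∧ ¬2 ∣ x₄ := by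
  have h24 : (2 : ℤ) ∣ 4 ^ (j + 1) := dvd_pow (by norm_num) (by omega)
  obtain ⟨p₁, p₂, p₃, p₄⟩ := h.parity (h24.trans h₁) (h24.trans h₂) h₄
  rcases Nat.eq_zero_or_pos j with rfl | hj
  · simpa using p₄
  have key : ∀ e : ℕ, 1 ≤ e → e ≤ 2 * j → 2 ^ e ∣ x₁ ∧ 2 ^ e ∣ x₂ ∧ 2 ^ e ∣ x₃ := by
    intro e he
    induction e, he using Nat.le_induction with
    | base => simpa using fun _ => ⟨p₁, p₂, p₃⟩
    | succ e he ih =>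
      intro hej
      obtain ⟨q₁, q₂, q₃⟩ := ih (by omega)
      obtain ⟨f, rfl⟩ : ∃ f, e = f + 1 := ⟨e - 1, by omega⟩
      have hd : (16 : ℤ) * 2 ^ f ∣ 4 ^ (j + 1) := by
        rw [show (16 : ℤ) = 2 ^ 4 by norm_num, show (4 : ℤ) = 2 ^ 2 by norm_num, ← pow_mul,
          ← pow_add]
        exact pow_dvd_pow _ (by omega)
      rw [show (2 : ℤ) ^ (f + 1) = 2 * 2 ^ f by ring] at q₁ q₂ q₃
      rw [show (2 : ℤ) ^ (f + 1 + 1) = 4 * 2 ^ f by ring]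
      exact h.dvd_step h₄ p₄ (by positivity) (hd.trans h₁) (hd.trans h₂) (hd.trans h₃) q₁ q₂ q₃
  obtain ⟨q₁, q₂, q₃⟩ := key (2 * j) (by omega) le_rfl
  rw [pow_mul] at q₁ q₂ q₃
  exact ⟨q₁, q₂, q₃, p₄⟩

end IsHalf
end

noncomputable section

namespace IsKummerPoint
variable {k₁ k₂ k₃ k₄ : ℤ}

theorem mul (h : IsKummerPoint k₁ k₂ k₃ k₄) {c : ℤ} (hc : c ≠ 0) :
    IsKummerPoint (c * k₁) (c * k₂) (c * k₃) (c * k₄) := by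
  obtain ⟨h₁, σ, ρ, β₁, β₀, hM, h₂, h₃, h₄⟩ := h
  refine ⟨mul_ne_zero hc h₁, σ, ρ, β₁, β₀, hM, ?_, ?_, ?_⟩
  · push_cast; rw [h₂]; ring
  · push_cast; rw [h₃]; ring
  · push_cast; rw [h₄]; ring

theorem kummer_eq_zero (h : IsKummerPoint k₁ k₂ k₃ k₄) : kummer k₁ k₂ k₃ k₄ = 0 := by
  obtain ⟨h₁, σ, ρ, β₁, β₀, hM, h₂, h₃, h₄⟩ := h
  have := kummer_mul (k₁ : ℚ) 1 σ ρ (kappa σ ρ β₁)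
  rw [hM.kummer_eq_zero, mul_one, ← h₂, ← h₃, ← h₄, mul_zero, ← kummer_cast] at this
  exact_mod_cast this

variable {K : Type*} [Field K] [NumberField K] {s g : K}

theorem exists_isSquareMod (h : IsKummerPoint k₁ k₂ k₃ k₄) (hs : IsFifthRoot s)
    {r : ℕ × ℕ × ℕ × ℕ × ℕ}
    (hg : HasRed s (vec s (k₃ / k₁) (1 / 2) 0 (-(k₂ / k₁) / 6) 0 * g ^ 2) r) :
    ∃ i j k : Fin 2, isSquareMod (mulMod r (selmerRed i j k)) = true ∧
      (i = 0 → j = 0 → k = 0 → k₂ ^ 2 ≠ 4 * k₁ * k₃ →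
        ∃ x₁ x₂ x₃ x₄ : ℤ, IsKummerPoint x₁ x₂ x₃ x₄ ∧ IsHalf x₁ x₂ x₃ x₄ k₁ k₂ k₃ k₄) := by
  obtain ⟨h₁, σ, ρ, β₁, β₀, hM, h₂, h₃, h₄⟩ := h
  have h₁' : (k₁ : ℚ) ≠ 0 := by exact_mod_cast h₁
  rw [show (k₃ : ℚ) / k₁ = ρ by rw [h₃]; field_simp, show (k₂ : ℚ) / k₁ = σ by rw [h₂]; field_simp,
    ← hs.aeval_quad] at hg
  obtain ⟨i, j, k, hijk, hsq⟩ := hs.exists_isSquareMod_quad hM hg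
  refine ⟨i, j, k, hijk, fun hi hj hk hd => ?_⟩
  have hdσ : σ ^ 2 ≠ 4 * ρ := by
    intro hσ
    apply hd
    rw [← Int.cast_inj (α := ℚ)]
    push_cast
    rw [h₂, h₃]
    linear_combination (k₁ : ℚ) ^ 2 * hσ
  obtain ⟨σ', ρ', γ₁, γ₀, r, hM', d₁, d₂, d₃, d₄⟩ := hs.exists_delta_eq hM hdσ (hsq hi hj hk)
  refine exists_isHalf_of_delta_eq (r := r / k₁) hM' ?_ ?_ ?_ ?_
  · rw [d₁]; field_simp
  · rw [d₂, h₂]; field_simp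
  · rw [d₃, h₃]; field_simp
  · rw [d₄, h₄]; field_simp

theorem exists_isHalf (h : IsKummerPoint k₁ k₂ k₃ k₄) (hs : IsFifthRoot s)
    {r : ℕ × ℕ × ℕ × ℕ × ℕ} (hd : k₂ ^ 2 ≠ 4 * k₁ * k₃)
    (hg : HasRed s (vec s (k₃ / k₁) (1 / 2) 0 (-(k₂ / k₁) / 6) 0 * g ^ 2) r)
    (hr : ∀ i j k : Fin 2, isSquareMod (mulMod r (selmerRed i j k)) = true → i = 0 ∧ j = 0 ∧ k = 0) :
    ∃ x₁ x₂ x₃ x₄ : ℤ, IsKummerPoint x₁ x₂ x₃ x₄ ∧ IsHalf x₁ x₂ x₃ x₄ k₁ k₂ k₃ k₄ := by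
  obtain ⟨i, j, k, hijk, himp⟩ := h.exists_isSquareMod hs hg
  obtain ⟨hi, hj, hk⟩ := hr i j k hijk
  exact himp hi hj hk hd

end IsKummerPoint

theorem not_two_dvd_of_cast_eq_one {n : ℤ} (h : (n : ZMod 8) = 1) : ¬2 ∣ n := by
  have : n % 8 = 1 % 8 := (ZMod.intCast_eq_intCast_iff n 1 8).1 (by exact_mod_cast h)
  omega

theorem cast_sq_eq_one {n : ℤ} (h : ¬2 ∣ n) : (n : ZMod 8) * n = 1 := by
  have : n * n % 8 = 1 % 8 := by
    have h8 : n % 8 = 1 ∨ n % 8 = 3 ∨ n % 8 = 5 ∨ n % 8 = 7 := by omega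
    rcases h8 with h8 | h8 | h8 | h8 <;> rw [Int.mul_emod, h8] <;> rfl
  exact_mod_cast (ZMod.intCast_eq_intCast_iff (n * n) 1 8).2 this

/-- A point of the Kummer surface which is `2`-adically close to the origin, in the direction of
the tangent at the rational point `(1, 1)`. -/
structure IsNear (j : ℕ) (u w z κ : ℤ) : Prop where
  point : IsKummerPoint (4 * 4 ^ j * u) (8 * 4 ^ j * w) (4 * 4 ^ j * z) κ
  u_eq : (u : ZMod 8) = 1
  w_eq : 2 * (w : ZMod 8) = 2
  z_eq : (z : ZMod 8) = 1 + 3 * 4 ^ j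
  κ_eq : (κ : ZMod 8) = 1

namespace IsNear
variable {j : ℕ} {u w z κ : ℤ}

theorem ne (h : IsNear j u w z κ) :
    (8 * 4 ^ j * w) ^ 2 ≠ 4 * (4 * 4 ^ j * u) * (4 * 4 ^ j * z) := by
  intro hd
  have hk := h.point.kummer_eq_zero
  have hu := not_two_dvd_of_cast_eq_one h.u_eq
  have hκ := not_two_dvd_of_cast_eq_one h.κ_eq
  have hA : (4 : ℤ) ^ j ≠ 0 := by positivity
  generalize (4 : ℤ) ^ j = A at *
  have hw : w ^ 2 = u * z := by
    apply mul_left_cancel₀ (show 64 * A ^ 2 ≠ 0 by positivity)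
    linear_combination hd
  have h3 : 3 * u ^ 3 * κ = 2 * (-(48 * A * u * w ^ 3) + 12 * A * u ^ 2 * w * z - 2 * A * z ^ 4 +
      2 * w * z ^ 2 * κ) := by
    apply mul_left_cancel₀ (show 64 * A ^ 3 ≠ 0 by positivity)
    rw [kummer] at hk
    linear_combination hk - 64 * A ^ 2 * κ ^ 2 * hw
  have h2 : (2 : ℤ) ∣ 3 * u ^ 3 * κ := ⟨_, h3⟩
  have hp := Int.prime_two
  rcases hp.dvd_or_dvd h2 with h4 | h4
  · rcases hp.dvd_or_dvd h4 with h5 | h5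
    · omega
    · exact hu (hp.dvd_of_dvd_pow h5)
  · exact hκ h4

theorem exists_isHalf {K : Type*} [Field K] [NumberField K] {s : K} (hs : IsFifthRoot s)
    (h : IsNear (j + 1) u w z κ) :
    ∃ x₁ x₂ x₃ x₄ : ℤ, IsKummerPoint x₁ x₂ x₃ x₄ ∧ IsHalf x₁ x₂ x₃ x₄
      (4 * 4 ^ (j + 1) * u) (8 * 4 ^ (j + 1) * w) (4 * 4 ^ (j + 1) * z) κ := by
  have hu : (u : ℚ) ≠ 0 := by
    rintro h0
    have : u = 0 := by exact_mod_cast h0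
    exact not_two_dvd_of_cast_eq_one h.u_eq (by simp [this])
  have hv : vec s (9 * u ^ 2 : ℤ) (0 : ℤ) (-6 * u * w : ℤ) (0 : ℤ) (u * z : ℤ) =
      vec s ((4 * 4 ^ (j + 1) * z : ℤ) / (4 * 4 ^ (j + 1) * u : ℤ)) (1 / 2) 0
        (-((8 * 4 ^ (j + 1) * w : ℤ) / (4 * 4 ^ (j + 1) * u : ℤ)) / 6) 0 * (u * s ^ 2) ^ 2 := by
    have h1 : (u : ℚ) * ((4 * 4 ^ (j + 1) * z : ℤ) / (4 * 4 ^ (j + 1) * u : ℤ)) = z := by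
      push_cast; field_simp
    have h2 : (u : ℚ) * ((8 * 4 ^ (j + 1) * w : ℤ) / (4 * 4 ^ (j + 1) * u : ℤ)) = 2 * w := by
      push_cast; field_simp; ring
    generalize ((4 * 4 ^ (j + 1) * z : ℤ) : ℚ) / (4 * 4 ^ (j + 1) * u : ℤ) = ρ at *
    generalize ((8 * 4 ^ (j + 1) * w : ℤ) : ℚ) / (4 * 4 ^ (j + 1) * u : ℤ) = σ at *
    have h1' := congrArg (Rat.cast : ℚ → K) h1
    have h2' := congrArg (Rat.cast : ℚ → K) h2
    simp only [vec]
    push_cast at *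
    linear_combination (-(u : K) ^ 2 / 2 + u ^ 2 * σ * s ^ 2 / 6) * hs.pow_five - u * s ^ 4 * h1' +
      3 * u * s ^ 2 * h2'
  have hg : HasRed s _ _ := hasRed_vec (s := s) (9 * u ^ 2) 0 (-6 * u * w) 0 (u * z)
  rw [hv] at hg
  have hc : ∀ a b : ℤ, (a : ZMod 8) = b → a ≡ b [ZMOD 8] := fun a b =>
    (ZMod.intCast_eq_intCast_iff a b 8).1
  have e₁ : (9 * u ^ 2 : ℤ) ≡ 1 [ZMOD 8] := hc _ _ (by push_cast; rw [h.u_eq]; decide)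
  have e₂ : -6 * u * w ≡ 2 [ZMOD 8] := hc _ _ (by
    have : (8 : ZMod 8) = 0 := by decide
    push_cast; rw [h.u_eq]; linear_combination (-3 : ZMod 8) * h.w_eq - this)
  by_cases hj : j = 0
  · have e₃ : u * z ≡ 5 [ZMOD 8] := hc _ _ (by push_cast; rw [h.u_eq, h.z_eq, hj]; decide)
    rw [redMod_congr e₁ rfl e₂ rfl e₃] at hg
    exact h.point.exists_isHalf hs h.ne hg (by decide +kernel)
  · obtain ⟨i, rfl⟩ := Nat.exists_eq_succ_of_ne_zero hj
    have e₃ : u * z ≡ 1 [ZMOD 8] := hc _ _ (by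
      push_cast; rw [h.u_eq, h.z_eq, pow_succ, pow_succ]
      have : (16 : ZMod 8) = 0 := by decide
      linear_combination (3 * 4 ^ i) * this)
    rw [redMod_congr e₁ rfl e₂ rfl e₃] at hg
    exact h.point.exists_isHalf hs h.ne hg (by decide +kernel)

theorem descend {K : Type*} [Field K] [NumberField K] {s : K} (hs : IsFifthRoot s)
    (h : IsNear (j + 1) u w z κ) : ∃ u' w' z' κ' : ℤ, IsNear j u' w' z' κ' := by
  obtain ⟨x₁, x₂, x₃, x₄, hx, hxk⟩ := h.exists_isHalf hs
  have hκ := not_two_dvd_of_cast_eq_one h.κ_eq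
  obtain ⟨⟨y₁, rfl⟩, ⟨y₂, rfl⟩, ⟨y₃, rfl⟩, hx₄⟩ := hxk.four_pow_dvd (j := j + 1)
    ⟨u, by ring⟩ ⟨2 * w, by ring⟩ ⟨z, by ring⟩ hκ
  have e₁ := hxk.eq₁
  have e₂ := hxk.eq₂
  have e₃ := hxk.eq₃
  have hx₄' := cast_sq_eq_one hx₄
  have hA : (4 : ℤ) ^ j ≠ 0 := by positivity
  rw [pow_succ] at *
  generalize hA4 : (4 : ℤ) ^ j = A at *
  obtain ⟨w', rfl⟩ : 2 ∣ y₂ := by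
    have h3 : y₂ * x₄ ^ 3 * κ = 2 * (delta₄ (A * 4 * y₁) (A * 4 * y₂) (A * 4 * y₃) x₄ * w -
        κ * (2 * A * y₃ ^ 2 * x₄ ^ 2 - 48 * A ^ 3 * y₂ ^ 3 * y₃ - 192 * A ^ 3 * y₁ * y₂ * y₃ ^ 2 -
        12 * A ^ 2 * y₁ * y₂ ^ 2 * x₄ + 24 * A ^ 2 * y₁ ^ 2 * y₃ * x₄ +
        72 * A ^ 3 * y₁ ^ 4)) := by
      apply mul_left_cancel₀ (show 16 * A ≠ 0 by positivity)
      rw [delta₂] at e₂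
      linear_combination e₂
    have h2 := Int.prime_two
    rcases h2.dvd_or_dvd (Dvd.intro _ h3.symm) with h4 | h4
    · exact (h2.dvd_or_dvd h4).resolve_right fun h5 => hx₄ (h2.dvd_of_dvd_pow h5)
    · exact absurd h4 hκ
  have h8 : (8 : ZMod 8) = 0 := by decide
  have hD : ((delta₄ (A * 4 * y₁) (A * 4 * (2 * w')) (A * 4 * y₃) x₄ : ℤ) : ZMod 8) = 1 := by
    rw [delta₄]
    push_cast
    linear_combination ((x₄ : ZMod 8) ^ 2 + 1) * hx₄' + (384 * A ^ 4 * w' * y₃ ^ 3 +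
      384 * A ^ 3 * w' ^ 2 * y₃ * x₄ + 48 * A ^ 3 * y₁ * y₃ ^ 2 * x₄ - 24 * A ^ 2 * y₁ * w' * x₄ ^ 2 +
      1152 * A ^ 4 * y₁ ^ 2 * w' ^ 2 + 576 * A ^ 4 * y₁ ^ 3 * y₃) * h8
  generalize delta₄ (A * 4 * y₁) (A * 4 * (2 * w')) (A * 4 * y₃) x₄ = D at *
  have f₁ : (y₁ * x₄ ^ 3 + 8 * (4 * A ^ 2 * y₃ ^ 3 * x₄ - A * w' * y₃ * x₄ ^ 2 -
      96 * A ^ 3 * w' ^ 4 + 96 * A ^ 3 * y₁ * w' ^ 2 * y₃ - 24 * A ^ 3 * y₁ ^ 2 * y₃ ^ 2 +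
      24 * A ^ 2 * y₁ ^ 2 * w' * x₄)) * κ = D * u := by
    apply mul_left_cancel₀ (show 16 * A ≠ 0 by positivity)
    rw [delta₁] at e₁
    linear_combination e₁
  have f₂ : (2 * w' * x₄ ^ 3 + 4 * A * y₃ ^ 2 * x₄ ^ 2 + 8 * (-96 * A ^ 3 * w' ^ 3 * y₃ -
      96 * A ^ 3 * y₁ * w' * y₃ ^ 2 - 12 * A ^ 2 * y₁ * w' ^ 2 * x₄ +
      6 * A ^ 2 * y₁ ^ 2 * y₃ * x₄ + 18 * A ^ 3 * y₁ ^ 4)) * κ = D * (2 * w) := by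
    apply mul_left_cancel₀ (show 16 * A ≠ 0 by positivity)
    rw [delta₂] at e₂
    linear_combination e₂
  have f₃ : (y₃ * x₄ ^ 3 + 9 * A * y₁ ^ 2 * x₄ ^ 2 + 8 * (-72 * A ^ 3 * w' ^ 2 * y₃ ^ 2 +
      24 * A ^ 2 * w' ^ 3 * x₄ + 24 * A ^ 3 * y₁ * y₃ ^ 3 + 18 * A ^ 2 * y₁ * w' * y₃ * x₄ -
      72 * A ^ 3 * y₁ ^ 3 * w')) * κ = D * z := by
    apply mul_left_cancel₀ (show 16 * A ≠ 0 by positivity)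
    rw [delta₃] at e₃
    linear_combination e₃
  have g₁ := congrArg (Int.cast : ℤ → ZMod 8) f₁
  have g₂ := congrArg (Int.cast : ℤ → ZMod 8) f₂
  have g₃ := congrArg (Int.cast : ℤ → ZMod 8) f₃
  push_cast at g₁ g₂ g₃
  have hz := h.z_eq
  have hA' : (4 : ZMod 8) ^ j = A := by rw [← hA4]; push_cast; rfl
  rw [pow_succ, hA'] at hz
  rw [h8, zero_mul, add_zero, hD, h.κ_eq, h.u_eq, mul_one, mul_one] at g₁
  rw [h8, zero_mul, add_zero, hD, h.κ_eq, h.w_eq, mul_one, one_mul] at g₂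
  rw [h8, zero_mul, add_zero, hD, h.κ_eq, hz, mul_one, one_mul] at g₃
  have q₁ : (y₁ : ZMod 8) * x₄ = 1 := by
    linear_combination g₁ - y₁ * x₄ * hx₄'
  have q₃ : (y₃ : ZMod 8) * x₄ = 1 + 3 * A := by
    linear_combination g₃ - y₃ * x₄ * hx₄' - 9 * A * (y₁ * x₄ + 1) * q₁
  have q₂ : 2 * ((w' : ZMod 8) * x₄) = 2 := by
    have hAA : ∀ a : ZMod 8, 4 * a * (1 + 3 * a) ^ 2 = 0 := by decide
    linear_combination g₂ - 2 * w' * x₄ * hx₄' - 4 * A * (y₃ * x₄ + 1 + 3 * A) * q₃ - hAA A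
  have hx₄0 : x₄ ≠ 0 := by
    rintro rfl
    exact hx₄ (dvd_zero 2)
  refine ⟨x₄ * y₁, x₄ * w', x₄ * y₃, x₄ * x₄, ?_, ?_, ?_, ?_, ?_⟩
  · rw [hA4]
    convert hx.mul hx₄0 using 1 <;> ring
  · push_cast; rw [mul_comm, q₁]
  · push_cast; rw [mul_comm (x₄ : ZMod 8), q₂]
  · push_cast; rw [mul_comm, q₃, hA']
  · push_cast; exact hx₄'

end IsNear
end

noncomputable section

/-- The rational `q` is integral at `2` and reduces to `a` modulo `8`. -/
def RedEight (q : ℚ) (a : ZMod 8) : Prop :=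
  ∃ n d : ℤ, (n : ZMod 8) = a ∧ (d : ZMod 8) = 1 ∧ q * d = n

namespace RedEight
variable {p q : ℚ} {a b : ZMod 8}

theorem add (hp : RedEight p a) (hq : RedEight q b) : RedEight (p + q) (a + b) := by
  obtain ⟨n, d, rfl, hd, h⟩ := hp
  obtain ⟨m, e, rfl, he, h'⟩ := hq
  refine ⟨n * e + m * d, d * e, by push_cast; rw [hd, he]; ring,
    by push_cast; rw [hd, he]; ring, ?_⟩
  push_cast
  linear_combination (e : ℚ) * h + d * h'

theorem mul (hp : RedEight p a) (hq : RedEight q b) : RedEight (p * q) (a * b) := by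
  obtain ⟨n, d, rfl, hd, h⟩ := hp
  obtain ⟨m, e, rfl, he, h'⟩ := hq
  refine ⟨n * m, d * e, by push_cast; ring, by push_cast; rw [hd, he]; ring, ?_⟩
  push_cast
  linear_combination (q * e) * h + n * h'

theorem neg (hp : RedEight p a) : RedEight (-p) (-a) := by
  obtain ⟨n, d, rfl, hd, h⟩ := hp
  refine ⟨-n, d, by push_cast; ring, hd, ?_⟩
  push_cast
  linear_combination -h

theorem sub (hp : RedEight p a) (hq : RedEight q b) : RedEight (p - q) (a - b) := by
  rw [sub_eq_add_neg, sub_eq_add_neg]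
  exact hp.add hq.neg

theorem pow (hp : RedEight p a) (n : ℕ) : RedEight (p ^ n) (a ^ n) := by
  induction n with
  | zero => exact ⟨1, 1, by simp, by simp, by simp⟩
  | succ n ih => rw [pow_succ, pow_succ]; exact ih.mul hp

theorem intCast (n : ℤ) : RedEight n n := ⟨n, 1, rfl, by simp, by simp⟩

theorem ofNat (n : ℕ) [n.AtLeastTwo] : RedEight (OfNat.ofNat n) (OfNat.ofNat n) :=
  ⟨OfNat.ofNat n, 1, by simp, by simp, by simp⟩

theorem one : RedEight 1 1 := ⟨1, 1, by simp, by simp, by simp⟩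

theorem ne_zero (hp : RedEight p a) (ha : a ≠ 0) : p ≠ 0 := by
  rintro rfl
  obtain ⟨n, d, rfl, -, h⟩ := hp
  apply ha
  have : n = 0 := by
    rw [zero_mul] at h
    exact_mod_cast h.symm
  simp [this]

theorem div (hp : RedEight p a) (hq : RedEight q b) (hb : b * b = 1) :
    RedEight (p / q) (a * b) := by
  have hq0 : q ≠ 0 := hq.ne_zero (by rintro rfl; exact absurd hb (by decide))
  obtain ⟨n, d, rfl, hd, h⟩ := hp
  obtain ⟨m, e, rfl, he, h'⟩ := hq
  refine ⟨n * m * e, d * m * m, by push_cast; rw [he]; ring,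
    by push_cast; rw [mul_assoc, hb, hd, one_mul], ?_⟩
  push_cast
  field_simp
  linear_combination (m : ℚ) ^ 2 * h - n * m * h'

theorem congr (hp : RedEight p a) (h : a = b) : RedEight p b := h ▸ hp

theorem exists_of_sq (hp : RedEight (p ^ 2) a) : ∃ b, RedEight p b ∧ b ^ 2 = a := by
  obtain ⟨n, d, rfl, hd, h⟩ := hp
  have hi : IsIntegral ℤ (p * d) := by
    refine ⟨X ^ 2 - C (n * d), monic_X_pow_sub_C _ (by norm_num), ?_⟩
    simp only [eval₂_sub, eval₂_pow, eval₂_X, eval₂_C]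
    push_cast [eq_intCast]
    linear_combination (d : ℚ) * h
  obtain ⟨m, hm⟩ := IsIntegrallyClosed.isIntegral_iff.1 hi
  rw [eq_intCast] at hm
  refine ⟨m, ⟨m, d, rfl, hd, hm.symm⟩, ?_⟩
  have : m ^ 2 = n * d := by
    rw [← Int.cast_inj (α := ℚ)]
    push_cast
    rw [hm]
    linear_combination (d : ℚ) * h
  have := congrArg (Int.cast : ℤ → ZMod 8) this
  push_cast at this
  rw [this, hd, mul_one]

end RedEight

namespace IsMumford
variable {σ ρ β₁ β₀ : ℚ}

theorem neg (h : IsMumford σ ρ β₁ β₀) : IsMumford σ ρ (-β₁) (-β₀) :=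
  ⟨by linear_combination h.lin, by linear_combination h.const⟩

theorem of_forall (p : ℚ[X])
    (h : ∀ x : ℚ, 4 * x ^ 5 - 3 - (β₁ * x + β₀) ^ 2 = (x ^ 2 - σ * x + ρ) * p.eval x) :
    IsMumford σ ρ β₁ β₀ := by
  have hd : quad σ ρ ∣ C (4 * (σ ^ 4 - 3 * σ ^ 2 * ρ + ρ ^ 2) - 2 * β₀ * β₁ - β₁ ^ 2 * σ) * X +
      C (-4 * ρ * (σ ^ 3 - 2 * σ * ρ) - 3 - β₀ ^ 2 + β₁ ^ 2 * ρ) := by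
    refine ⟨p - (4 * X ^ 3 + C (4 * σ) * X ^ 2 + C (4 * (σ ^ 2 - ρ)) * X +
      C (4 * σ ^ 3 - 8 * σ * ρ - β₁ ^ 2)), Polynomial.funext fun x => ?_⟩
    simp only [quad, eval_add, eval_sub, eval_mul, eval_pow, eval_C, eval_X, eval_ofNat]
    linear_combination h x
  have h0 := Polynomial.eq_zero_of_dvd_of_natDegree_lt hd
    (lt_of_le_of_lt natDegree_linear_le (by rw [natDegree_quad]; norm_num))
  have h₀ := congrArg (eval 0) h0
  have h₁ := congrArg (eval 1) h0
  simp only [eval_add, eval_mul, eval_C, eval_X, eval_zero, mul_zero, mul_one, zero_add] at h₀ h₁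
  exact ⟨by linear_combination h₀ - h₁, by linear_combination -h₀⟩

/-- Subtraction of the divisor cut out by `x ^ 2 + 1` and `y = 1 + 2 x`. -/
theorem add_torsion (h : IsMumford σ ρ β₁ β₀) {h₁ h₀ σ' ρ' : ℚ}
    (e₁ : (ρ - 1) * h₁ - σ * h₀ + 2 + β₁ = 0) (e₀ : (ρ - 1) * h₀ + σ * h₁ + 1 + β₀ = 0)
    (hD : (ρ - 1) ^ 2 + σ ^ 2 ≠ 0) (hσ : σ' * h₁ ^ 2 = 4 - 2 * h₀ * h₁ + σ * h₁ ^ 2)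
    (hρ : ρ' * h₁ ^ 2 =
      -(4 * σ - 2 * β₁ * h₁ - h₀ ^ 2 + 2 * σ * h₀ * h₁ - ρ * h₁ ^ 2) - h₁ ^ 2) :
    IsMumford σ' ρ' (-(β₁ + (σ' - σ) * h₀ + (ρ - ρ') * h₁ + (σ' - σ) * h₁ * σ'))
      (-(β₀ + (ρ - ρ') * h₀ - ρ' * (σ' - σ) * h₁)) := by
  have hu : 4 * (σ ^ 2 - ρ) - 2 * (β₁ * h₀ + β₀ * h₁) + σ * h₀ ^ 2 - 2 * ρ * h₀ * h₁ =
      4 - 2 * h₀ * h₁ + σ * h₁ ^ 2 := by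
    apply mul_left_cancel₀ hD
    linear_combination (ρ - 1) * (h.lin + (-2 * ((ρ - 1) * h₀ + σ * h₁ + 1 + β₀) + 2) * e₁ +
      4 * e₀) + σ * (h.const + (-((ρ - 1) * h₀ + σ * h₁ + 1 + β₀) + 2) * e₀ +
      ((ρ - 1) * h₁ - σ * h₀ + 2 + β₁ - 4) * e₁)
  have hv : 4 * σ ^ 3 - 8 * σ * ρ - β₁ ^ 2 - 2 * β₀ * h₀ - ρ * h₀ ^ 2 =
      4 * σ - 2 * β₁ * h₁ - h₀ ^ 2 + 2 * σ * h₀ * h₁ - ρ * h₁ ^ 2 + h₁ ^ 2 := by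
    apply mul_left_cancel₀ hD
    linear_combination (-σ) * (h.lin + (-2 * ((ρ - 1) * h₀ + σ * h₁ + 1 + β₀) + 2) * e₁ +
      4 * e₀) + (ρ - 1) * (h.const + (-((ρ - 1) * h₀ + σ * h₁ + 1 + β₀) + 2) * e₀ +
      ((ρ - 1) * h₁ - σ * h₀ + 2 + β₁ - 4) * e₁)
  refine of_forall (-(C h₁ ^ 2 * (X ^ 2 - C σ * X + C ρ) * (X ^ 2 + 1)) +
    2 * (C β₁ * X + C β₀ + (X ^ 2 - C σ * X + C ρ) * (C h₁ * X + C h₀)) *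
      (C h₁ * X + C h₀ + C (σ' - σ) * C h₁) -
    (X ^ 2 - C σ' * X + C ρ') * (C h₁ * X + C h₀ + C (σ' - σ) * C h₁) ^ 2) fun x => ?_
  simp only [eval_add, eval_sub, eval_mul, eval_pow, eval_C, eval_X, eval_ofNat, eval_neg, eval_one]
  linear_combination (-x) * h.lin - h.const + (x ^ 2 - σ * x + ρ) * (x * hu + hv - (x ^ 3 + x) * hσ +
    (x ^ 2 + 1) * hρ)

end IsMumford
end

noncomputable section

theorem two_dvd_iff_cast {n : ℤ} : 2 ∣ n ↔ 4 * (n : ZMod 8) = 0 := by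
  have : ((4 * n : ℤ) : ZMod 8) = 0 ↔ (8 : ℤ) ∣ 4 * n := ZMod.intCast_zmod_eq_zero_iff_dvd (4 * n) 8
  push_cast at this
  rw [this]
  omega

set_option synthInstance.maxHeartbeats 400000 in
set_option synthInstance.maxSize 1000 in
theorem delta_eq_mod_eight : ∀ a b c d : ZMod 8, kummer a b c d = 0 →
    delta₁ a b c d * 3 = delta₄ a b c d * 1 → delta₂ a b c d * 3 = delta₄ a b c d * 2 →
    delta₃ a b c d * 3 = delta₄ a b c d * 5 → ¬(4 * a = 0 ∧ 4 * b = 0 ∧ 4 * c = 0 ∧ 4 * d = 0) →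
    a = 4 ∧ b * b = 1 ∧ (c = b ∨ c = 5 * b) := by
  unfold kummer delta₁ delta₂ delta₃ delta₄
  decide +kernel

namespace IsKummerPoint
variable {K : Type*} [Field K] [NumberField K] {s : K} {k₁ k₂ k₃ k₄ : ℤ}

theorem hasRed (h : IsKummerPoint k₁ k₂ k₃ k₄) (hs : IsFifthRoot s) {a b c : ℤ} (t : ℚ)
    (ha : (a : ℚ) = 9 * k₁ ^ 2 * t ^ 2) (hb : (b : ℚ) = -3 * k₁ * k₂ * t ^ 2)
    (hc : (c : ℚ) = k₁ * k₃ * t ^ 2) :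
    HasRed s (vec s (k₃ / k₁) (1 / 2) 0 (-(k₂ / k₁) / 6) 0 * ((k₁ * t : ℚ) * s ^ 2) ^ 2)
      (redMod a 0 b 0 c) := by
  have h₁ : (k₁ : ℚ) ≠ 0 := by exact_mod_cast h.1
  have h2 : (k₁ : ℚ) * (k₂ / k₁) = k₂ := by field_simp
  have h3 : (k₁ : ℚ) * (k₃ / k₁) = k₃ := by field_simp
  have hg := hasRed_vec (s := s) a 0 b 0 c
  rw [ha, hb, hc, ← h2, ← h3] at hg
  convert hg using 1
  generalize (k₃ : ℚ) / k₁ = ρ at *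
  generalize (k₂ : ℚ) / k₁ = σ at *
  simp only [vec]
  push_cast
  linear_combination (k₁ : K) ^ 2 * t ^ 2 * (1 / 2 + -(σ : K) * s ^ 2 / 6) * hs.pow_five

theorem eq_false_of_cast_eq (h : IsKummerPoint k₁ k₂ k₃ k₄) (hs : IsFifthRoot s)
    (h₁ : (k₁ : ZMod 8) = 4) (h₂ : (k₂ : ZMod 8) * k₂ = 1)
    (h₃ : (k₃ : ZMod 8) = k₂ ∨ (k₃ : ZMod 8) = 5 * k₂) : False := by
  obtain ⟨m, rfl⟩ : 4 ∣ k₁ := by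
    have := (ZMod.intCast_eq_intCast_iff k₁ 4 8).1 (by exact_mod_cast h₁)
    have : k₁ % 8 = 4 % 8 := this
    omega
  have hm : ¬2 ∣ m := by
    rintro ⟨n, rfl⟩
    have : ((4 * (2 * n) : ℤ) : ZMod 8) = 0 := by
      push_cast
      rw [← mul_assoc, show (4 * 2 : ZMod 8) = 0 by decide, zero_mul]
    rw [this] at h₁
    exact absurd h₁ (by decide)
  have hm := cast_sq_eq_one hm
  have hg := h.hasRed hs (a := 36 * m ^ 2) (b := -3 * m * k₂) (c := m * k₃) (1 / 2)
    (by push_cast; ring) (by push_cast; ring) (by push_cast; ring)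
  obtain ⟨i, j, k, hijk, -⟩ := h.exists_isSquareMod hs hg
  have hc : ∀ a b : ℤ, (a : ZMod 8) = b → a ≡ b [ZMOD 8] := fun a b =>
    (ZMod.intCast_eq_intCast_iff a b 8).1
  obtain ⟨n, hn, hn'⟩ : ∃ n : ZMod 8, n = m * k₂ ∧ n * n = 1 :=
    ⟨_, rfl, by linear_combination (k₂ : ZMod 8) ^ 2 * hm + h₂⟩
  have key : ∃ b c : ℤ, -3 * m * k₂ ≡ b [ZMOD 8] ∧ m * k₃ ≡ c [ZMOD 8] ∧
      (b, c) ∈ [((1 : ℤ), (5 : ℤ)), (1, 1), (3, 7), (3, 3), (5, 1), (5, 5), (7, 3), (7, 7)] := by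
    have hb : ((-3 * m * k₂ : ℤ) : ZMod 8) = -3 * n := by rw [hn]; push_cast; ring
    have hc' : ((m * k₃ : ℤ) : ZMod 8) = n ∨ ((m * k₃ : ℤ) : ZMod 8) = 5 * n := by
      rcases h₃ with h₃ | h₃
      · left; rw [hn]; push_cast; rw [h₃]
      · right; rw [hn]; push_cast; rw [h₃]; ring
    have hcases : ∀ n b c : ZMod 8, n * n = 1 → b = -3 * n → (c = n ∨ c = 5 * n) →
        ∃ p ∈ [((1 : ℤ), (5 : ℤ)), (1, 1), (3, 7), (3, 3), (5, 1), (5, 5), (7, 3), (7, 7)],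
          b = (p.1 : ZMod 8) ∧ c = (p.2 : ZMod 8) := by decide
    obtain ⟨⟨b, c⟩, hp, e, f⟩ := hcases n _ _ hn' hb hc'
    exact ⟨b, c, hc _ _ e, hc _ _ f, hp⟩
  obtain ⟨b, c, hb, hc', hbc⟩ := key
  rw [redMod_congr (hc (36 * m ^ 2) 4 (by
    push_cast; rw [pow_two, hm]; decide)) rfl hb rfl hc'] at hijk
  revert i j k
  simp only [List.mem_cons, Prod.mk.injEq, List.not_mem_nil, or_false] at hbc
  rcases hbc with ⟨rfl, rfl⟩ | ⟨rfl, rfl⟩ | ⟨rfl, rfl⟩ | ⟨rfl, rfl⟩ | ⟨rfl, rfl⟩ | ⟨rfl, rfl⟩ |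
    ⟨rfl, rfl⟩ | ⟨rfl, rfl⟩ <;> decide +kernel

theorem eq_false_of_cast_eq' (h : IsKummerPoint k₁ k₂ k₃ k₄) (hs : IsFifthRoot s)
    (h₁ : (k₁ : ZMod 8) = 1) (h₂ : (k₂ : ZMod 8) = 2) (h₃ : (k₃ : ZMod 8) = 5)
    (h₄ : (k₄ : ZMod 8) = 3) : False := by
  have hg := h.hasRed hs (a := 9 * k₁ ^ 2) (b := -3 * k₁ * k₂) (c := k₁ * k₃) 1
    (by push_cast; ring) (by push_cast; ring) (by push_cast; ring)
  have hc : ∀ a b : ℤ, (a : ZMod 8) = b → a ≡ b [ZMOD 8] := fun a b =>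
    (ZMod.intCast_eq_intCast_iff a b 8).1
  rw [redMod_congr (hc (9 * k₁ ^ 2) 1 (by push_cast; rw [h₁]; decide)) rfl
    (hc (-3 * k₁ * k₂) 2 (by push_cast; rw [h₁, h₂]; decide)) rfl
    (hc (k₁ * k₃) 5 (by push_cast; rw [h₁, h₃]; decide))] at hg
  have hd : k₂ ^ 2 ≠ 4 * k₁ * k₃ := by
    have hm : k₁ % 8 = 1 % 8 := hc k₁ 1 (by rw [h₁]; decide)
    have hm₂ : k₂ % 8 = 2 % 8 := hc k₂ 2 (by rw [h₂]; decide)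
    have hm₃ : k₃ % 8 = 5 % 8 := hc k₃ 5 (by rw [h₃]; decide)
    obtain ⟨a, rfl⟩ : ∃ a, k₁ = 8 * a + 1 := ⟨k₁ / 8, by omega⟩
    obtain ⟨b, rfl⟩ : ∃ b, k₂ = 8 * b + 2 := ⟨k₂ / 8, by omega⟩
    obtain ⟨c, rfl⟩ : ∃ c, k₃ = 8 * c + 5 := ⟨k₃ / 8, by omega⟩
    intro hd
    ring_nf at hd
    omega
  obtain ⟨x₁, x₂, x₃, x₄, hx, hxk⟩ := h.exists_isHalf hs hd hg (by decide +kernel)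
  have e₀ := congrArg (Int.cast : ℤ → ZMod 8) hxk.kummer_eq
  have e₁ := congrArg (Int.cast : ℤ → ZMod 8) hxk.eq₁
  have e₂ := congrArg (Int.cast : ℤ → ZMod 8) hxk.eq₂
  have e₃ := congrArg (Int.cast : ℤ → ZMod 8) hxk.eq₃
  have e₄ := hxk.primitive
  simp only [two_dvd_iff_cast] at e₄
  have c₀ : ((kummer x₁ x₂ x₃ x₄ : ℤ) : ZMod 8) = kummer (x₁ : ZMod 8) x₂ x₃ x₄ := by
    simp [kummer]
  have c₁ : ((delta₁ x₁ x₂ x₃ x₄ : ℤ) : ZMod 8) = delta₁ (x₁ : ZMod 8) x₂ x₃ x₄ := by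
    simp [delta₁]
  have c₂ : ((delta₂ x₁ x₂ x₃ x₄ : ℤ) : ZMod 8) = delta₂ (x₁ : ZMod 8) x₂ x₃ x₄ := by
    simp [delta₂]
  have c₃ : ((delta₃ x₁ x₂ x₃ x₄ : ℤ) : ZMod 8) = delta₃ (x₁ : ZMod 8) x₂ x₃ x₄ := by
    simp [delta₃]
  have c₄ : ((delta₄ x₁ x₂ x₃ x₄ : ℤ) : ZMod 8) = delta₄ (x₁ : ZMod 8) x₂ x₃ x₄ := by
    simp [delta₄]
  rw [c₀, Int.cast_zero] at e₀
  rw [Int.cast_mul, Int.cast_mul, c₁, c₄, h₁, h₄] at e₁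
  rw [Int.cast_mul, Int.cast_mul, c₂, c₄, h₂, h₄] at e₂
  rw [Int.cast_mul, Int.cast_mul, c₃, c₄, h₃, h₄] at e₃
  obtain ⟨f₁, f₂, f₃⟩ := delta_eq_mod_eight _ _ _ _ e₀ e₁ e₂ e₃ e₄
  exact hx.eq_false_of_cast_eq hs f₁ f₂ f₃

end IsKummerPoint
end

noncomputable section

namespace RedEight
variable {q : ℚ} {a b : ZMod 8}

theorem unique (h : RedEight q a) (h' : RedEight q b) : a = b := by
  obtain ⟨n, d, rfl, hd, h⟩ := h
  obtain ⟨m, e, rfl, he, h'⟩ := h'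
  have : n * e = m * d := by
    rw [← Int.cast_inj (α := ℚ)]
    push_cast
    rw [← h, ← h']
    ring
  have := congrArg (Int.cast : ℤ → ZMod 8) this
  push_cast at this
  rwa [hd, he, mul_one, mul_one] at this

theorem sq_div_four (h : RedEight q 2) : RedEight (q ^ 2 / 4) 1 := by
  obtain ⟨n, d, hn, hd, h⟩ := h
  have hn' : n % 8 = 2 % 8 := (ZMod.intCast_eq_intCast_iff n 2 8).1 (by exact_mod_cast hn)
  obtain ⟨m, rfl⟩ : ∃ m, n = 2 * m := ⟨n / 2, by omega⟩
  refine ⟨m * m, d * d, ?_, by push_cast; rw [hd, mul_one], ?_⟩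
  · push_cast
    exact cast_sq_eq_one (by omega)
  · push_cast at h ⊢
    linear_combination (q * d / 4 + m / 2) * h

end RedEight

namespace IsMumford
variable {K : Type*} [Field K] [NumberField K] {s : K} {σ ρ β₁ β₀ : ℚ}

theorem eq_false_of_redEight' (h : IsMumford σ ρ β₁ β₀) (hs : IsFifthRoot s) (hσ : RedEight σ 2)
    (hρ : RedEight ρ 5) (hβ : RedEight β₁ 2) : False := by
  have hκ : RedEight (kappa σ ρ β₁) 3 := by
    rw [show kappa σ ρ β₁ = β₁ ^ 2 / 4 - σ ^ 3 + σ * ρ by rw [kappa]; ring]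
    exact ((hβ.sq_div_four.sub (hσ.pow 3)).add (hσ.mul hρ)).congr (by decide)
  obtain ⟨n₂, d₂, hn₂, hd₂, h₂⟩ := hσ
  obtain ⟨n₃, d₃, hn₃, hd₃, h₃⟩ := hρ
  obtain ⟨n₄, d₄, hn₄, hd₄, h₄⟩ := hκ
  have hk : IsKummerPoint (d₂ * d₃ * d₄) (n₂ * d₃ * d₄) (d₂ * n₃ * d₄) (d₂ * d₃ * n₄) := by
    refine ⟨?_, σ, ρ, β₁, β₀, h, ?_, ?_, ?_⟩
    · have h0 : ∀ d : ℤ, (d : ZMod 8) = 1 → d ≠ 0 := by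
        rintro d hd rfl
        exact absurd hd (by decide)
      exact mul_ne_zero (mul_ne_zero (h0 _ hd₂) (h0 _ hd₃)) (h0 _ hd₄)
    · push_cast; rw [← h₂]; ring
    · push_cast; rw [← h₃]; ring
    · push_cast; rw [← h₄]; ring
  refine hk.eq_false_of_cast_eq' hs ?_ ?_ ?_ ?_
  all_goals
    push_cast
    simp only [hd₂, hd₃, hd₄, hn₂, hn₃, hn₄]
    decide

theorem eq_false_of_redEight (h : IsMumford σ ρ β₁ β₀) (hs : IsFifthRoot s) {a b : ZMod 8}
    (hσ : RedEight σ 2) (hρ : RedEight ρ 4) (hβ₁ : RedEight β₁ b) (hβ₀ : RedEight β₀ a)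
    (hb : 2 * b = 2) (ha : 2 * a = -2) : False := by
  have hp : RedEight (ρ - 1) 3 := (hρ.sub .one).congr (by decide)
  have hD : RedEight ((ρ - 1) ^ 2 + σ ^ 2) 5 := ((hp.pow 2).add (hσ.pow 2)).congr (by decide)
  have hD0 : (ρ - 1) ^ 2 + σ ^ 2 ≠ 0 := hD.ne_zero (by decide)
  obtain ⟨h₁, hh₁⟩ : ∃ x, x = ((-1 - β₀) * σ + (-2 - β₁) * (ρ - 1)) / ((ρ - 1) ^ 2 + σ ^ 2) :=
    ⟨_, rfl⟩
  obtain ⟨h₀, hh₀⟩ : ∃ x, x = ((-1 - β₀) * (ρ - 1) - (-2 - β₁) * σ) / ((ρ - 1) ^ 2 + σ ^ 2) :=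
    ⟨_, rfl⟩
  have r₁ := (((RedEight.one.neg.sub hβ₀).mul hσ).add
    (((RedEight.ofNat 2).neg.sub hβ₁).mul hp)).div hD (by decide)
  have r₀ := (((RedEight.one.neg.sub hβ₀).mul hp).sub
    (((RedEight.ofNat 2).neg.sub hβ₁).mul hσ)).div hD (by decide)
  rw [← hh₁] at r₁
  rw [← hh₀] at r₀
  have e₁ : (ρ - 1) * h₁ - σ * h₀ + 2 + β₁ = 0 := by rw [hh₁, hh₀]; field_simp; ring
  have e₀ : (ρ - 1) * h₀ + σ * h₁ + 1 + β₀ = 0 := by rw [hh₁, hh₀]; field_simp; ring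
  clear hh₁ hh₀
  obtain ⟨b₁, hb₁, q₁⟩ : ∃ b₁, b₁ = ((-1 - a) * 2 + (-2 - b) * 3) * 5 ∧ RedEight h₁ b₁ :=
    ⟨_, rfl, r₁⟩
  obtain ⟨b₀, hb₀, q₀⟩ : ∃ b₀, b₀ = ((-1 - a) * 3 - (-2 - b) * 2) * 5 ∧ RedEight h₀ b₀ :=
    ⟨_, rfl, r₀⟩
  obtain ⟨k₁, kσ, kρ, kβ⟩ : b₁ ^ 2 = 1 ∧ 4 - 2 * b₀ * b₁ + 2 * b₁ ^ 2 = 2 ∧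
      -(4 * 2 - 2 * b * b₁ - b₀ ^ 2 + 2 * 2 * b₀ * b₁ - 4 * b₁ ^ 2) - b₁ ^ 2 = 5 ∧
      -(b + (2 - 2) * b₀ + (4 - 5) * b₁ + (2 - 2) * b₁ * 2) = 2 := by
    clear r₁ r₀ q₁ q₀ hβ₁ hβ₀
    revert a b b₁ b₀
    decide
  have hn := (q₁.pow 2).congr k₁
  have hn0 : h₁ ^ 2 ≠ 0 := hn.ne_zero (by decide)
  have hσ' := (((((RedEight.ofNat 4).sub (((RedEight.ofNat 2).mul q₀).mul q₁)).add
    (hσ.mul (q₁.pow 2))).congr kσ).div hn (by decide)).congr (mul_one _)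
  have hρ' := (((((((((RedEight.ofNat 4).mul hσ).sub (((RedEight.ofNat 2).mul hβ₁).mul q₁)).sub
    (q₀.pow 2)).add ((((RedEight.ofNat 2).mul hσ).mul q₀).mul q₁)).sub
    (hρ.mul (q₁.pow 2))).neg.sub (q₁.pow 2)).congr kρ).div hn (by decide)).congr (mul_one _)
  obtain ⟨σ', eσ⟩ : ∃ x, x = (4 - 2 * h₀ * h₁ + σ * h₁ ^ 2) / h₁ ^ 2 := ⟨_, rfl⟩
  obtain ⟨ρ', eρ⟩ : ∃ x, x = (-(4 * σ - 2 * β₁ * h₁ - h₀ ^ 2 + 2 * σ * h₀ * h₁ - ρ * h₁ ^ 2) -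
    h₁ ^ 2) / h₁ ^ 2 := ⟨_, rfl⟩
  rw [← eσ] at hσ'
  rw [← eρ] at hρ'
  have hγ := ((((hβ₁.add ((hσ'.sub hσ).mul q₀)).add ((hρ.sub hρ').mul q₁)).add
    (((hσ'.sub hσ).mul q₁).mul hσ')).neg).congr kβ
  exact (h.add_torsion e₁ e₀ hD0 ((eq_div_iff hn0).1 eσ) ((eq_div_iff hn0).1 eρ)).eq_false_of_redEight'
    hs hσ' hρ' hγ

end IsMumford

theorem IsNear.eq_false_of_zero {K : Type*} [Field K] [NumberField K] {s : K} {u w z κ : ℤ}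
    (h : IsNear 0 u w z κ) (hs : IsFifthRoot s) : False := by
  obtain ⟨-, σ, ρ, β₁, β₀, hM, h₂, h₃, h₄⟩ := h.point
  have hu0 : (u : ℚ) ≠ 0 := by
    rintro h0
    have : u = 0 := by exact_mod_cast h0
    exact not_two_dvd_of_cast_eq_one h.u_eq (by simp [this])
  push_cast at h₂ h₃ h₄
  have hu : RedEight u 1 := (RedEight.intCast u).congr h.u_eq
  have hσ : RedEight σ 2 := by
    rw [show σ = (2 * w : ℤ) / u by push_cast; field_simp; linear_combination -h₂ / 4]
    exact ((RedEight.intCast _).div hu (by decide)).congr (by push_cast; rw [h.w_eq, mul_one])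
  have hρ : RedEight ρ 4 := by
    rw [show ρ = z / u by field_simp; linear_combination -h₃ / 4]
    exact ((RedEight.intCast _).div hu (by decide)).congr (by rw [h.z_eq]; decide)
  have hβ₁ : RedEight (β₁ ^ 2) 1 := by
    rw [show β₁ ^ 2 = κ / u + 4 * σ ^ 3 - 4 * σ * ρ by
      rw [kappa] at h₄; field_simp; linear_combination -h₄]
    exact ((((RedEight.intCast κ).div hu (by decide)).add ((RedEight.ofNat 4).mul (hσ.pow 3))).sub
      (((RedEight.ofNat 4).mul hσ).mul hρ)).congr (by rw [h.κ_eq]; decide)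
  have hβ₀ : RedEight (β₀ ^ 2) 1 := by
    rw [show β₀ ^ 2 = β₁ ^ 2 * ρ - 4 * ρ * (σ ^ 3 - 2 * σ * ρ) - 3 by
      linear_combination hM.const]
    exact (((hβ₁.mul hρ).sub (((RedEight.ofNat 4).mul hρ).mul ((hσ.pow 3).sub
      (((RedEight.ofNat 2).mul hσ).mul hρ)))).sub (RedEight.ofNat 3)).congr (by decide)
  obtain ⟨b, hb, hb1⟩ := hβ₁.exists_of_sq
  obtain ⟨a, ha, ha1⟩ := hβ₀.exists_of_sq
  have hl := (((RedEight.ofNat 2).mul ha).mul hb).add ((hb.pow 2).mul hσ)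
  rw [hM.lin] at hl
  have hab := hl.unique ((RedEight.ofNat 4).mul (((hσ.pow 4).sub
    (((RedEight.ofNat 3).mul (hσ.pow 2)).mul hρ)).add (hρ.pow 2)))
  have : ∀ a b : ZMod 8, b ^ 2 = 1 → a ^ 2 = 1 →
      2 * a * b + b ^ 2 * 2 = 4 * (2 ^ 4 - 3 * 2 ^ 2 * 4 + 4 ^ 2) →
      (2 * b = 2 ∧ 2 * a = -2) ∨ (2 * -b = 2 ∧ 2 * -a = -2) := by decide
  rcases this a b hb1 ha1 hab with ⟨h1, h2⟩ | ⟨h1, h2⟩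
  · exact hM.eq_false_of_redEight hs hσ hρ hb ha h1 h2
  · exact hM.neg.eq_false_of_redEight hs hσ hρ hb.neg ha.neg h1 h2

theorem IsNear.eq_false {K : Type*} [Field K] [NumberField K] {s : K} (hs : IsFifthRoot s) {j : ℕ}
    {u w z κ : ℤ} (h : IsNear j u w z κ) : False := by
  induction j generalizing u w z κ with
  | zero => exact h.eq_false_of_zero hs
  | succ j ih =>
    obtain ⟨u', w', z', κ', h'⟩ := h.descend hs
    exact ih h'
end

noncomputable section

namespace IsMumford
variable {σ ρ β₁ β₀ : ℚ}

theorem eq_false_of_near {K : Type*} [Field K] [NumberField K] {s : K} (hs : IsFifthRoot s)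
    (h : IsMumford σ ρ β₁ β₀) {j : ℕ} (hj : 2 ≤ j) (hσ : RedEight σ 2) (hρ : RedEight ρ 1)
    (hβ : RedEight (β₁ ^ 2 * 4 ^ j) 1) : False := by
  have h4 : ((4 : ℕ) : ZMod 8) ^ j = 0 := by
    obtain ⟨i, rfl⟩ := Nat.exists_eq_add_of_le hj
    rw [pow_add, show ((4 : ℕ) : ZMod 8) ^ 2 = 0 by decide, zero_mul]
  have hκ : RedEight (4 * 4 ^ j * kappa σ ρ β₁) 1 := by
    rw [show 4 * 4 ^ j * kappa σ ρ β₁ = β₁ ^ 2 * 4 ^ j - 4 * (4 ^ j * (σ ^ 3 - σ * ρ)) by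
      rw [kappa]; ring]
    refine (hβ.sub ((RedEight.ofNat 4).mul (((RedEight.ofNat 4).pow j).mul
      ((hσ.pow 3).sub (hσ.mul hρ))))).congr ?_
    rw [show (2 ^ 3 - 2 * 1 : ZMod 8) = 2 * 3 by decide, mul_left_comm, ← mul_assoc 4 2,
      show (4 * 2 : ZMod 8) = 0 by decide, zero_mul, mul_zero, sub_zero]
  obtain ⟨n₂, d₂, hn₂, hd₂, h₂⟩ := hσ
  obtain ⟨n₃, d₃, hn₃, hd₃, h₃⟩ := hρ
  obtain ⟨n₄, d₄, hn₄, hd₄, h₄⟩ := hκ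
  have hd : ∀ d : ℤ, (d : ZMod 8) = 1 → d ≠ 0 := by
    rintro d h rfl
    exact absurd h (by decide)
  obtain ⟨m, rfl⟩ : 2 ∣ n₂ := two_dvd_iff_cast.2 (by rw [hn₂]; decide)
  have hu : d₂ * d₃ * d₄ ≠ 0 := mul_ne_zero (mul_ne_zero (hd _ hd₂) (hd _ hd₃)) (hd _ hd₄)
  refine IsNear.eq_false hs (j := j) (u := d₂ * d₃ * d₄) (w := m * d₃ * d₄) (z := d₂ * n₃ * d₄)
    (κ := d₂ * d₃ * n₄) ⟨⟨mul_ne_zero (by positivity) hu, σ, ρ, β₁, β₀, h, ?_, ?_, ?_⟩, ?_, ?_, ?_, ?_⟩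
  · push_cast at h₂ ⊢
    linear_combination -4 * 4 ^ j * d₃ * d₄ * h₂
  · push_cast
    linear_combination -4 * 4 ^ j * d₂ * d₄ * h₃
  · push_cast
    linear_combination -(d₂ : ℚ) * d₃ * h₄
  · push_cast
    rw [hd₂, hd₃, hd₄]; rfl
  · push_cast at hn₂ ⊢
    rw [hd₃, hd₄, mul_one, mul_one, hn₂]
  · push_cast at h4 ⊢
    rw [hd₂, hn₃, hd₄, h4]; rfl
  · push_cast
    rw [hd₂, hd₃, hn₄]; rfl

/-- The case of a divisor given by its equations in the coordinate `z = X / x - 1`. -/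
theorem of_shift {x y S R b₁ b₀ : ℚ} (hx : x ≠ 0) (hxy : y ^ 2 = 4 * x ^ 5 - 3)
    (hlin : 4 * x ^ 5 * (5 + 10 * S + 10 * (S ^ 2 - R) + 5 * (S ^ 3 - 2 * S * R) +
      (S ^ 4 - 3 * S ^ 2 * R + R ^ 2)) = 2 * b₀ * b₁ + b₁ ^ 2 * S)
    (hconst : y ^ 2 - 4 * x ^ 5 * R * (10 + 10 * S + 5 * (S ^ 2 - R) + (S ^ 3 - 2 * S * R)) =
      b₀ ^ 2 - b₁ ^ 2 * R) :
    IsMumford (x * (2 + S)) (x ^ 2 * (1 + S + R)) (b₁ / x) (b₀ - b₁) := by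
  constructor
  · apply mul_left_cancel₀ hx
    field_simp
    linear_combination -hlin
  · field_simp
    linear_combination -hconst + hxy + hlin

theorem quintuple {x y q w g r b c : ℚ} (hx : x ≠ 0) (hxy : y ^ 2 = 4 * x ^ 5 - 3)
    (hq : q = x ^ 5 + 3) (hq0 : q ≠ 0) (hw : w = q ^ 2 + 75 * q - 225) (hw0 : w ≠ 0)
    (hy0 : y ≠ 0)
    (hg : g = -119 * q ^ 6 - 36015 * q ^ 5 + 418500 * q ^ 4 - 1434375 * q ^ 3 + 8353125 * q -
      11390625)
    (hr : r = 14 * q ^ 4 + 7140 * q ^ 3 - 73350 * q ^ 2 + 256500 * q - 303750)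
    (hb : b = -89 * q ^ 12 - 594180 * q ^ 11 + 132941475 * q ^ 10 - 5132227500 * q ^ 9 +
      90734175000 * q ^ 8 - 946255668750 * q ^ 7 + 6488396156250 * q ^ 6 - 30732988359375 * q ^ 5 +
      102041490234375 * q ^ 4 - 234312275390625 * q ^ 3 + 355216640625000 * q ^ 2 -
      320040966796875 * q + 129746337890625)
    (hc : c = -12 * q ^ 10 - 106540 * q ^ 9 + 20927100 * q ^ 8 - 584064000 * q ^ 7 +
      7121975625 * q ^ 6 - 48112734375 * q ^ 5 + 196419937500 * q ^ 4 - 494751796875 * q ^ 3 +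
      744946875000 * q ^ 2 - 602279296875 * q + 192216796875) :
    ∃ β₁ β₀, IsMumford (x * (2 + q * g / (w ^ 2 * y ^ 6)))
      (x ^ 2 * (1 + q * g / (w ^ 2 * y ^ 6) + q ^ 2 * r / (w ^ 2 * y ^ 4))) β₁ β₀ ∧
      β₁ = 2 * b / (5 * q * w ^ 3 * y ^ 9 * x) := by
  obtain ⟨p, hp⟩ : ∃ p, p = 4 * q - 15 := ⟨_, rfl⟩
  have hyp : y ^ 2 = p := by linear_combination hxy - hp - 4 * hq
  have hp0 : p ≠ 0 := by rw [← hyp]; exact pow_ne_zero 2 hy0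
  have e : q * g / (w ^ 2 * y ^ 6) = q * g / (w ^ 2 * p ^ 3) := by rw [← hyp]; ring
  have e' : q ^ 2 * r / (w ^ 2 * y ^ 4) = q ^ 2 * r / (w ^ 2 * p ^ 2) := by rw [← hyp]; ring
  rw [e, e']
  refine ⟨y * (2 * b / (5 * q * w ^ 3 * p ^ 5)) / x, y * (3 * c / (5 * w ^ 3 * p ^ 4)) -
    y * (2 * b / (5 * q * w ^ 3 * p ^ 5)), of_shift hx hxy ?_ ?_, ?_⟩
  · rw [show 4 * x ^ 5 = 4 * (q - 3) by rw [hq]; ring, show ∀ u v : ℚ, 2 * (y * u) * (y * v) =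
      p * (2 * u * v) by intro u v; rw [← hyp]; ring, mul_pow, hyp]
    field_simp
    subst hg hr hb hc hp
    subst hw
    ring
  · rw [show 4 * x ^ 5 = 4 * (q - 3) by rw [hq]; ring, mul_pow, mul_pow, hyp]
    field_simp
    subst hg hr hb hc hp
    subst hw
    ring
  · rw [← hyp]
    field_simp

end IsMumford
end

noncomputable section

namespace RedEight
variable {p : ℚ} {a : ZMod 8}

theorem exists_eq_two_pow_mul (h : RedEight p 0) (hp : p ≠ 0) :
    ∃ (m : ℕ) (u : ℚ), 3 ≤ m ∧ p = 2 ^ m * u ∧ RedEight (u ^ 2) 1 := by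
  obtain ⟨n, d, hn, hd, e⟩ := h
  have hd0 : d ≠ 0 := by
    rintro rfl
    exact absurd hd (by decide)
  have hdq : (d : ℚ) ≠ 0 := by exact_mod_cast hd0
  have hn0 : n ≠ 0 := by
    rintro rfl
    exact mul_ne_zero hp hdq (by rw [e, Int.cast_zero])
  obtain ⟨k, hk, hk2⟩ :=
    (Int.finiteMultiplicity_iff (a := 2).2 ⟨by decide, hn0⟩).exists_eq_pow_mul_and_not_dvd
  generalize multiplicity 2 n = m at hk
  subst hk
  refine ⟨m, k / d, ?_, ?_, ⟨k ^ 2, d ^ 2, ?_, ?_, ?_⟩⟩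
  · by_contra! hm
    have h8 : (8 : ℤ) ∣ 2 ^ m * k := (ZMod.intCast_zmod_eq_zero_iff_dvd _ 8).1 hn
    interval_cases m <;> omega
  · push_cast at e
    field_simp
    exact e
  · push_cast
    rw [pow_two, cast_sq_eq_one hk2]
  · push_cast
    rw [hd, one_pow]
  · push_cast
    field_simp

theorem of_eq {q : ℚ} (h : RedEight p a) (e : p = q) : RedEight q a := e ▸ h

theorem aeval_of_zero (h : RedEight p 0) (P : ℤ[X]) :
    RedEight (aeval p P) ((P.eval 0 : ℤ) : ZMod 8) := by
  induction P using Polynomial.induction_on' with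
  | add P Q hP hQ => rw [map_add, eval_add, Int.cast_add]; exact hP.add hQ
  | monomial n c =>
    rw [aeval_monomial, eval_monomial]
    refine ((RedEight.intCast c).mul (h.pow n)).congr ?_
    push_cast
    rfl

end RedEight

section
variable {K : Type*} [Field K] [NumberField K] {s : K} {x y : ℚ}

theorem aeval_C_sub_X (s : K) (x : ℚ) : aeval (theta s) (C x - X) = vec s x 0 0 (-1 / 6) 0 := by
  simp only [theta, vec, map_sub, aeval_X, aeval_C, eq_ratCast]
  push_cast
  ring

theorem IsFifthRoot.exists_isSquareMod_point (h : IsFifthRoot s) (hxy : y ^ 2 = 4 * x ^ 5 - 3)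
    {g : K} {r : ℕ × ℕ × ℕ × ℕ × ℕ} (hg : HasRed s (vec s x 0 0 (-1 / 6) 0 * g ^ 2) r) :
    ∃ i j k : Fin 2, isSquareMod (mulMod r (selmerRed i j k)) = true ∧
      (i = 0 → j = 0 → k = 0 → IsSquare (aeval (theta s) (C x - X))) := by
  rw [← aeval_C_sub_X] at hg
  have hdeg : (C x - X : ℚ[X]).natDegree = 1 := by compute_degree!
  refine h.exists_isSquareMod (b := C y) (by omega) (c := -4 * (X ^ 4 + C x * X ^ 3 +
    C x ^ 2 * X ^ 2 + C x ^ 3 * X + C x ^ 4)) ?_ ?_ ?_ hg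
  · have := congrArg (C : ℚ → ℚ[X]) hxy
    simp only [map_sub, map_mul, map_pow, map_ofNat] at this
    linear_combination -this
  · rw [aeval_C_sub_X]
    intro h0
    have : vec s x 0 0 (-1 / 6) 0 = vec s 0 0 0 0 0 := by rw [h0]; simp [vec]
    have := (h.vec_inj this).2.2.2.1
    norm_num at this
  · refine ⟨y / 2, ?_⟩
    rw [aeval_C_sub_X, h.norm_vec]
    linear_combination -hxy / 4

theorem IsFifthRoot.not_redEight_three (h : IsFifthRoot s) (hxy : y ^ 2 = 4 * x ^ 5 - 3) {a : ℤ}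
    (ha : a = 3 ∨ a = 7) (hx : RedEight x (a : ZMod 8)) : False := by
  obtain ⟨n, d, hn, hd, e⟩ := hx
  have hg := hasRed_vec (s := s) (-3 * d ^ 2) 0 (n * d) 0 0
  have hc : ∀ a b : ℤ, (a : ZMod 8) = b → a ≡ b [ZMOD 8] := fun a b =>
    (ZMod.intCast_eq_intCast_iff a b 8).1
  rw [redMod_congr (hc _ (-3) (by push_cast; rw [hd]; rfl)) rfl
    (hc _ a (by push_cast; rw [hd, hn, mul_one])) rfl rfl] at hg
  have e' : vec s (-3 * d ^ 2 : ℤ) (0 : ℤ) (n * d : ℤ) (0 : ℤ) (0 : ℤ) =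
      vec s x 0 0 (-1 / 6) 0 * (d * s) ^ 2 := by
    have e := congrArg (Rat.cast : ℚ → K) e
    simp only [vec]
    push_cast at *
    linear_combination (d : K) ^ 2 / 6 * h.pow_five - d * s ^ 2 * e
  rw [e'] at hg
  obtain ⟨i, j, k, hijk, -⟩ := h.exists_isSquareMod_point hxy hg
  revert i j k
  rcases ha with rfl | rfl <;> decide +kernel

theorem IsFifthRoot.eq_one_of_redEight_one (h : IsFifthRoot s) (hxy : y ^ 2 = 4 * x ^ 5 - 3)
    (hx : RedEight x 1) : x = 1 := by
  wlog hy : ∃ b, RedEight y b ∧ (b = 1 ∨ b = 5) generalizing y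
  · have hb := (((RedEight.ofNat 4).mul (hx.pow 5)).sub (RedEight.ofNat 3)).congr
      (show _ = (1 : ZMod 8) by decide)
    rw [← hxy] at hb
    obtain ⟨b, hb, hb1⟩ := hb.exists_of_sq
    have hb' : ∀ b : ZMod 8, b ^ 2 = 1 → (b = 1 ∨ b = 5) ∨ (-b = 1 ∨ -b = 5) := by decide
    rcases hb' b hb1 with hb' | hb'
    · exact this hxy ⟨b, hb, hb'⟩
    · exact this (y := -y) (by rw [neg_sq, hxy]) ⟨-b, hb.neg, hb'⟩
  by_contra hx1
  have hx1 : x - 1 ≠ 0 := sub_ne_zero.2 hx1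
  obtain ⟨m, u, hm, hu, hu2⟩ :=
    ((hx.sub RedEight.one).congr (sub_self _)).exists_eq_two_pow_mul hx1
  have hu0 : u ≠ 0 := by
    rintro rfl
    exact hx1 (by rw [hu, mul_zero])
  obtain ⟨b, hb, hb'⟩ := hy
  have hy1 : RedEight (((y + 1) / 2) ^ 2) 1 := by
    rw [div_pow, show (2 : ℚ) ^ 2 = 4 by norm_num]
    have hb1 := hb.add RedEight.one
    rcases hb' with rfl | rfl
    · exact (hb1.congr (by decide)).sq_div_four
    · rw [← neg_sq]
      exact (hb1.neg.congr (by decide)).sq_div_four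
  have hM : IsMumford (1 + x) x ((y + 1) / (x - 1)) (-1 - (y + 1) / (x - 1)) := by
    constructor
    · field_simp
      linear_combination (x - 1) * hxy
    · field_simp
      linear_combination -(x - 1) * hxy
  obtain ⟨j, rfl⟩ := Nat.exists_eq_add_of_le' (show 1 ≤ m by omega)
  refine hM.eq_false_of_near h (j := j) (by omega) (RedEight.one.add hx) hx ?_
  rw [hu, show (4 : ℚ) ^ j = (2 ^ j) ^ 2 by rw [← pow_mul, mul_comm, pow_mul]; norm_num]
  rw [show ((y + 1) / (2 ^ (j + 1) * u)) ^ 2 * (2 ^ j) ^ 2 = ((y + 1) / 2) ^ 2 / u ^ 2 by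
    field_simp; ring]
  exact hy1.div hu2 (mul_one 1)

theorem IsFifthRoot.not_redEight_five (h : IsFifthRoot s) (hxy : y ^ 2 = 4 * x ^ 5 - 3)
    (hx : RedEight x 5) : False := by
  obtain ⟨b, hb, hb1⟩ := RedEight.exists_of_sq (p := y) (a := 1) (by
    rw [hxy]
    exact (((RedEight.ofNat 4).mul (hx.pow 5)).sub (RedEight.ofNat 3)).congr (by decide))
  have hx0 := hx.ne_zero (by decide)
  have hy0 := hb.ne_zero (by rintro rfl; exact absurd hb1 (by decide))
  obtain ⟨q, hq⟩ : ∃ q, q = x ^ 5 + 3 := ⟨_, rfl⟩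
  have hqr : RedEight q 0 := by
    rw [hq]
    exact ((hx.pow 5).add (RedEight.ofNat 3)).congr (by decide)
  have hq0 : q ≠ 0 := by
    rintro rfl
    nlinarith [sq_nonneg y]
  obtain ⟨w, hw⟩ : ∃ w, w = q ^ 2 + 75 * q - 225 := ⟨_, rfl⟩
  obtain ⟨g, hg⟩ : ∃ g, g = -119 * q ^ 6 - 36015 * q ^ 5 + 418500 * q ^ 4 - 1434375 * q ^ 3 +
    8353125 * q - 11390625 := ⟨_, rfl⟩
  obtain ⟨r, hr⟩ : ∃ r, r = 14 * q ^ 4 + 7140 * q ^ 3 - 73350 * q ^ 2 + 256500 * q - 303750 :=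
    ⟨_, rfl⟩
  obtain ⟨c, hc⟩ : ∃ c, c = -89 * q ^ 12 - 594180 * q ^ 11 + 132941475 * q ^ 10 -
    5132227500 * q ^ 9 + 90734175000 * q ^ 8 - 946255668750 * q ^ 7 + 6488396156250 * q ^ 6 -
    30732988359375 * q ^ 5 + 102041490234375 * q ^ 4 - 234312275390625 * q ^ 3 +
    355216640625000 * q ^ 2 - 320040966796875 * q + 129746337890625 := ⟨_, rfl⟩
  have hwr : RedEight w 7 := by
    refine ((hqr.aeval_of_zero (X ^ 2 + 75 * X - 225)).congr ?_).of_eq ?_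
    · simp; rfl
    · simp [hw, map_ofNat]
  have hgr : RedEight g 7 := by
    refine ((hqr.aeval_of_zero (-119 * X ^ 6 - 36015 * X ^ 5 + 418500 * X ^ 4 - 1434375 * X ^ 3 +
      8353125 * X - 11390625)).congr ?_).of_eq ?_
    · simp; rfl
    · simp [hg, map_ofNat]
  have hrr : RedEight r 2 := by
    refine ((hqr.aeval_of_zero (14 * X ^ 4 + 7140 * X ^ 3 - 73350 * X ^ 2 + 256500 * X -
      303750)).congr ?_).of_eq ?_
    · simp; rfl
    · simp [hr, map_ofNat]
  have hcr : RedEight c 1 := by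
    refine ((hqr.aeval_of_zero (-89 * X ^ 12 - 594180 * X ^ 11 + 132941475 * X ^ 10 -
      5132227500 * X ^ 9 + 90734175000 * X ^ 8 - 946255668750 * X ^ 7 + 6488396156250 * X ^ 6 -
      30732988359375 * X ^ 5 + 102041490234375 * X ^ 4 - 234312275390625 * X ^ 3 +
      355216640625000 * X ^ 2 - 320040966796875 * X + 129746337890625)).congr ?_).of_eq ?_
    · simp; rfl
    · simp [hc, map_ofNat]
  have hw0 := hwr.ne_zero (by decide)
  obtain ⟨β₁, β₀, hM, hβ⟩ := IsMumford.quintuple hx0 hxy hq hq0 hw hw0 hy0 hg hr hc rfl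
  have hw2 := (hwr.pow 2).congr (show _ = (1 : ZMod 8) by decide)
  have hy2 : RedEight (y ^ 2) 1 := (hb.pow 2).congr hb1
  have hS : RedEight (q * g / (w ^ 2 * y ^ 6)) 0 := by
    rw [show y ^ 6 = (y ^ 2) ^ 3 by ring]
    exact ((hqr.mul hgr).div (hw2.mul (hy2.pow 3)) (by decide)).congr (by decide)
  have hR : RedEight (q ^ 2 * r / (w ^ 2 * y ^ 4)) 0 := by
    rw [show y ^ 4 = (y ^ 2) ^ 2 by ring]
    exact (((hqr.pow 2).mul hrr).div (hw2.mul (hy2.pow 2)) (by decide)).congr (by decide)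
  obtain ⟨m, u, hm, hu, hu2⟩ := hqr.exists_eq_two_pow_mul hq0
  have hu0 : u ≠ 0 := by
    rintro rfl
    exact hq0 (by rw [hu, mul_zero])
  obtain ⟨j, rfl⟩ := Nat.exists_eq_add_of_le' (show 1 ≤ m by omega)
  refine hM.eq_false_of_near h (j := j) (by omega)
    ((hx.mul ((RedEight.ofNat 2).add hS)).congr (by decide))
    (((hx.pow 2).mul ((RedEight.one.add hS).add hR)).congr (by decide)) ?_
  rw [hβ, show (4 : ℚ) ^ j = (2 ^ j) ^ 2 by rw [← pow_mul, mul_comm, pow_mul]; norm_num]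
  have e : (2 * c / (5 * q * w ^ 3 * y ^ 9 * x)) ^ 2 * (2 ^ j) ^ 2 =
      c ^ 2 / (25 * u ^ 2 * (w ^ 2) ^ 3 * (y ^ 2) ^ 9 * x ^ 2) := by
    rw [hu]
    field_simp
    ring
  rw [e]
  exact ((hcr.pow 2).div (((((RedEight.ofNat 25).mul hu2).mul (hw2.pow 3)).mul (hy2.pow 9)).mul
    (hx.pow 2)) (by decide)).congr (by decide)
end
end

noncomputable section

namespace IsHalf
variable {x₁ x₂ x₃ x₄ α β u κ : ℤ}

theorem exists_weighted_of_eq {A a : ℤ} (hA : A = 4 * a) (hA0 : A ≠ 0)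
    (hc : ∀ n, ¬2 ∣ n → IsCoprime A n) (hu : ¬2 ∣ u) (hκ : ¬2 ∣ κ) (hx₄ : ¬2 ∣ x₄) (h₁ : A ∣ x₁)
    (h₂ : A ∣ x₂) (h₃ : A ∣ x₃)
    (h : IsHalf x₁ x₂ x₃ x₄ (64 * A ^ 3 * α) (16 * A ^ 2 * β) (4 * A * u) κ) :
    ∃ z₁ z₂ z₃, x₁ = A ^ 3 * z₁ ∧ x₂ = A ^ 2 * z₂ ∧ x₃ = A * z₃ ∧ ¬2 ∣ z₁ ∧ ¬2 ∣ z₂ ∧ ¬2 ∣ z₃ := by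
  obtain ⟨y₁, rfl⟩ := h₁
  obtain ⟨y₂, rfl⟩ := h₂
  obtain ⟨y₃, rfl⟩ := h₃
  obtain ⟨-, e₁, e₂, e₃, -⟩ := h
  have ho : ∀ n : ℤ, ¬2 ∣ n ↔ Odd n := fun n => by rw [← even_iff_two_dvd, Int.not_even_iff_odd]
  simp only [ho] at *
  have hk := hc _ ((hx₄.pow (n := 3)).mul hκ)
  obtain ⟨z₂, rfl⟩ : A ∣ y₂ := by
    refine hk.dvd_of_dvd_mul_right
      ⟨4 * β * delta₄ (A * y₁) (A * y₂) (A * y₃) x₄ - κ * (y₃ ^ 2 * x₄ ^ 2 - 24 * a ^ 2 * y₂ ^ 3 * y₃ -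
        6 * A ^ 2 * y₁ * y₂ * y₃ ^ 2 - 6 * a * y₁ * y₂ ^ 2 * x₄ + 3 * A * y₁ ^ 2 * y₃ * x₄ +
        36 * a ^ 2 * y₁ ^ 4), ?_⟩
    apply mul_left_cancel₀ (mul_ne_zero four_ne_zero hA0)
    rw [delta₂] at e₂
    subst hA
    linear_combination e₂
  obtain ⟨z₁, rfl⟩ : A ^ 2 ∣ y₁ := by
    refine (hk.pow_left (m := 2)).dvd_of_dvd_mul_right
      ⟨16 * α * delta₄ (A * y₁) (A * (A * z₂)) (A * y₃) x₄ - κ * (-z₂ * y₃ * x₄ ^ 2 +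
        2 * y₃ ^ 3 * x₄ - 3 * a * A ^ 4 * z₂ ^ 4 + 3 * A ^ 3 * y₁ * z₂ ^ 2 * y₃ -
        3 * A * y₁ ^ 2 * y₃ ^ 2 + 6 * A * y₁ ^ 2 * z₂ * x₄), ?_⟩
    apply mul_left_cancel₀ (mul_ne_zero four_ne_zero hA0)
    rw [delta₁] at e₁
    subst hA
    linear_combination e₁
  refine ⟨z₁, z₂, y₃, by ring, by ring, rfl, ?_⟩
  have hy₃ : Odd y₃ := by
    have : y₃ * (x₄ ^ 3 * κ) = x₄ ^ 4 * u + 2 * (u * (3 * A ^ 5 * z₂ * y₃ ^ 3 +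
        6 * A ^ 5 * z₂ ^ 2 * y₃ * x₄ + 3 * A ^ 5 * z₁ * y₃ ^ 2 * x₄ - 3 * A ^ 5 * z₁ * z₂ * x₄ ^ 2 +
        18 * a * A ^ 9 * z₁ ^ 2 * z₂ ^ 2 + 9 * A ^ 10 * z₁ ^ 3 * y₃) - κ * (
        -18 * a ^ 2 * A ^ 3 * z₂ ^ 2 * y₃ ^ 2 + 3 * a * A ^ 4 * z₂ ^ 3 * x₄ +
        6 * a * A ^ 4 * z₁ * y₃ ^ 3 + 9 * a * A ^ 4 * z₁ * z₂ * y₃ * x₄ +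
        18 * a ^ 2 * A ^ 3 * z₁ ^ 2 * x₄ ^ 2 - 9 * a * A ^ 9 * z₁ ^ 3 * z₂)) := by
      apply mul_left_cancel₀ (mul_ne_zero four_ne_zero hA0)
      rw [delta₃, delta₄] at e₃
      subst hA
      linear_combination e₃
    suffices h : Odd (y₃ * (x₄ ^ 3 * κ)) from (Int.odd_mul.1 h).1
    rw [this]
    exact (((hx₄.pow (n := 4)).mul hu)).add_even (even_two_mul _)
  have hz₂ : Odd z₂ := by
    have : z₂ * (x₄ ^ 3 * κ) = y₃ ^ 2 * x₄ ^ 2 * κ + 2 * (2 * β *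
        delta₄ (A * (A ^ 2 * z₁)) (A * (A * z₂)) (A * y₃) x₄ - κ * (y₃ ^ 2 * x₄ ^ 2 -
        3 * a * A ^ 4 * z₂ ^ 3 * y₃ - 3 * A ^ 5 * z₁ * z₂ * y₃ ^ 2 - 3 * a * A ^ 4 * z₁ * z₂ ^ 2 * x₄ +
        6 * a * A ^ 4 * z₁ ^ 2 * y₃ * x₄ + 18 * a ^ 2 * A ^ 8 * z₁ ^ 4)) := by
      apply mul_left_cancel₀ (mul_ne_zero four_ne_zero (pow_ne_zero 2 hA0))
      rw [delta₂] at e₂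
      subst hA
      linear_combination e₂
    suffices h : Odd (z₂ * (x₄ ^ 3 * κ)) from (Int.odd_mul.1 h).1
    rw [this]
    exact (((hy₃.pow (n := 2)).mul (hx₄.pow (n := 2))).mul hκ).add_even (even_two_mul _)
  have hz₁ : Odd z₁ := by
    have : z₁ * (x₄ ^ 3 * κ) = z₂ * y₃ * x₄ ^ 2 * κ + 2 * (8 * α *
        delta₄ (A * (A ^ 2 * z₁)) (A * (A * z₂)) (A * y₃) x₄ - κ * (y₃ ^ 3 * x₄ -
        6 * a ^ 2 * A ^ 3 * z₂ ^ 4 + 6 * a * A ^ 4 * z₁ * z₂ ^ 2 * y₃ -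
        6 * a * A ^ 4 * z₁ ^ 2 * y₃ ^ 2 + 3 * A ^ 5 * z₁ ^ 2 * z₂ * x₄)) := by
      apply mul_left_cancel₀ (mul_ne_zero four_ne_zero (pow_ne_zero 3 hA0))
      rw [delta₁] at e₁
      subst hA
      linear_combination e₁
    suffices h : Odd (z₁ * (x₄ ^ 3 * κ)) from (Int.odd_mul.1 h).1
    rw [this]
    exact (((hz₂.mul hy₃).mul (hx₄.pow (n := 2))).mul hκ).add_even (even_two_mul _)
  exact ⟨hz₁, hz₂, hy₃⟩

end IsHalf
end

noncomputable section

/-- A point of the Kummer surface which is `2`-adically close to the origin, in the direction of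
the point at infinity. -/
structure IsFar (i : ℕ) (α β u κ : ℤ) : Prop where
  point : IsKummerPoint (64 * (4 ^ i) ^ 3 * α) (16 * (4 ^ i) ^ 2 * β) (4 * 4 ^ i * u) κ
  α_odd : ¬2 ∣ α
  β_odd : ¬2 ∣ β
  u_odd : ¬2 ∣ u
  κ_odd : ¬2 ∣ κ

theorem IsHalf.exists_isFar {i : ℕ} {x₁ x₂ x₃ x₄ α β u κ : ℤ} (hx : IsKummerPoint x₁ x₂ x₃ x₄)
    (h : IsHalf x₁ x₂ x₃ x₄ (64 * (4 ^ (i + 1)) ^ 3 * α) (16 * (4 ^ (i + 1)) ^ 2 * β)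
      (4 * 4 ^ (i + 1) * u) κ) (hu : ¬2 ∣ u) (hκ : ¬2 ∣ κ) :
    ∃ α' β' u' κ' : ℤ, IsFar i α' β' u' κ' := by
  obtain ⟨h₁, h₂, h₃, hx₄⟩ := h.four_pow_dvd (j := i + 1)
    ⟨16 * (4 ^ (i + 1)) ^ 2 * α, by ring⟩ ⟨4 * 4 ^ (i + 1) * β, by ring⟩ ⟨u, by ring⟩ hκ
  have hc : ∀ n : ℤ, ¬2 ∣ n → IsCoprime (4 ^ (i + 1)) n := fun n hn => by
    rw [show (4 : ℤ) = 2 ^ 2 by norm_num]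
    exact ((Int.prime_two.coprime_iff_not_dvd.2 hn).pow_left).pow_left
  obtain ⟨z₁, z₂, z₃, rfl, rfl, rfl, hz₁, hz₂, hz₃⟩ :=
    h.exists_weighted_of_eq (pow_succ' 4 i) (by positivity) hc hu hκ hx₄ h₁ h₂ h₃
  refine ⟨z₁, z₂, z₃, x₄, ?_, hz₁, hz₂, hz₃, hx₄⟩
  convert hx using 1 <;> ring

theorem odd_emod_eight {n : ℤ} (h : ¬2 ∣ n) : n % 8 ∈ ([1, 3, 5, 7] : List ℤ) := by
  have : n % 8 = 1 ∨ n % 8 = 3 ∨ n % 8 = 5 ∨ n % 8 = 7 := by omega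
  simpa

theorem eq_zero_of_isSquareMod_last : ∀ n ∈ ([1, 3, 5, 7] : List ℤ), ∀ i j k : Fin 2,
    isSquareMod (mulMod (redMod 0 0 0 0 n) (selmerRed i j k)) = true → i = 0 ∧ j = 0 ∧ k = 0 := by
  decide +kernel

theorem not_isSquareMod_last : ∀ n ∈ ([1, 3, 5, 7] : List ℤ), ∀ i j k : Fin 2,
    isSquareMod (mulMod (redMod 0 0 4 0 n) (selmerRed i j k)) ≠ true := by
  decide +kernel

theorem eq_zero_of_isSquareMod_first : ∀ n ∈ ([1, 3, 5, 7] : List ℤ), ∀ i j k : Fin 2,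
    isSquareMod (mulMod (redMod n 0 0 0 0) (selmerRed i j k)) = true → i = 0 ∧ j = 0 ∧ k = 0 := by
  decide +kernel

theorem not_isSquareMod_first : ∀ n ∈ ([1, 3, 5, 7] : List ℤ), ∀ c ∈ ([2, 6] : List ℤ),
    ∀ i j k : Fin 2, isSquareMod (mulMod (redMod n 0 0 c 0) (selmerRed i j k)) ≠ true := by
  decide +kernel

namespace IsFar
variable {K : Type*} [Field K] [NumberField K] {s : K} {i : ℕ} {α β u κ : ℤ}

theorem hasRed (h : IsFar i α β u κ) (hs : IsFifthRoot s) :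
    ∃ g, HasRed s (vec s ((4 * 4 ^ i * u : ℤ) / (64 * (4 ^ i) ^ 3 * α : ℤ)) (1 / 2) 0
      (-((16 * (4 ^ i) ^ 2 * β : ℤ) / (64 * (4 ^ i) ^ 3 * α : ℤ)) / 6) 0 * g ^ 2)
      (redMod (144 * (4 ^ i) ^ 2 * α ^ 2) 0 (-12 * 4 ^ i * α * β) 0 (α * u)) := by
  refine ⟨_, h.point.hasRed hs (1 / (16 * (4 ^ i) ^ 2)) ?_ ?_ ?_⟩ <;>
  · push_cast
    field_simp
    ring

theorem ne (h : IsFar i α β u κ) : (16 * (4 ^ i) ^ 2 * β) ^ 2 ≠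
    4 * (64 * (4 ^ i) ^ 3 * α) * (4 * 4 ^ i * u) := by
  intro hd
  have hβ : β ^ 2 = 2 * (2 * α * u) := by
    apply mul_left_cancel₀ (show (256 * (4 ^ i) ^ 4 : ℤ) ≠ 0 by positivity)
    linear_combination hd
  exact h.β_odd (Int.prime_two.dvd_of_dvd_pow ⟨_, hβ⟩)

theorem eq_false (hs : IsFifthRoot s) (h : IsFar i α β u κ) : False := by
  induction i generalizing α β u κ with
  | zero =>
    obtain ⟨g, hg⟩ := h.hasRed hs
    have hc : -12 * 4 ^ 0 * α * β ≡ 4 [ZMOD 8] := by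
      have := (Int.prime_two.not_dvd_mul h.α_odd h.β_odd)
      generalize e : α * β = m at this
      rw [show -12 * 4 ^ 0 * α * β = -12 * m by rw [← e]; ring, Int.ModEq]
      omega
    rw [redMod_congr (show _ ≡ 0 [ZMOD 8] from Int.modEq_zero_iff_dvd.2
      ⟨18 * (4 ^ 0) ^ 2 * α ^ 2, by ring⟩) rfl hc rfl (Int.mod_modEq (α * u) 8).symm] at hg
    obtain ⟨i, j, k, hijk, -⟩ := h.point.exists_isSquareMod hs hg
    exact not_isSquareMod_last _ (odd_emod_eight (Int.prime_two.not_dvd_mul h.α_odd h.u_odd))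
      i j k hijk
  | succ i ih =>
    obtain ⟨g, hg⟩ := h.hasRed hs
    rw [redMod_congr (show _ ≡ 0 [ZMOD 8] from Int.modEq_zero_iff_dvd.2
      ⟨18 * (4 ^ (i + 1)) ^ 2 * α ^ 2, by ring⟩) rfl (show _ ≡ 0 [ZMOD 8] from
      Int.modEq_zero_iff_dvd.2 ⟨-6 * 4 ^ i * α * β, by ring⟩) rfl
      (Int.mod_modEq (α * u) 8).symm] at hg
    obtain ⟨x₁, x₂, x₃, x₄, hx, hxk⟩ := h.point.exists_isHalf hs h.ne hg
      (eq_zero_of_isSquareMod_last _ (odd_emod_eight (Int.prime_two.not_dvd_mul h.α_odd h.u_odd)))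
    obtain ⟨α', β', u', κ', h'⟩ := hxk.exists_isFar hx h.u_odd h.κ_odd
    exact ih h'

end IsFar

theorem even_of_sq_eq_two_pow_mul {e : ℕ} : ∀ {w c : ℤ}, w ^ 2 = 2 ^ e * c → ¬2 ∣ c → Even e := by
  induction e using Nat.twoStepInduction with
  | zero => simp
  | one =>
    intro w c h hc
    obtain ⟨v, rfl⟩ : 2 ∣ w := Int.prime_two.dvd_of_dvd_pow ⟨c, by rw [h, pow_one]⟩
    exact absurd ⟨v ^ 2, by linarith⟩ hc
  | more e ih _ =>
    intro w c h hc
    obtain ⟨v, rfl⟩ : 2 ∣ w := Int.prime_two.dvd_of_dvd_pow ⟨2 ^ (e + 1) * c, by rw [h]; ring⟩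
    refine (ih (w := v) (c := c) ?_ hc).add even_two
    apply mul_left_cancel₀ (show (4 : ℤ) ≠ 0 by decide)
    linear_combination h

variable {K : Type*} [Field K] [NumberField K] {s : K} {x y : ℚ}

theorem not_two_dvd_num (hx : 2 ∣ x.den) : ¬2 ∣ x.num := fun h => by
  have := Nat.dvd_gcd (Int.natAbs_dvd_natAbs.2 h) hx
  rw [x.reduced.gcd_eq_one] at this
  exact absurd this (by decide)

theorem exists_den_eq_four_pow_mul (hxy : y ^ 2 = 4 * x ^ 5 - 3) (hx : 2 ∣ x.den) :
    ∃ (m : ℕ) (d : ℤ), ¬2 ∣ d ∧ (x.den : ℤ) = 4 ^ (m + 1) * d := by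
  obtain ⟨d, hd, hd2⟩ :=
    (Int.finiteMultiplicity_iff (a := 2).2
      ⟨by decide, Int.natCast_ne_zero.2 x.den_nz⟩).exists_eq_pow_mul_and_not_dvd
  generalize multiplicity 2 (x.den : ℤ) = e at hd
  obtain ⟨D, hD⟩ : (2 : ℤ) ∣ x.den := by exact_mod_cast hx
  have hn := not_two_dvd_num hx
  have hxn := x.mul_den_eq_num
  have hDq : (x.den : ℚ) = 2 * D := by exact_mod_cast congrArg (Int.cast : ℤ → ℚ) hD
  obtain ⟨w, hw⟩ : IsSquare (2 ^ (e + 2) * (d * (x.num ^ 5 - 24 * D ^ 5))) := by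
    rw [← Rat.isSquare_intCast_iff]
    refine ⟨y * x.den ^ 3, ?_⟩
    have hdq : (2 : ℚ) ^ e * d = x.den := by exact_mod_cast (congrArg (Int.cast : ℤ → ℚ) hd).symm
    push_cast
    rw [pow_add, show (2 : ℚ) ^ e * 2 ^ 2 * (d * (x.num ^ 5 - 24 * D ^ 5)) =
      4 * (2 ^ e * d) * (x.num ^ 5 - 24 * D ^ 5) by ring, hdq, ← hxn, hDq]
    linear_combination -(2 * D : ℚ) ^ 6 * hxy
  have he : Even (e + 2) := by
    refine even_of_sq_eq_two_pow_mul (w := w) (by rw [hw, sq])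
      (Int.prime_two.not_dvd_mul hd2 fun h => hn ?_)
    exact Int.prime_two.dvd_of_dvd_pow (n := 5) (by omega)
  obtain ⟨m, hm⟩ := he
  obtain ⟨m, rfl⟩ : ∃ k, m = k + 2 := by
    refine Nat.exists_eq_add_of_le' ?_
    by_contra! hm2
    obtain rfl : e = 0 := by omega
    rw [pow_zero, one_mul] at hd
    exact hd2 ⟨D, by rw [← hd, hD]⟩
  obtain rfl : e = 2 * (m + 1) := by omega
  exact ⟨m, d, hd2, by rw [hd, pow_mul]; norm_num⟩

theorem IsFifthRoot.not_two_dvd_den (h : IsFifthRoot s) (hxy : y ^ 2 = 4 * x ^ 5 - 3) :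
    ¬2 ∣ x.den := by
  intro hx
  obtain ⟨m, d, hd, hxd⟩ := exists_den_eq_four_pow_mul hxy hx
  have hn := not_two_dvd_num hx
  have hd0 : d ≠ 0 := by rintro rfl; exact hd (dvd_zero 2)
  have hdq : (d : ℚ) ≠ 0 := by exact_mod_cast hd0
  have hxq : x * (4 ^ (m + 1) * d) = x.num := by
    have := x.mul_den_eq_num
    rw [show (x.den : ℚ) = (4 ^ (m + 1) * d : ℤ) by rw [← hxd]; simp] at this
    push_cast at this
    exact this
  generalize x.num = n at *
  have hg := hasRed_vec (s := s) (9 * n * d) 0 0 (-6 * 4 ^ m * d ^ 2) 0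
  have hnd := Int.prime_two.not_dvd_mul (Int.prime_two.not_dvd_mul (a := 9) (by decide) hn) hd
  have e : vec s (9 * n * d : ℤ) (0 : ℤ) (0 : ℤ) (-6 * 4 ^ m * d ^ 2 : ℤ) (0 : ℤ) =
      vec s x 0 0 (-1 / 6) 0 * ((3 * 2 ^ (m + 1) * d : ℤ) : K) ^ 2 := by
    have e := congrArg (Rat.cast : ℚ → K) hxq
    have h4 : (2 : K) ^ (m + 1) * 2 ^ (m + 1) = 4 * 4 ^ m := by
      rw [← mul_pow, ← pow_succ']; norm_num
    simp only [vec]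
    push_cast at *
    linear_combination -9 * (d : K) * e - 9 * d ^ 2 * (x - s ^ 3 / 6) * h4
  rw [e] at hg
  rcases m with - | m
  · rw [redMod_congr (Int.mod_modEq _ 8).symm rfl rfl (Int.mod_modEq _ 8).symm rfl] at hg
    obtain ⟨i, j, k, hijk, -⟩ := h.exists_isSquareMod_point hxy hg
    refine not_isSquareMod_first _ (odd_emod_eight hnd) _ ?_ i j k hijk
    have := Int.prime_two.not_dvd_mul hd hd
    generalize e : d * d = m at this
    rw [show -6 * 4 ^ 0 * d ^ 2 = -6 * m by rw [← e]; ring]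
    have : -6 * m % 8 = 2 ∨ -6 * m % 8 = 6 := by omega
    simpa
  rw [redMod_congr (Int.mod_modEq _ 8).symm rfl rfl (show _ ≡ 0 [ZMOD 8] from
    Int.modEq_zero_iff_dvd.2 ⟨-3 * 4 ^ m * d ^ 2, by ring⟩) rfl] at hg
  obtain ⟨i, j, k, hijk, hsq⟩ := h.exists_isSquareMod_point hxy hg
  obtain ⟨hi, hj, hk⟩ := eq_zero_of_isSquareMod_first _ (odd_emod_eight hnd) i j k hijk
  obtain ⟨σ, ρ, β₁, β₀, r, hM, h₁, h₂, h₃, h₄⟩ := h.exists_delta_eq_of_point hxy (hsq hi hj hk)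
  have hx : x = n / (4 ^ (m + 1 + 1) * d) := by
    rw [← hxq]
    field_simp
  obtain ⟨x₁, x₂, x₃, x₄, hK, hH⟩ := exists_isHalf_of_delta_eq hM
    (r := r / (4 ^ (m + 1 + 1) * d) ^ 2) (k₁ := 64 * (4 ^ (m + 1)) ^ 3 * 0)
    (k₂ := 16 * (4 ^ (m + 1)) ^ 2 * d ^ 2) (k₃ := 4 * 4 ^ (m + 1) * (n * d)) (k₄ := n ^ 2)
    (by rw [h₁]; push_cast; ring)
    (by rw [h₂]; push_cast; field_simp; ring)
    (by rw [h₃, hx]; push_cast; field_simp; ring)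
    (by rw [h₄, hx]; push_cast; field_simp)
  obtain ⟨α', β', u', κ', h'⟩ := hH.exists_isFar hK (Int.prime_two.not_dvd_mul hn hd)
    (fun h2 => hn (Int.prime_two.dvd_of_dvd_pow h2))
  exact h'.eq_false h

theorem exists_redEight (hx : ¬2 ∣ x.den) : ∃ a, RedEight x a := by
  have hd : ¬2 ∣ (x.den : ℤ) := by exact_mod_cast hx
  refine ⟨_, x.num * x.den, x.den * x.den, rfl, by push_cast; exact_mod_cast cast_sq_eq_one hd, ?_⟩
  push_cast
  rw [← mul_assoc, x.mul_den_eq_num]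

end

theorem rational_points_4x5_minus_3 (x y : ℚ) (h : y ^ 2 = 4 * x ^ 5 - 3) :
    x = 1 ∧ (y = 1 ∨ y = -1) := by
  obtain ⟨K, _, _, s, hs⟩ := exists_isFifthRoot
  obtain ⟨a, ha⟩ := exists_redEight (hs.not_two_dvd_den h)
  obtain ⟨b, -, hb⟩ := RedEight.exists_of_sq (p := y) (by
    rw [h]
    exact ((RedEight.ofNat 4).mul (ha.pow 5)).sub (RedEight.ofNat 3))
  have key : ∀ a b : ZMod 8, b ^ 2 = 4 * a ^ 5 - 3 → a = 1 ∨ a = 3 ∨ a = 5 ∨ a = 7 := by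
    decide +kernel
  rcases key a b hb with rfl | rfl | rfl | rfl
  · obtain rfl := hs.eq_one_of_redEight_one h ha
    exact ⟨rfl, sq_eq_sq_iff_eq_or_eq_neg.1 (by rw [h]; norm_num)⟩
  · exact (hs.not_redEight_three h (a := 3) (Or.inl rfl) (ha.congr (by decide))).elim
  · exact (hs.not_redEight_five h ha).elim
  · exact (hs.not_redEight_three h (a := 7) (Or.inr rfl) (ha.congr (by decide))).elim
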